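/- Every 2-connected cubic simple graph G on n ≥ 8 vertices admits a tour of length at most (4/3 − 1/61236)·n − 2. -/

import Mathlib

open SimpleGraph

set_option linter.unusedSectionVars false
set_option linter.unusedVariables false
set_option linter.style.longLine false

section TJ
variable {V : Type*} [Fintype V] [DecidableEq V]
open Finset

/-- boundary mod 2 -/
def bd (J : Finset (Sym2 V)) (v : V) : ZMod 2 := ∑ e ∈ J, if v ∈ e then 1 else 0

/-- crossing -/
def crs (X : Finset V) (e : Sym2 V) : Prop := ∃ u ∈ X, ∃ v ∉ X, e = s(u,v)

noncomputable instance (X : Finset V) : DecidablePred (crs X) := fun _ => Classical.dec _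

def dl (x : V) : V → ZMod 2 := fun v => if v = x then 1 else 0

lemma zm_two : (2 : V → ZMod 2) = 0 := by funext v; rfl

lemma sum_symmDiff_zmod (f : Sym2 V → ZMod 2) (A B : Finset (Sym2 V)) :
    ∑ e ∈ symmDiff A B, f e = ∑ e ∈ A, f e + ∑ e ∈ B, f e := by
  have h1 : symmDiff A B = (A \ B) ∪ (B \ A) := by rfl
  rw [h1, sum_union (by
    rw [Finset.disjoint_left]; intro a ha hb; simp at ha hb; tauto)]
  have h2 := Finset.sum_inter_add_sum_sdiff A B f
  have h3 := Finset.sum_inter_add_sum_sdiff B A f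
  rw [inter_comm] at h3
  rw [← h2, ← h3]
  have two : (2 : ZMod 2) = 0 := rfl
  linear_combination (-∑ e ∈ A ∩ B, f e) * two

lemma bd_symmDiff (A B : Finset (Sym2 V)) : bd (symmDiff A B) = bd A + bd B := by
  funext v; exact sum_symmDiff_zmod _ A B

lemma bd_single {u v : V} (h : u ≠ v) : bd {s(u,v)} = dl u + dl v := by
  funext x
  simp only [bd, sum_singleton, dl, Pi.add_apply, Sym2.mem_iff]
  by_cases h1 : x = u
  · subst h1; simp [h]
  · by_cases h2 : x = v
    · subst h2; simp [h1]
    · simp [h1, h2]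

lemma bd_empty : bd (∅ : Finset (Sym2 V)) = 0 := by funext x; simp [bd]

lemma crs_mk {X : Finset V} {u v : V} : crs X s(u,v) ↔ (u ∈ X ∧ v ∉ X) ∨ (v ∈ X ∧ u ∉ X) := by
  unfold crs
  constructor
  · rintro ⟨a, ha, b, hb, h⟩
    rw [Sym2.eq_iff] at h
    rcases h with ⟨rfl, rfl⟩ | ⟨rfl, rfl⟩
    · left; exact ⟨ha, hb⟩
    · right; exact ⟨ha, hb⟩
  · rintro (⟨h1, h2⟩ | ⟨h1, h2⟩)
    · exact ⟨u, h1, v, h2, rfl⟩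
    · exact ⟨v, h1, u, h2, Sym2.eq_swap⟩

lemma sum_bd (X : Finset V) (J : Finset (Sym2 V)) (hJ : ∀ e ∈ J, ¬ e.IsDiag) :
    ∑ v ∈ X, bd J v = ((J.filter (crs X)).card : ZMod 2) := by
  unfold bd
  rw [sum_comm, card_filter, Nat.cast_sum]
  apply sum_congr rfl
  intro e he
  have := hJ e he
  induction e using Sym2.ind with
  | _ u v =>
    have huv : u ≠ v := by simpa using this
    have h1 : ∀ x, (if x ∈ s(u,v) then (1:ZMod 2) else 0) = dl u x + dl v x := by
      intro x; have := congrFun (bd_single huv) x; rw [bd, sum_singleton] at this; exact this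
    simp only [h1, sum_add_distrib, dl, sum_ite_eq', crs_mk]
    by_cases hu : u ∈ X <;> by_cases hv : v ∈ X <;> simp [hu, hv]
    rfl

lemma walk_bd {G' : SimpleGraph V} {u v : V} (p : G'.Walk u v) :
    ∃ C : Finset (Sym2 V), (∀ e ∈ C, e ∈ G'.edgeSet) ∧ bd C = dl u + dl v := by
  induction p with
  | @nil a =>
    refine ⟨∅, by simp, ?_⟩
    rw [bd_empty]; linear_combination (- dl a) * (zm_two (V := V))
  | cons h p ih =>
    rename_i a b c
    obtain ⟨C, h1, h2⟩ := ih
    refine ⟨symmDiff C {s(a,b)}, ?_, ?_⟩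
    · intro e he
      rw [mem_symmDiff] at he
      rcases he with he | he
      · exact h1 e he.1
      · have := he.1; simp at this; subst this; exact h
    · rw [bd_symmDiff, h2, bd_single h.ne]
      linear_combination dl b * (zm_two (V := V))

lemma sum_exch (f : Sym2 V → ℕ) (A B C : Finset (Sym2 V)) (h : C ⊆ symmDiff A B) :
    ∑ e ∈ symmDiff A C, f e + ∑ e ∈ symmDiff B C, f e = ∑ e ∈ A, f e + ∑ e ∈ B, f e := by
  have key : ∀ S : Finset (Sym2 V), ∑ e ∈ S, f e = ∑ e, if e ∈ S then f e else 0 := by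
    intro S; simp
  rw [key, key, key A, key B, ← sum_add_distrib, ← sum_add_distrib]
  apply sum_congr rfl
  intro e _
  have := @h e
  simp only [mem_symmDiff] at this ⊢
  by_cases h1 : e ∈ A <;> by_cases h2 : e ∈ B <;> by_cases h3 : e ∈ C <;> simp_all

lemma sum_symmDiff_zero (f : Sym2 V → ℕ) (A P : Finset (Sym2 V)) (h : ∀ e ∈ P, f e = 0) :
    ∑ e ∈ symmDiff A P, f e = ∑ e ∈ A, f e := by
  have key : ∀ S : Finset (Sym2 V), ∑ e ∈ S, f e = ∑ e, if e ∈ S then f e else 0 := by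
    intro S; simp
  rw [key, key A]
  apply sum_congr rfl
  intro e _
  have := h e
  simp only [mem_symmDiff] at this ⊢
  by_cases h1 : e ∈ A <;> by_cases h3 : e ∈ P <;> simp_all

lemma weight_parity (w : Sym2 V → ℕ) (c : V → ZMod 2) (J : Finset (Sym2 V))
    (hJ : ∀ e ∈ J, ¬ e.IsDiag)
    (hw : ∀ u v, s(u,v) ∈ J → (w s(u,v) : ZMod 2) = c u + c v) :
    ((∑ e ∈ J, w e : ℕ) : ZMod 2) = ∑ v, c v * bd J v := by
  unfold bd
  simp only [mul_sum]
  rw [sum_comm, Nat.cast_sum]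
  apply sum_congr rfl
  intro e he
  have := hJ e he
  induction e using Sym2.ind with
  | _ u v =>
    have huv : u ≠ v := by simpa using this
    have h1 : ∀ x, (if x ∈ s(u,v) then (1:ZMod 2) else 0) = dl u x + dl v x := by
      intro x; have := congrFun (bd_single huv) x; rw [bd, sum_singleton] at this; exact this
    simp only [h1, mul_add, sum_add_distrib, dl]
    simp [hw u v he]

end TJ

set_option linter.unusedSectionVars false
set_option linter.unusedVariables false

section TJ2
variable {V : Type*} [Fintype V] [DecidableEq V]
open Finset

lemma sd_sub {A B E : Finset (Sym2 V)} (hA : A ⊆ E) (hB : B ⊆ E) : symmDiff A B ⊆ E := by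
  intro e he
  rw [mem_symmDiff] at he
  rcases he with he | he
  · exact hA he.1
  · exact hB he.1

theorem tjoin (E : Finset (Sym2 V)) (hE : ∀ e ∈ E, ¬ e.IsDiag) (T : V → ZMod 2)
    (hT : ∃ J ⊆ E, bd J = T)
    (h3 : ∀ X : Finset V, ∑ v ∈ X, T v = 1 → 3 ≤ (E.filter (crs X)).card) :
    ∀ (N : ℕ) (w : Sym2 V → ℕ) (c : V → ZMod 2)
      (_ : ∀ u v, s(u,v) ∈ E → (w s(u,v) : ZMod 2) = c u + c v)
      (_ : ∑ e ∈ E, w e = N), ∃ J ⊆ E, bd J = T ∧ 3 * ∑ e ∈ J, w e ≤ ∑ e ∈ E, w e := by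
  intro N
  induction N using Nat.strong_induction_on with
  | _ N IH =>
  intro w c hw hN
  classical
  -- minimal T-join
  obtain ⟨J, hJ, hJmin⟩ := Finset.exists_min_image (E.powerset.filter (fun J => bd J = T))
    (fun J => ∑ e ∈ J, w e) (by obtain ⟨J, h1, h2⟩ := hT; exact ⟨J, by simp [h1, h2]⟩)
  simp only [mem_filter, mem_powerset, and_imp] at hJ hJmin
  by_cases hz : ∑ e ∈ J, w e = 0
  · exact ⟨J, hJ.1, hJ.2, by rw [hz]; simp⟩
  obtain ⟨e, heJ, hew⟩ : ∃ e ∈ J, w e ≠ 0 := by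
    by_contra hcon; push Not at hcon; exact hz (sum_eq_zero hcon)
  induction e using Sym2.ind with
  | _ x0 y =>
  have hxy : x0 ≠ y := by simpa using hE _ (hJ.1 heJ)
  -- minimal pair
  obtain ⟨⟨J0, b⟩, hJ0, hJ0min⟩ := Finset.exists_min_image
    ((E.powerset ×ˢ (univ : Finset V)).filter (fun p => bd p.1 = T + dl x0 + dl p.2))
    (fun p => ∑ e ∈ p.1, w e) ⟨(symmDiff J {s(x0,y)}, y), by
      simp only [mem_filter, mem_product, mem_powerset, mem_univ, and_true]
      refine ⟨sd_sub hJ.1 (by simpa using hJ.1 heJ), ?_⟩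
      rw [bd_symmDiff, hJ.2, bd_single hxy]; ring⟩
  simp only [mem_filter, mem_product, mem_powerset, mem_univ, and_true, and_imp, Prod.forall] at hJ0 hJ0min
  have hsing : ∀ (A : Finset (Sym2 V)) (e : Sym2 V), e ∈ A →
      ∑ f ∈ symmDiff A {e}, w f + w e = ∑ f ∈ A, w f := by
    intro A e he
    have : symmDiff A {e} = A.erase e := by
      ext f; simp only [mem_symmDiff, mem_singleton, mem_erase]
      by_cases h : f = e
      · subst h; simp [he]
      · simp [h]
    rw [this]; exact Finset.sum_erase_add _ _ he
  have hlt : ∑ e ∈ J0, w e < ∑ e ∈ J, w e := by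
    have h1 := hJ0min (symmDiff J {s(x0,y)}) y (sd_sub hJ.1 (by simpa using hJ.1 heJ)) (by
      rw [bd_symmDiff, hJ.2, bd_single hxy]; ring)
    have h2 := hsing J _ heJ
    omega
  -- zero-weight graph
  let Z : SimpleGraph V := SimpleGraph.fromRel (fun u v => s(u,v) ∈ E ∧ w s(u,v) = 0)
  have hZ : ∀ u v, Z.Adj u v ↔ s(u,v) ∈ E ∧ w s(u,v) = 0 := by
    intro u v
    simp only [Z, SimpleGraph.fromRel_adj]
    constructor
    · rintro ⟨_, h | h⟩
      · exact h
      · rw [Sym2.eq_swap]; exact h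
    · intro h; refine ⟨by simpa using hE _ h.1, Or.inl h⟩
  let X : Finset V := univ.filter (fun u => Z.Reachable b u)
  have hX : ∀ u, u ∈ X ↔ Z.Reachable b u := by simp [X]
  have hbX : b ∈ X := by rw [hX]
  have hP : ∀ u ∈ X, ∃ P ⊆ E, (∀ e ∈ P, w e = 0) ∧ (∀ e ∈ P, ¬ crs X e) ∧ bd P = dl b + dl u := by
    intro u hu
    rw [hX] at hu
    obtain ⟨p⟩ := hu
    obtain ⟨C, h1, h2⟩ := walk_bd p
    refine ⟨C, ?_, ?_, ?_, h2⟩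
    · intro e he
      have := h1 e he
      induction e using Sym2.ind with
      | _ s t => exact ((hZ s t).1 this).1
    · intro e he
      have := h1 e he
      induction e using Sym2.ind with
      | _ s t => exact ((hZ s t).1 this).2
    · intro e he
      have := h1 e he
      induction e using Sym2.ind with
      | _ s t =>
        have hst : Z.Adj s t := this
        rw [crs_mk, hX, hX]
        have h3 : Z.Reachable b s ↔ Z.Reachable b t :=
          ⟨fun h => h.trans hst.reachable, fun h => h.trans hst.symm.reachable⟩
        tauto
  have hcr1 : ∀ e ∈ E, crs X e → 1 ≤ w e := by
    rintro e he ⟨u, hu, v, hv, rfl⟩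
    by_contra hc
    apply hv
    rw [hX] at hu ⊢
    exact hu.trans (SimpleGraph.Adj.reachable ((hZ u v).2 ⟨he, by omega⟩))
  have hcZ : ∀ s t, Z.Walk s t → c s = c t := by
    intro s t p
    induction p with
    | nil => rfl
    | @cons a1 b1 c1 h p ih =>
      rw [← ih]
      have h1 := (hZ _ _).1 h
      have h2 := hw _ _ h1.1
      rw [h1.2] at h2
      have two : (2 : ZMod 2) = 0 := rfl
      push_cast at h2
      linear_combination - h2 - c b1 * two
  have hcX : ∀ u ∈ X, c u = c b := by
    intro u hu
    rw [hX] at hu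
    obtain ⟨p⟩ := hu
    exact (hcZ _ _ p).symm
  have hJ0cr : ∀ e ∈ J0, ¬ crs X e := by
    rintro e he ⟨i, hi, o, ho, rfl⟩
    obtain ⟨P, hP1, hP2, hP3, hP4⟩ := hP i hi
    have hio : i ≠ o := by rintro rfl; exact ho hi
    have h1 := hJ0min (symmDiff (symmDiff J0 {s(i,o)}) P) o
      (sd_sub (sd_sub hJ0.1 (by simpa using hJ0.1 he)) hP1) (by
        rw [bd_symmDiff, bd_symmDiff, bd_single hio, hP4, hJ0.2]
        linear_combination (dl b + dl i) * (zm_two (V := V)))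
    rw [sum_symmDiff_zero _ _ _ hP2] at h1
    have h2 := hsing J0 _ he
    have h4 := hcr1 _ (hJ0.1 he) ⟨i, hi, o, ho, rfl⟩
    omega
  have hx0 : x0 ∉ X := by
    intro h
    obtain ⟨P, hP1, hP2, hP3, hP4⟩ := hP x0 h
    have := hJmin (symmDiff J0 P) (sd_sub hJ0.1 hP1) (by
      rw [bd_symmDiff, hJ0.2, hP4]
      linear_combination (dl b + dl x0) * (zm_two (V := V)))
    rw [sum_symmDiff_zero _ _ _ hP2] at this
    omega
  have hTX : ∑ v ∈ X, T v = 1 := by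
    have h1 := sum_bd X J0 (fun e he => hE e (hJ0.1 he))
    have h2 : J0.filter (crs X) = ∅ := by
      rw [filter_eq_empty_iff]; exact fun e he => hJ0cr e he
    rw [h2, hJ0.2] at h1
    simp only [Pi.add_apply, sum_add_distrib, dl, sum_ite_eq', hx0, hbX, if_true, if_false, card_empty, Nat.cast_zero] at h1
    have two : (2 : ZMod 2) = 0 := rfl
    linear_combination h1 - two
  have hE3 := h3 X hTX
  let w' : Sym2 V → ℕ := fun e => w e - (if crs X e then 1 else 0)
  let c' : V → ZMod 2 := fun v => c v + (if v ∈ X then 1 else 0)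
  have hw'E : ∀ S ⊆ E, ∑ e ∈ S, w e = ∑ e ∈ S, w' e + (S.filter (crs X)).card := by
    intro S hS
    rw [card_filter, ← sum_add_distrib]
    apply sum_congr rfl
    intro e he
    simp only [w']
    by_cases h : crs X e
    · have := hcr1 e (hS he) h; simp [h]; omega
    · simp [h]
  have hc' : ∀ u v, s(u,v) ∈ E → (w' s(u,v) : ZMod 2) = c' u + c' v := by
    intro u v huv
    have h1 := hw u v huv
    have two : (2 : ZMod 2) = 0 := rfl
    simp only [w', c']
    by_cases h : crs X s(u,v)
    · have h4 := hcr1 _ huv h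
      rw [if_pos h, Nat.cast_sub h4, h1]
      rw [crs_mk] at h
      rcases h with h | h <;> simp [h] <;> linear_combination - two
    · rw [if_neg h]
      rw [crs_mk] at h
      by_cases hu : u ∈ X
      · have : v ∈ X := by tauto
        simp [hu, this, h1]; linear_combination - two
      · have : v ∉ X := by tauto
        simp [hu, this, h1]
  have hEE := hw'E E (subset_refl _)
  obtain ⟨J', hJ'E, hJ'T, hJ'w⟩ := IH (∑ e ∈ E, w' e) (by omega) w' c' hc' rfl
  -- minimize crossing
  obtain ⟨K, hK, hKmin⟩ := Finset.exists_min_image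
    (E.powerset.filter (fun K => bd K = T ∧ ∑ e ∈ K, w' e ≤ ∑ e ∈ J', w' e))
    (fun K => (K.filter (crs X)).card) ⟨J', by simp [hJ'E, hJ'T]⟩
  simp only [mem_filter, mem_powerset, and_imp] at hK hKmin
  obtain ⟨hKE, hKT, hKw⟩ := hK
  by_cases hone : (K.filter (crs X)).card ≤ 1
  · refine ⟨K, hKE, hKT, ?_⟩
    have := hw'E K hKE
    omega
  exfalso
  let A := symmDiff K J0
  have hAE : A ⊆ E := sd_sub hKE hJ0.1
  have hbdA : bd A = dl x0 + dl b := by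
    simp only [A]; rw [bd_symmDiff, hKT, hJ0.2]; linear_combination T * (zm_two (V := V))
  have hAK : ∀ e, crs X e → (e ∈ A ↔ e ∈ K) := by
    intro e he
    have : e ∉ J0 := fun h => hJ0cr e h he
    simp [A, mem_symmDiff, this]
  let Go : SimpleGraph V := SimpleGraph.fromRel (fun u v => s(u,v) ∈ A ∧ u ∉ X ∧ v ∉ X)
  have hGo : ∀ u v, Go.Adj u v ↔ s(u,v) ∈ A ∧ u ∉ X ∧ v ∉ X := by
    intro u v
    simp only [Go, SimpleGraph.fromRel_adj]
    constructor
    · rintro ⟨_, h | h⟩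
      · exact h
      · rw [Sym2.eq_swap]; exact ⟨h.1, h.2.2, h.2.1⟩
    · intro h; refine ⟨by simpa using hE _ (hAE h.1), Or.inl h⟩
  have hstep : ∀ i1 o1, i1 ∈ X → o1 ∉ X → s(i1,o1) ∈ A → ¬ Go.Reachable o1 x0 →
      ∃ i2 o2, i2 ∈ X ∧ o2 ∉ X ∧ s(i2,o2) ∈ A ∧ s(i1,o1) ≠ s(i2,o2) ∧ Go.Reachable o1 o2 := by
    intro i1 o1 hi1 ho1 he1 hnr
    let Y : Finset V := univ.filter (fun u => Go.Reachable o1 u)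
    have hY : ∀ u, u ∈ Y ↔ Go.Reachable o1 u := by simp [Y]
    have hYX : ∀ u ∈ Y, u ∉ X := by
      intro u hu
      rw [hY] at hu
      obtain ⟨p⟩ := hu
      by_cases hl : p.length = 0
      · have := p.eq_of_length_eq_zero hl; subst this; exact ho1
      · have hnn : ¬ p.Nil := by
          intro h; exact hl (SimpleGraph.Walk.length_eq_zero_iff.2 h)
        have := p.adj_penultimate hnn
        exact ((hGo _ _).1 this).2.2
    have h1 := sum_bd Y A (fun e he => hE e (hAE he))
    have hxY : x0 ∉ Y := by rw [hY]; exact hnr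
    have hbY : b ∉ Y := fun h => hYX b h hbX
    rw [hbdA] at h1
    simp only [Pi.add_apply, sum_add_distrib, dl, sum_ite_eq', hxY, hbY, if_false, add_zero] at h1
    have h1' : Even (A.filter (crs Y)).card := by
      rw [← ZMod.natCast_eq_zero_iff_even]; exact h1.symm
    have hm : s(i1,o1) ∈ A.filter (crs Y) := by
      rw [mem_filter]; refine ⟨he1, ?_⟩
      rw [crs_mk]; right; exact ⟨by rw [hY], fun h => hYX _ h hi1⟩
    have h2 : 1 < (A.filter (crs Y)).card := by
      have : 0 < (A.filter (crs Y)).card := card_pos.2 ⟨_, hm⟩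
      obtain ⟨r, hr⟩ := h1'
      omega
    obtain ⟨e2, he2, hne⟩ := exists_mem_ne h2 s(i1,o1)
    rw [mem_filter] at he2
    obtain ⟨he2A, o2, ho2, i2, hi2, rfl⟩ := he2
    have hi2X : i2 ∈ X := by
      by_contra hc
      apply hi2
      rw [hY] at ho2 ⊢
      exact ho2.trans (SimpleGraph.Adj.reachable ((hGo _ _).2 ⟨he2A, hYX _ (by rw [hY]; exact ho2), hc⟩))
    exact ⟨i2, o2, hi2X, hYX _ ho2, by rw [Sym2.eq_swap]; exact he2A, by rw [Sym2.eq_swap (a := i2)]; exact hne.symm, (hY _).1 ho2⟩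
  have hpair : ∃ i1 o1 i2 o2, i1 ∈ X ∧ o1 ∉ X ∧ s(i1,o1) ∈ A ∧ i2 ∈ X ∧ o2 ∉ X ∧ s(i2,o2) ∈ A ∧
      s(i1,o1) ≠ s(i2,o2) ∧ Go.Reachable o1 o2 := by
    obtain ⟨e1, he1, e2, he2, hne⟩ := one_lt_card.1 (not_le.1 hone)
    rw [mem_filter] at he1 he2
    have h1A := (hAK _ he1.2).2 he1.1
    have h2A := (hAK _ he2.2).2 he2.1
    obtain ⟨_, i1, hi1, o1, ho1, rfl⟩ := he1
    obtain ⟨_, i2, hi2, o2, ho2, rfl⟩ := he2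
    by_cases r1 : Go.Reachable o1 x0
    · by_cases r2 : Go.Reachable o2 x0
      · exact ⟨i1, o1, i2, o2, hi1, ho1, h1A, hi2, ho2, h2A, hne, r1.trans r2.symm⟩
      · obtain ⟨i3, o3, h⟩ := hstep i2 o2 hi2 ho2 h2A r2
        exact ⟨i2, o2, i3, o3, hi2, ho2, h2A, h.1, h.2.1, h.2.2.1, h.2.2.2⟩
    · obtain ⟨i3, o3, h⟩ := hstep i1 o1 hi1 ho1 h1A r1
      exact ⟨i1, o1, i3, o3, hi1, ho1, h1A, h.1, h.2.1, h.2.2.1, h.2.2.2⟩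
  obtain ⟨i1, o1, i2, o2, hi1, ho1, h1A, hi2, ho2, h2A, hne, ⟨p⟩⟩ := hpair
  obtain ⟨C, hC1, hC2⟩ := walk_bd p
  have hio1 : i1 ≠ o1 := by rintro rfl; exact ho1 hi1
  have hio2 : i2 ≠ o2 := by rintro rfl; exact ho2 hi2
  have hCA : C ⊆ A := by
    intro e he
    have := hC1 e he
    induction e using Sym2.ind with
    | _ s t => exact ((hGo s t).1 this).1
  have hCX : ∀ e ∈ C, ¬ crs X e := by
    intro e he
    have := hC1 e he
    induction e using Sym2.ind with
    | _ s t => 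
      have := ((hGo s t).1 this).2
      rw [crs_mk]; tauto
  have hcr_1 : crs X s(i1,o1) := ⟨i1, hi1, o1, ho1, rfl⟩
  have hcr_2 : crs X s(i2,o2) := ⟨i2, hi2, o2, ho2, rfl⟩
  generalize he1 : s(i1,o1) = e1 at *
  generalize he2 : s(i2,o2) = e2 at *
  let C0 := symmDiff (symmDiff C {e1}) {e2}
  have hC0A : C0 ⊆ A := sd_sub (sd_sub hCA (by simpa using h1A)) (by simpa using h2A)
  have hC0cr : ∀ e, crs X e → (e ∈ C0 ↔ e = e1 ∨ e = e2) := by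
    intro e he
    have : e ∉ C := fun h => hCX e h he
    simp only [C0, mem_symmDiff, this, mem_singleton]
    grind
  have hbd1 : bd {e1} = dl i1 + dl o1 := by rw [← he1]; exact bd_single hio1
  have hbd2 : bd {e2} = dl i2 + dl o2 := by rw [← he2]; exact bd_single hio2
  have hbdC0 : bd C0 = dl i1 + dl i2 := by
    simp only [C0]; rw [bd_symmDiff, bd_symmDiff, hC2, hbd1, hbd2]
    linear_combination (dl o1 + dl o2) * (zm_two (V := V))
  obtain ⟨P1, hP11, hP12, hP13, hP14⟩ := hP i1 hi1
  obtain ⟨P2, hP21, hP22, hP23, hP24⟩ := hP i2 hi2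
  have hC0E : C0 ⊆ E := hC0A.trans hAE
  have hD1 : e1 ∈ symmDiff J0 C0 := by
    rw [mem_symmDiff]; right
    exact ⟨(hC0cr e1 hcr_1).2 (Or.inl rfl), fun h => hJ0cr _ h hcr_1⟩
  have hD2 : ∑ e ∈ J0, w e + 1 ≤ ∑ e ∈ symmDiff J0 C0, w e := by
    have h1 := hJ0min (symmDiff (symmDiff (symmDiff J0 C0) {e1}) P2) o1
      (sd_sub (sd_sub (sd_sub hJ0.1 hC0E) (by simpa using hAE h1A)) hP21) (by
        rw [bd_symmDiff, bd_symmDiff, bd_symmDiff, hJ0.2, hbdC0, hbd1, hP24]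
        linear_combination (dl i1 + dl i2 + dl b) * (zm_two (V := V)))
    rw [sum_symmDiff_zero _ _ _ hP22] at h1
    have h2 := hsing _ _ hD1
    have := hcr1 e1 (hAE h1A) hcr_1
    omega
  have hD3 : ∑ e ∈ J0, w e + 2 ≤ ∑ e ∈ symmDiff J0 C0, w e := by
    have h1 := weight_parity w c J0 (fun e he => hE e (hJ0.1 he)) (fun u v h => hw u v (hJ0.1 h))
    have h2 := weight_parity w c (symmDiff J0 C0) (fun e he => hE e (sd_sub hJ0.1 hC0E he))
      (fun u v h => hw u v (sd_sub hJ0.1 hC0E h))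
    rw [bd_symmDiff, hbdC0] at h2
    simp only [Pi.add_apply, mul_add, sum_add_distrib] at h2
    rw [← h1] at h2
    have h4 : ∀ i, ∑ v, c v * dl i v = c i := by intro i; simp [dl]
    rw [h4, h4, hcX i1 hi1, hcX i2 hi2, CharTwo.add_self_eq_zero, add_zero] at h2
    have h5 := (ZMod.natCast_eq_natCast_iff' _ _ 2).1 h2
    omega
  have hD4 : ∑ e ∈ J0, w' e ≤ ∑ e ∈ symmDiff J0 C0, w' e := by
    have h1 := hw'E J0 hJ0.1
    have h2 := hw'E (symmDiff J0 C0) (sd_sub hJ0.1 hC0E)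
    have h4 : ((symmDiff J0 C0).filter (crs X)) = {e1, e2} := by
      ext e
      simp only [mem_filter, mem_symmDiff, mem_insert, mem_singleton]
      constructor
      · rintro ⟨h | h, hc⟩
        · exact absurd hc (hJ0cr _ h.1)
        · exact (hC0cr _ hc).1 h.1
      · intro h
        have hc : crs X e := by rcases h with rfl | rfl <;> assumption
        exact ⟨Or.inr ⟨(hC0cr _ hc).2 h, fun h => hJ0cr _ h hc⟩, hc⟩
    rw [h4, card_pair hne] at h2
    omega
  have hD5 := sum_exch w' K J0 C0 hC0A
  have hw0 : ∀ e, w e = 0 → w' e = 0 := by intro e he; simp [w', he]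
  let K2 := symmDiff (symmDiff (symmDiff K C0) P1) P2
  have hK2w : ∑ e ∈ K2, w' e = ∑ e ∈ symmDiff K C0, w' e := by
    simp only [K2]
    rw [sum_symmDiff_zero _ _ _ (fun e he => hw0 e (hP22 e he)), sum_symmDiff_zero _ _ _ (fun e he => hw0 e (hP12 e he))]
  have hfin := hKmin K2 (sd_sub (sd_sub (sd_sub hKE hC0E) hP11) hP21) (by
    simp only [K2]; rw [bd_symmDiff, bd_symmDiff, bd_symmDiff, hKT, hbdC0, hP14, hP24]
    linear_combination (dl i1 + dl i2 + dl b) * (zm_two (V := V))) (by omega)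
  have hlt2 : (K2.filter (crs X)).card < (K.filter (crs X)).card := by
    apply card_lt_card
    rw [Finset.ssubset_iff_of_subset]
    · refine ⟨e1, mem_filter.2 ⟨(hAK e1 hcr_1).1 h1A, hcr_1⟩, ?_⟩
      intro h
      rw [mem_filter] at h
      have h1 : e1 ∉ P1 := fun h => hP13 _ h hcr_1
      have h2 : e1 ∉ P2 := fun h => hP23 _ h hcr_1
      have h3 := (hAK e1 hcr_1).1 h1A
      have h4 := (hC0cr e1 hcr_1).2 (Or.inl rfl)
      simp only [K2, mem_symmDiff, h1, h2, h3, h4] at h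
      simp at h
    · intro e he
      rw [mem_filter] at he ⊢
      refine ⟨?_, he.2⟩
      have h1 : e ∉ P1 := fun h => hP13 _ h he.2
      have h2 : e ∉ P2 := fun h => hP23 _ h he.2
      have h3 : e ∈ C0 → e ∈ K := fun h => (hAK _ he.2).1 (hC0A h)
      have h4 := he.1
      simp only [K2, mem_symmDiff, h1, h2] at h4
      tauto
  omega

end TJ2

set_option linter.unusedSectionVars false
set_option linter.unusedVariables false
set_option linter.unusedSimpArgs false

section PM
variable {V : Type*} [Fintype V] [DecidableEq V]
open Finset

/-- edge finset, classical -/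
noncomputable def eF (G : SimpleGraph V) : Finset (Sym2 V) :=
  @Finset.filter _ (fun e => e ∈ G.edgeSet) (fun _ => Classical.dec _) univ

lemma mem_eF {G : SimpleGraph V} {u v : V} : s(u,v) ∈ eF G ↔ G.Adj u v := by
  simp [eF]

lemma eF_nd {G : SimpleGraph V} : ∀ e ∈ eF G, ¬ e.IsDiag := by
  intro e he
  induction e using Sym2.ind with
  | _ u v => rw [mem_eF] at he; simpa using he.ne

/-- cut size -/
noncomputable def dc (G : SimpleGraph V) (X : Finset V) : ℕ := ((eF G).filter (crs X)).card

def N3 (G : SimpleGraph V) (u : V) : Prop :=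
  ∃ a b c, a ≠ b ∧ a ≠ c ∧ b ≠ c ∧ ∀ x, G.Adj u x ↔ x = a ∨ x = b ∨ x = c

structure Cub (G : SimpleGraph V) (W : Finset V) : Prop where
  supp : ∀ u v, G.Adj u v → u ∈ W
  deg : ∀ u ∈ W, N3 G u
  tec : ∀ X ⊆ W, X.Nonempty → X ≠ W → 2 ≤ dc G X

/-- symmetrised dart weight -/
def sw (g : V → V → ℕ) : Sym2 V → ℕ := Sym2.lift ⟨fun v x => g v x + g x v, fun v x => add_comm _ _⟩

lemma sw_mk (g : V → V → ℕ) (u v : V) : sw g s(u,v) = g u v + g v u := rfl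

lemma sum_sw (g : V → V → ℕ) (J : Finset (Sym2 V)) (hJ : ∀ e ∈ J, ¬ e.IsDiag) :
    ∑ e ∈ J, sw g e = ∑ v, ∑ x, if s(v,x) ∈ J then g v x else 0 := by
  induction J using Finset.induction_on with
  | empty => simp
  | insert e J he ih =>
    rw [sum_insert he, ih (fun f hf => hJ f (mem_insert_of_mem hf))]
    have hd := hJ e (mem_insert_self _ _)
    induction e using Sym2.ind with
    | _ a b =>
      have hab : a ≠ b := by simpa using hd
      have key : ∀ v x, (if s(v,x) ∈ insert s(a,b) J then g v x else 0) =
          (if v = a then (if x = b then g a b else 0) else 0) +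
          (if v = b then (if x = a then g b a else 0) else 0) + (if s(v,x) ∈ J then g v x else 0) := by
        intro v x
        by_cases h : s(v,x) = s(a,b)
        · have h1 : s(v,x) ∈ insert s(a,b) J := by rw [h]; exact mem_insert_self _ _
          have h2 : s(v,x) ∉ J := by rw [h]; exact he
          simp only [h1, h2, if_true, if_false]
          rw [Sym2.eq_iff] at h
          rcases h with ⟨rfl, rfl⟩ | ⟨rfl, rfl⟩
          · simp [hab]
          · simp [hab.symm]
        · have h1 : (s(v,x) ∈ insert s(a,b) J) ↔ s(v,x) ∈ J := by simp only [mem_insert, h, false_or]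
          simp only [h1]
          rw [Sym2.eq_iff] at h
          by_cases h2 : v = a
          · have h3 : x ≠ b := by tauto
            have h4 : v ≠ b := by rw [h2]; exact hab
            rw [if_pos h2, if_neg h3, if_neg h4]; simp
          · by_cases h3 : v = b
            · have h4 : x ≠ a := by tauto
              rw [if_neg h2, if_pos h3, if_neg h4]; simp
            · rw [if_neg h2, if_neg h3]; simp
      simp only [key, sum_add_distrib, sum_ite_eq', mem_univ, if_true, sw_mk]
      simp

lemma Cub.adj_mem {G : SimpleGraph V} {W : Finset V} (h : Cub G W) {u v : V} (huv : G.Adj u v) :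
    u ∈ W ∧ v ∈ W := ⟨h.supp _ _ huv, h.supp _ _ huv.symm⟩

lemma Cub.sum3 {G : SimpleGraph V} {W : Finset V} (h : Cub G W) {M : Type*} [AddCommMonoid M] (t : M) (v : V) :
    (∑ x, if s(v,x) ∈ eF G then t else 0) = if v ∈ W then t + t + t else 0 := by
  by_cases hv : v ∈ W
  · obtain ⟨a, b, c, h1, h2, h3, h4⟩ := h.deg v hv
    rw [if_pos hv, ← sum_filter]
    have : (univ.filter (fun x => s(v,x) ∈ eF G)) = {a, b, c} := by
      ext x; simp [mem_eF, h4]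
    rw [this, sum_insert (by simp [h1, h2]), sum_pair h3, add_assoc]
  · rw [if_neg hv]
    apply sum_eq_zero
    intro x _
    rw [if_neg]; rw [mem_eF]; intro hx; exact hv (h.supp _ _ hx)

lemma bd_eq_sum (J : Finset (Sym2 V)) (v : V) (hJ : ∀ e ∈ J, ¬ e.IsDiag) :
    bd J v = ∑ x, if s(v,x) ∈ J then 1 else 0 := by
  unfold bd
  rw [← sum_filter, ← sum_filter]
  apply sum_bij' (i := fun e he => if h : v ∈ e then Sym2.Mem.other' h else v) (j := fun x _ => s(v,x))
  · intro e he
    rw [mem_filter] at he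
    simp only [he.2, dif_pos, mem_filter, mem_univ, true_and]
    rw [Sym2.other_spec' he.2]; exact he.1
  · intro x hx
    simp only [mem_filter, mem_univ, true_and] at hx ⊢
    simp [hx]
  · intro e he
    rw [mem_filter] at he
    simp only [he.2, dif_pos]
    rw [Sym2.other_spec' he.2]
  · intro x hx
    have hm : v ∈ s(v,x) := by simp
    simp only [hm, dif_pos]
    have := Sym2.other_spec' hm
    rwa [Sym2.congr_right] at this
  · intros; rfl

lemma Cub.bd_eF {G : SimpleGraph V} {W : Finset V} (h : Cub G W) (v : V) :
    bd (eF G) v = if v ∈ W then 1 else 0 := by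
  rw [bd_eq_sum _ _ eF_nd, h.sum3]
  split_ifs
  · rfl
  · rfl

lemma Cub.card_eF {G : SimpleGraph V} {W : Finset V} (h : Cub G W) : 2 * (eF G).card = 3 * W.card := by
  have h1 := sum_sw (fun _ _ => 1) (eF G) eF_nd
  have h2 : ∀ e : Sym2 V, sw (fun _ _ => 1) e = 2 := by
    intro e; induction e using Sym2.ind with | _ u v => rfl
  simp only [h2, h.sum3] at h1
  rw [sum_const, ← sum_filter, sum_const] at h1
  simp at h1
  omega

lemma Cub.even {G : SimpleGraph V} {W : Finset V} (h : Cub G W) : Even W.card := by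
  have := h.card_eF
  rw [Nat.even_iff]; omega

lemma Cub.dc_parity {G : SimpleGraph V} {W : Finset V} (h : Cub G W) {X : Finset V} (hX : X ⊆ W) :
    dc G X % 2 = X.card % 2 := by
  have h1 := sum_bd X (eF G) eF_nd
  have h2 : ∑ v ∈ X, bd (eF G) v = (X.card : ZMod 2) := by
    rw [sum_congr rfl (fun v hv => by rw [h.bd_eF v, if_pos (hX hv)])]
    simp
  rw [h2] at h1
  exact ((ZMod.natCast_eq_natCast_iff' _ _ 2).1 h1).symm

lemma Cub.conn {G : SimpleGraph V} {W : Finset V} (h : Cub G W) {x y : V} (hx : x ∈ W) (hy : y ∈ W) :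
    G.Reachable x y := by
  classical
  by_contra hn
  let X : Finset V := W.filter (fun u => G.Reachable x u)
  have h1 := h.tec X (filter_subset _ _) ⟨x, by simp [X, hx]⟩ (by
    intro he
    have : y ∈ X := by rw [he]; exact hy
    simp [X] at this; exact hn this.2)
  unfold dc at h1
  have h2 : (eF G).filter (crs X) = ∅ := by
    rw [filter_eq_empty_iff]
    rintro e he ⟨u, hu, v, hv, rfl⟩
    rw [mem_eF] at he
    simp only [X, mem_filter] at hu hv
    exact hv ⟨(h.adj_mem he).2, hu.2.trans he.reachable⟩
  rw [h2] at h1; simp at h1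

lemma Cub.exists_tj {G : SimpleGraph V} {W : Finset V} (h : Cub G W) :
    ∃ J ⊆ eF G, bd J = fun v => if v ∈ W then 1 else 0 := by
  classical
  set T : V → ZMod 2 := fun v => if v ∈ W then 1 else 0 with hT
  obtain ⟨J, hJ, hmin⟩ := exists_min_image (eF G).powerset
    (fun J => (univ.filter (fun v => bd J v ≠ T v)).card) ⟨∅, by simp⟩
  rw [mem_powerset] at hJ
  simp only [mem_powerset] at hmin
  refine ⟨J, hJ, ?_⟩
  by_contra hne
  set B := univ.filter (fun v => bd J v ≠ T v) with hB
  have hz : ∀ K : Finset (Sym2 V), K ⊆ eF G → ∀ v, v ∉ W → bd K v = 0 := by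
    intro K hK v hv
    unfold bd
    apply sum_eq_zero
    intro e he
    rw [if_neg]
    intro hve
    have h1 := hK he
    rw [← Sym2.other_spec' hve, mem_eF] at h1
    exact hv (h.supp _ _ h1)
  have hBW : ∀ v ∈ B, v ∈ W := by
    intro v hv
    simp only [hB, mem_filter] at hv
    by_contra hvW
    apply hv.2
    rw [hz J hJ v hvW]; simp [hT, hvW]
  have hBne : B.Nonempty := by
    by_contra he
    rw [not_nonempty_iff_eq_empty] at he
    apply hne
    funext v
    by_contra hv
    have : v ∈ B := by simp [hB]; exact hv
    rw [he] at this; simp at this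
  have hz2 : ∀ z : ZMod 2, z = 0 ∨ z = 1 := by decide
  have hBeven : Even B.card := by
    have h1 := sum_bd univ J (fun e he => eF_nd e (hJ he))
    have h2 : J.filter (crs univ) = ∅ := by
      rw [filter_eq_empty_iff]
      rintro e he ⟨u, hu, v, hv, rfl⟩
      simp at hv
    rw [h2] at h1
    have h4 : ∑ v, T v = 0 := by
      simp only [hT]; rw [sum_ite_mem]; simp
      rw [ZMod.natCast_eq_zero_iff_even]; exact h.even
    have h5 : ∑ v, (bd J v + T v) = 0 := by
      rw [sum_add_distrib, h1, h4]; simp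
    have h6 : ∀ v, bd J v + T v = if bd J v ≠ T v then 1 else 0 := by
      intro v
      rcases hz2 (bd J v) with h | h <;> rcases hz2 (T v) with h' | h' <;> rw [h, h'] <;> decide
    simp only [h6] at h5
    rw [← ZMod.natCast_eq_zero_iff_even]
    rw [← sum_filter] at h5
    simpa using h5
  have hcard : 1 < B.card := by
    have := card_pos.2 hBne
    obtain ⟨r, hr⟩ := hBeven
    omega
  obtain ⟨x, hx, y, hy, hxy⟩ := one_lt_card.1 hcard
  obtain ⟨p⟩ := h.conn (hBW x hx) (hBW y hy)
  obtain ⟨C, hC1, hC2⟩ := walk_bd p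
  have hC3 : C ⊆ eF G := by
    intro e he
    have := hC1 e he
    induction e using Sym2.ind with
    | _ s t => rw [mem_eF]; exact this
  have h1 := hmin (symmDiff J C) (sd_sub hJ hC3)
  have h2 : (univ.filter (fun v => bd (symmDiff J C) v ≠ T v)).card < B.card := by
    apply card_lt_card
    rw [bd_symmDiff, hC2]
    rw [Finset.ssubset_iff_of_subset]
    · refine ⟨x, hx, ?_⟩
      simp only [hB, mem_filter, mem_univ, true_and] at hx ⊢
      simp only [Pi.add_apply, dl, if_true, if_neg hxy]
      rcases hz2 (bd J x) with h | h <;> rcases hz2 (T x) with h' | h' <;> rw [h, h'] at hx ⊢ <;> revert hx <;> decide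
    · intro v hv
      simp only [hB, mem_filter, mem_univ, true_and] at hx hy hv ⊢
      by_cases hvx : v = x
      · subst hvx; exact hx
      · by_cases hvy : v = y
        · subst hvy; exact hy
        · simp only [Pi.add_apply, dl, if_neg hvx, if_neg hvy, add_zero] at hv; exact hv
  omega

end PM

set_option linter.unusedSectionVars false
set_option linter.unusedVariables false

section WPM
variable {V : Type*} [Fintype V] [DecidableEq V]
open Finset

lemma Cub.wpm0 {G : SimpleGraph V} {W : Finset V} (h : Cub G W) (w0 : Sym2 V → ℕ) :
    ∃ J ⊆ eF G, (∀ v ∈ W, ∑ x, (if s(v,x) ∈ J then 1 else 0) = 1) ∧ bd J = (fun v => if v ∈ W then 1 else 0) ∧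
      2 * J.card = W.card ∧ 3 * ∑ e ∈ J, w0 e ≤ ∑ e ∈ eF G, w0 e := by
  classical
  let K := 1 + ∑ e ∈ eF G, w0 e
  obtain ⟨J, hJE, hJT, hJw⟩ := tjoin (eF G) eF_nd (fun v => if v ∈ W then 1 else 0) h.exists_tj (by
    intro X hX
    have h1 : (eF G).filter (crs X) = (eF G).filter (crs (X ∩ W)) := by
      apply filter_congr
      intro e he
      induction e using Sym2.ind with
      | _ u v =>
        rw [mem_eF] at he
        have := h.adj_mem he
        rw [crs_mk, crs_mk]; simp [this]
    rw [h1]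
    have h2 : ((X ∩ W).card : ZMod 2) = 1 := by
      rw [sum_ite_mem] at hX; simpa using hX
    have h3 : (X ∩ W).card % 2 = 1 := by
      have : ((X ∩ W).card : ZMod 2) = ((1 : ℕ) : ZMod 2) := by simpa using h2
      exact (ZMod.natCast_eq_natCast_iff' _ _ 2).1 this
    have h4 := h.dc_parity (X := X ∩ W) inter_subset_right
    have h5 := h.tec (X ∩ W) inter_subset_right (card_pos.1 (by omega)) (by
      intro he; rw [he] at h3; have := h.even; rw [Nat.even_iff] at this; omega)
    unfold dc at h4 h5
    omega) _ (fun e => 2 * (K + w0 e)) (fun _ => 0) (by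
      intro u v _; push_cast
      have two : (2 : ZMod 2) = 0 := rfl
      rw [two]; simp) rfl
  have hJnd : ∀ e ∈ J, ¬ e.IsDiag := fun e he => eF_nd e (hJE he)
  let t : V → ℕ := fun v => ∑ x, (if s(v,x) ∈ J then 1 else 0)
  have ht : ∀ v ∈ W, 1 ≤ t v := by
    intro v hv
    have h1 : bd J v = 1 := by rw [hJT]; simp [hv]
    rw [bd_eq_sum _ _ hJnd] at h1
    by_contra hc
    have h0 : t v = 0 := by omega
    have : ((t v : ℕ) : ZMod 2) = 1 := by simp only [t]; push_cast; exact h1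
    rw [h0] at this; simp at this
  have hsum : 2 * J.card = ∑ v, t v := by
    have h1 := sum_sw (fun _ _ => 1) J hJnd
    have h2 : ∀ e : Sym2 V, sw (fun _ _ => 1) e = 2 := by
      intro e; induction e using Sym2.ind with | _ u v => rfl
    simp only [h2] at h1
    rw [sum_const] at h1
    simp only [t]; rw [← h1]; simp [mul_comm]
  have htW : ∑ v, t v = ∑ v ∈ W, t v := by
    symm
    apply sum_subset (subset_univ _)
    intro v _ hv
    simp only [t]
    apply sum_eq_zero
    intro x _
    rw [if_neg]
    intro hx
    exact hv (h.supp _ _ (mem_eF.1 (hJE hx)))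
  have hge : W.card ≤ ∑ v ∈ W, t v := by
    have := card_nsmul_le_sum W t 1 ht
    simpa using this
  have hcE := h.card_eF
  simp only [← mul_sum, sum_add_distrib, sum_const, smul_eq_mul] at hJw
  have hle : 2 * J.card ≤ W.card := by
    by_contra hc
    have hev := h.even; rw [Nat.even_iff] at hev
    have h1 : (eF G).card + 3 ≤ 3 * J.card := by omega
    have h2 : ((eF G).card + 3) * K ≤ 3 * J.card * K := Nat.mul_le_mul_right _ h1
    have h3 : ∑ e ∈ eF G, w0 e < K := by simp only [K]; omega
    have h4 : 3 * J.card * K = 3 * (J.card * K) := by ring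
    have h5 : ((eF G).card + 3) * K = (eF G).card * K + 3 * K := by ring
    have h6 : 0 ≤ ∑ e ∈ J, w0 e := Nat.zero_le _
    omega
  have hcJ : 2 * J.card = W.card := by omega
  refine ⟨J, hJE, ?_, hJT, hcJ, ?_⟩
  · intro v hv
    have h1 : ∑ v ∈ W, t v = ∑ v ∈ W, 1 := by rw [← htW, ← hsum, hcJ]; simp
    exact ((sum_eq_sum_iff_of_le (fun v hv => ht v hv)).1 h1.symm v hv).symm
  · have h1 : (eF G).card = 3 * J.card := by omega
    rw [h1] at hJw
    have h4 : 3 * J.card * K = 3 * (J.card * K) := by ring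
    omega

theorem Cub.wpm {G : SimpleGraph V} {W : Finset V} (h : Cub G W) (g : V → V → ℕ) :
    ∃ m : V → V, (∀ v ∈ W, m v ∈ W ∧ m (m v) = v ∧ G.Adj v (m v)) ∧
      (∀ X ⊆ W, dc G X = 3 → (X.filter (fun u => m u ∉ X)).card ≤ 1) ∧
      ∑ v ∈ W, ∑ x, (if s(v,x) ∈ eF G then g v x else 0) ≤ 3 * ∑ v ∈ W, g v (m v) := by
  classical
  let TC : Finset (Finset V) := W.powerset.filter (fun X => dc G X = 3)
  let U := ∑ e ∈ eF G, sw g e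
  let N := U + 1
  let cc : Sym2 V → ℕ := fun e => (TC.filter (fun X => crs X e)).card
  obtain ⟨J, hJE, hJ1, hJT, hJc, hJw⟩ := h.wpm0 (fun e => N * cc e + (U - sw g e))
  have hJnd : ∀ e ∈ J, ¬ e.IsDiag := fun e he => eF_nd e (hJE he)
  have hU : ∀ e ∈ eF G, sw g e ≤ U := fun e he => single_le_sum (fun _ _ => Nat.zero_le _) he
  have hcc : ∀ S : Finset (Sym2 V), ∑ e ∈ S, cc e = ∑ X ∈ TC, (S.filter (crs X)).card := by
    intro S
    simp only [cc, card_filter]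
    rw [sum_comm]
  have hccE : ∑ e ∈ eF G, cc e = 3 * TC.card := by
    rw [hcc, sum_const_nat (m := 3)]
    · ring
    · intro X hX
      simp only [TC, mem_filter] at hX
      exact hX.2
  have hodd : ∀ X ∈ TC, 1 ≤ (J.filter (crs X)).card := by
    intro X hX
    simp only [TC, mem_filter, mem_powerset] at hX
    have h1 := sum_bd X J hJnd
    have h2 : ∑ v ∈ X, bd J v = (X.card : ZMod 2) := by
      rw [hJT, sum_ite_mem, inter_eq_left.2 hX.1]
      simp
    rw [h2] at h1
    have h3 := (ZMod.natCast_eq_natCast_iff' _ _ 2).1 h1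
    have h4 := h.dc_parity hX.1
    omega
  have hsw : ∀ S ⊆ eF G, ∑ e ∈ S, (U - sw g e) + ∑ e ∈ S, sw g e = S.card * U := by
    intro S hS
    rw [← sum_add_distrib, sum_const_nat]
    intro e he
    have := hU e (hS he); omega
  have e1 := hsw J hJE
  have e2 := hsw (eF G) (subset_refl _)
  have hEJ : (eF G).card = 3 * J.card := by have := h.card_eF; omega
  simp only [sum_add_distrib, ← mul_sum] at hJw
  rw [hccE] at hJw
  have hTCle : TC.card ≤ ∑ e ∈ J, cc e := by
    rw [hcc]
    have := card_nsmul_le_sum TC (fun X => (J.filter (crs X)).card) 1 hodd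
    simpa using this
  rw [hEJ] at e2
  have e3 : 3 * J.card * U = 3 * (J.card * U) := by ring
  have hJU : ∑ e ∈ J, sw g e ≤ U := sum_le_sum_of_subset hJE
  have hU' : ∑ e ∈ eF G, sw g e = U := rfl
  have hTC : ∑ e ∈ J, cc e = TC.card := by
    by_contra hne
    have hlt : TC.card + 1 ≤ ∑ e ∈ J, cc e := by omega
    have := Nat.mul_le_mul_left N hlt
    have e4 : N * (TC.card + 1) = N * TC.card + N := by ring
    have e5 : N * (3 * TC.card) = 3 * (N * TC.card) := by ring
    have e6 : N = U + 1 := rfl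
    omega
  have hfin : ∑ e ∈ eF G, sw g e ≤ 3 * ∑ e ∈ J, sw g e := by
    have e5 : N * (3 * TC.card) = 3 * (N * TC.card) := by ring
    rw [hTC] at hJw
    omega
  have hTC1 : ∀ X ∈ TC, (J.filter (crs X)).card = 1 := by
    rw [hcc] at hTC
    have h1 : ∑ X ∈ TC, 1 = ∑ X ∈ TC, (J.filter (crs X)).card := by rw [hTC]; simp
    intro X hX
    exact ((sum_eq_sum_iff_of_le hodd).1 h1 X hX).symm
  -- the mate function
  have hex : ∀ v, ∃ x, v ∈ W → (s(v,x) ∈ J ∧ ∀ y, s(v,y) ∈ J → y = x) := by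
    intro v
    by_cases hv : v ∈ W
    · have := hJ1 v hv
      rw [← card_filter, card_eq_one] at this
      obtain ⟨x, hx⟩ := this
      refine ⟨x, fun _ => ⟨?_, ?_⟩⟩
      · have : x ∈ univ.filter (fun x => s(v,x) ∈ J) := by rw [hx]; simp
        simpa using this
      · intro y hy
        have : y ∈ univ.filter (fun x => s(v,x) ∈ J) := by simpa using hy
        rw [hx] at this; simpa using this
    · exact ⟨v, fun h => absurd h hv⟩
  choose m hm using hex
  have hmA : ∀ v ∈ W, G.Adj v (m v) := fun v hv => mem_eF.1 (hJE (hm v hv).1)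
  refine ⟨m, ?_, ?_, ?_⟩
  · intro v hv
    have hA := hmA v hv
    have hmv := (h.adj_mem hA).2
    refine ⟨hmv, ?_, hA⟩
    exact ((hm (m v) hmv).2 v (by rw [Sym2.eq_swap]; exact (hm v hv).1)).symm
  · intro X hXW hX3
    have h1 := hTC1 X (by simp [TC, hXW, hX3])
    rw [← h1]
    apply card_le_card_of_injOn (fun u => s(u, m u))
    · intro u hu
      simp only [coe_filter, Set.mem_ofPred_eq] at hu ⊢
      exact ⟨(hm u (hXW hu.1)).1, u, hu.1, m u, hu.2, rfl⟩
    · intro u hu v hv huv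
      simp only [coe_filter, Set.mem_ofPred_eq] at hu hv
      have := Sym2.eq_iff.1 huv
      rcases this with ⟨h1, _⟩ | ⟨h1, h2⟩
      · exact h1
      · exfalso; apply hv.2; rw [← h1]; exact hu.1
  · rw [sum_sw g _ eF_nd, sum_sw g J hJnd] at hfin
    have hl : ∀ v, v ∉ W → ∑ x, (if s(v,x) ∈ eF G then g v x else 0) = 0 := by
      intro v hv
      apply sum_eq_zero
      intro x _
      rw [if_neg]; rw [mem_eF]; intro hx; exact hv (h.supp _ _ hx)
    have hr : ∀ v, v ∉ W → ∑ x, (if s(v,x) ∈ J then g v x else 0) = 0 := by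
      intro v hv
      apply sum_eq_zero
      intro x _
      rw [if_neg]; intro hx; exact hv (h.supp _ _ (mem_eF.1 (hJE hx)))
    rw [sum_subset (subset_univ W) (fun v _ hv => hl v hv)]
    refine hfin.trans ?_
    apply Nat.mul_le_mul_left
    rw [← sum_subset (subset_univ W) (fun v _ hv => hr v hv)]
    apply sum_le_sum
    intro v hv
    rw [sum_eq_single (m v)]
    · rw [if_pos (hm v hv).1]
    · intro b _ hb; rw [if_neg]; intro hbJ; exact hb ((hm v hv).2 b hbJ)
    · simp

end WPM

set_option linter.unusedSectionVars false
set_option linter.unusedVariables false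
set_option linter.unusedSimpArgs false

section OPS
variable {V : Type*} [Fintype V] [DecidableEq V]
open Finset

def iso (H : SimpleGraph V) (v : V) : Prop := ∀ x, ¬ H.Adj v x

noncomputable instance (H : SimpleGraph V) : DecidablePred (iso H) := fun _ => Classical.dec _

def D2 (H : SimpleGraph V) : Prop :=
  ∀ u, iso H u ∨ ∃ a b, a ≠ b ∧ ∀ x, H.Adj u x ↔ x = a ∨ x = b

structure Rl (W : Finset V) (H : SimpleGraph V) (k : ℕ) : Prop where
  d2 : D2 H
  supp : ∀ u v, H.Adj u v → u ∈ W
  rt : ∃ R : Finset V, (∀ v x, H.Adj v x → ∃ r ∈ R, H.Reachable r v) ∧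
    (W.filter (iso H)).card + 2 * R.card ≤ k

def Good (G : SimpleGraph V) (W : Finset V) (k : ℕ) : Prop := ∃ H ≤ G, Rl W H k

lemma D2.other {H : SimpleGraph V} (h : D2 H) {u v : V} (huv : H.Adj u v) :
    ∃ t, t ≠ v ∧ ∀ x, H.Adj u x ↔ x = v ∨ x = t := by
  rcases h u with h1 | ⟨a, b, hab, h1⟩
  · exact absurd huv (h1 v)
  · rcases (h1 v).1 huv with rfl | rfl
    · exact ⟨b, hab.symm, h1⟩
    · exact ⟨a, hab, fun x => by rw [h1, or_comm]⟩

lemma reach_map {H H1 : SimpleGraph V} (h : ∀ x y, H.Adj x y → H1.Reachable x y) {x y : V}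
    (hxy : H.Reachable x y) : H1.Reachable x y := by
  obtain ⟨p⟩ := hxy
  induction p with
  | nil => exact Reachable.refl _
  | cons h' p ih => exact (h _ _ h').trans ih

lemma Rl.mono_W {W W' : Finset V} {H : SimpleGraph V} {k : ℕ} (h : Rl W' H k) (hW : W' ⊆ W) :
    Rl W H (k + (W \ W').card) := by
  obtain ⟨h1, h2, R, h3, h4⟩ := h
  refine ⟨h1, fun u v huv => hW (h2 u v huv), R, h3, ?_⟩
  have : (W.filter (iso H)).card ≤ (W'.filter (iso H)).card + (W \ W').card := by
    rw [← card_union_of_disjoint]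
    · apply card_le_card
      intro x hx
      simp only [mem_union, mem_filter, mem_sdiff] at hx ⊢
      tauto
    · rw [Finset.disjoint_left]; intro x hx hy; simp at hx hy; tauto
  omega

lemma Rl.mono_k {W : Finset V} {H : SimpleGraph V} {k k' : ℕ} (h : Rl W H k) (hk : k ≤ k') :
    Rl W H k' := by
  obtain ⟨h1, h2, R, h3, h4⟩ := h
  exact ⟨h1, h2, R, h3, h4.trans hk⟩

/-- H with edges in S deleted, and edges in A added -/
def edit (H : SimpleGraph V) (S A : Set (Sym2 V)) : SimpleGraph V :=
  H.deleteEdges S ⊔ SimpleGraph.fromEdgeSet A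

lemma edit_adj {H : SimpleGraph V} {S A : Set (Sym2 V)} {x y : V} :
    (edit H S A).Adj x y ↔ (H.Adj x y ∧ s(x,y) ∉ S) ∨ (s(x,y) ∈ A ∧ x ≠ y) := by
  simp [edit, SimpleGraph.deleteEdges_adj]

/-- insert an isolated vertex into an edge -/
lemma Rl.ins {W : Finset V} {H : SimpleGraph V} {k : ℕ} (h : Rl W H (k+1)) {u v w : V}
    (huv : H.Adj u v) (hw : iso H w) (hwW : w ∈ W) :
    Rl W (edit H {s(u,v)} {s(u,w), s(w,v)}) k := by
  have huw : u ≠ w := by rintro rfl; exact hw _ huv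
  have hvw : v ≠ w := by rintro rfl; exact hw _ huv.symm
  have hne := huv.ne
  set H1 := edit H {s(u,v)} {s(u,w), s(w,v)} with hH1
  have hadj : ∀ x y, H1.Adj x y ↔ (H.Adj x y ∧ ¬ (x = u ∧ y = v) ∧ ¬ (x = v ∧ y = u)) ∨
      (x = u ∧ y = w) ∨ (x = w ∧ y = u) ∨ (x = w ∧ y = v) ∨ (x = v ∧ y = w) := by
    intro x y
    rw [hH1, edit_adj]
    simp only [Set.mem_singleton_iff, Set.mem_insert_iff, Sym2.eq_iff]
    grind
  obtain ⟨h1, h2, R, h3, h4⟩ := h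
  have hr : ∀ x y, H.Adj x y → H1.Reachable x y := by
    have huv' : H1.Reachable u v := by
      have e1 : H1.Adj u w := by rw [hadj]; tauto
      have e2 : H1.Adj w v := by rw [hadj]; tauto
      exact e1.reachable.trans e2.reachable
    intro x y hxy
    by_cases c1 : x = u ∧ y = v
    · rw [c1.1, c1.2]; exact huv'
    · by_cases c2 : x = v ∧ y = u
      · rw [c2.1, c2.2]; exact huv'.symm
      · have : H1.Adj x y := by rw [hadj]; tauto
        exact this.reachable
  refine ⟨?_, ?_, R, ?_, ?_⟩
  · intro x
    by_cases xu : x = u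
    · obtain ⟨t, ht, ht2⟩ := h1.other huv
      right; refine ⟨w, t, ?_, ?_⟩
      · rintro rfl; exact hw u ((ht2 w).2 (Or.inr rfl)).symm
      · intro y; rw [hadj, xu]; have := ht2 y; grind
    by_cases xv : x = v
    · obtain ⟨t, ht, ht2⟩ := h1.other huv.symm
      right; refine ⟨w, t, ?_, ?_⟩
      · rintro rfl; exact hw v ((ht2 w).2 (Or.inr rfl)).symm
      · intro y; rw [hadj, xv]; have := ht2 y; grind
    by_cases xw : x = w
    · right; refine ⟨u, v, hne, ?_⟩
      intro y; rw [hadj, xw]; have := hw y; grind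
    · have e : ∀ y, H1.Adj x y ↔ H.Adj x y := by intro y; rw [hadj]; tauto
      rcases h1 x with h | ⟨a, b, hab, h⟩
      · left; intro y; rw [e]; exact h y
      · right; exact ⟨a, b, hab, fun y => by rw [e]; exact h y⟩
  · intro x y hxy
    rw [hadj] at hxy
    rcases hxy with h | ⟨rfl, _⟩ | ⟨rfl, _⟩ | ⟨rfl, _⟩ | ⟨rfl, _⟩
    · exact h2 _ _ h.1
    · exact h2 _ _ huv
    · exact hwW
    · exact hwW
    · exact h2 _ _ huv.symm
  · have hu : ∀ x y, H.Adj x y → ∃ r ∈ R, H1.Reachable r x := by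
      intro x y hxy
      obtain ⟨r, hr1, hr2⟩ := h3 _ _ hxy
      exact ⟨r, hr1, reach_map hr hr2⟩
    intro x y hxy
    have hxy' := hxy
    rw [hadj] at hxy
    rcases hxy with h | ⟨rfl, _⟩ | ⟨rfl, rfl⟩ | ⟨rfl, rfl⟩ | ⟨rfl, _⟩
    · exact hu _ _ h.1
    · exact hu _ _ huv
    · obtain ⟨r, hr1, hr2⟩ := hu _ _ huv
      exact ⟨r, hr1, hr2.trans hxy'.symm.reachable⟩
    · obtain ⟨r, hr1, hr2⟩ := hu _ _ huv.symm
      exact ⟨r, hr1, hr2.trans hxy'.symm.reachable⟩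
    · exact hu _ _ huv.symm
  · have : (W.filter (iso H1)).card + 1 ≤ (W.filter (iso H)).card := by
      rw [Nat.succ_le_iff]
      apply card_lt_card
      rw [Finset.ssubset_iff_of_subset]
      · refine ⟨w, by simp [hwW, hw], ?_⟩
        simp only [mem_filter, not_and]
        intro _ hi
        exact hi u (by rw [hadj]; tauto)
      · intro x hx
        rw [mem_filter] at hx ⊢
        refine ⟨hx.1, fun y hy => ?_⟩
        by_cases c1 : x = u ∧ y = v
        · exact hx.2 w (by rw [hadj]; tauto)
        · by_cases c2 : x = v ∧ y = u
          · exact hx.2 w (by rw [hadj]; tauto)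
          · exact hx.2 y (by rw [hadj]; tauto)
    omega

/-- insert a list of isolated vertices into an edge -/
lemma Rl.insl {W : Finset V} {Gc : V → V → Prop} (hGs : ∀ x y, Gc x y → Gc y x) (l : List V) :
    ∀ {H : SimpleGraph V} {k : ℕ} {u v : V} (_ : Rl W H (k + l.length)) (_ : H.Adj u v)
    (_ : ∀ w ∈ l, iso H w ∧ w ∈ W) (_ : l.Nodup) (_ : List.IsChain Gc (u :: (l ++ [v]))),
    ∃ H1, Rl W H1 k ∧ (∀ x y, H.Adj x y → s(x,y) ≠ s(u,v) → H1.Adj x y) ∧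
      (∀ x y, H1.Adj x y → (H.Adj x y ∧ s(x,y) ≠ s(u,v)) ∨ Gc x y) ∧
      (∀ x, x ∉ l → iso H x → iso H1 x) := by
  induction l with
  | nil =>
    intro H k u v h huv _ _ hch
    have huv' : Gc u v := by simpa using hch
    refine ⟨H, h, fun x y hxy _ => hxy, ?_, fun x _ hx => hx⟩
    intro x y hxy
    by_cases e : s(x,y) = s(u,v)
    · right
      rw [Sym2.eq_iff] at e
      rcases e with ⟨rfl, rfl⟩ | ⟨rfl, rfl⟩
      · exact huv'
      · exact hGs _ _ huv'
    · left; exact ⟨hxy, e⟩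
  | cons w l ih =>
    intro H k u v h huv hl hnd hch
    have hw := hl w (by simp)
    have hch1 : Gc u w := by
      simp only [List.cons_append] at hch
      rw [List.isChain_cons_cons] at hch; exact hch.1
    have hch2 : List.IsChain Gc (w :: (l ++ [v])) := by
      simp only [List.cons_append] at hch
      rw [List.isChain_cons_cons] at hch; exact hch.2
    have huw : u ≠ w := by rintro rfl; exact hw.1 _ huv
    have hvw : v ≠ w := by rintro rfl; exact hw.1 _ huv.symm
    have h' : Rl W H ((k + l.length) + 1) := by simpa [add_assoc] using h
    have hi := h'.ins huv hw.1 hw.2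
    set H1 := edit H {s(u,v)} {s(u,w), s(w,v)} with hH1
    have hadj : ∀ x y, H1.Adj x y ↔ (H.Adj x y ∧ s(x,y) ≠ s(u,v)) ∨
        ((s(x,y) = s(u,w) ∨ s(x,y) = s(w,v)) ∧ x ≠ y) := by
      intro x y
      rw [hH1, edit_adj]; simp only [Set.mem_singleton_iff, Set.mem_insert_iff, ne_eq]
    rw [List.nodup_cons] at hnd
    have hiso1 : ∀ x, x ≠ w → iso H x → iso H1 x := by
      intro x hx hxi y hy
      rw [hadj] at hy
      rcases hy with hy | ⟨hy | hy, _⟩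
      · exact hxi _ hy.1
      · rw [Sym2.eq_iff] at hy
        rcases hy with ⟨rfl, _⟩ | ⟨rfl, _⟩
        · exact hxi _ huv
        · exact hx rfl
      · rw [Sym2.eq_iff] at hy
        rcases hy with ⟨rfl, _⟩ | ⟨rfl, _⟩
        · exact hx rfl
        · exact hxi _ huv.symm
    obtain ⟨H2, g1, g2, g3, g4⟩ := ih hi (u := w) (v := v) (by
        rw [hadj]; right; exact ⟨Or.inr rfl, hvw.symm⟩) (by
        intro x hx
        have := hl x (by simp [hx])
        exact ⟨hiso1 x (by rintro rfl; exact hnd.1 hx) this.1, this.2⟩) hnd.2 hch2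
    refine ⟨H2, g1, ?_, ?_, ?_⟩
    · intro x y hxy hne
      apply g2 _ _ (by rw [hadj]; exact Or.inl ⟨hxy, hne⟩)
      intro e
      rw [Sym2.eq_iff] at e
      rcases e with ⟨rfl, rfl⟩ | ⟨rfl, rfl⟩
      · exact hw.1 _ hxy
      · exact hw.1 _ hxy.symm
    · intro x y hxy
      rcases g3 x y hxy with ⟨a, b⟩ | a
      · rw [hadj] at a
        rcases a with a | ⟨a | a, _⟩
        · exact Or.inl a
        · right
          rw [Sym2.eq_iff] at a
          rcases a with ⟨rfl, rfl⟩ | ⟨rfl, rfl⟩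
          · exact hch1
          · exact hGs _ _ hch1
        · exact absurd a b
      · exact Or.inr a
    · intro x hx hxi
      simp only [List.mem_cons, not_or] at hx
      exact g4 x hx.2 (hiso1 x hx.1 hxi)

end OPS

set_option linter.unusedSectionVars false
set_option linter.unusedVariables false
set_option linter.unusedSimpArgs false

section OPS2
variable {V : Type*} [Fintype V] [DecidableEq V]
open Finset

lemma Rl.tri {W : Finset V} {H : SimpleGraph V} {k k' : ℕ} (h : Rl W H k') (hk : k' ≤ k + 1) {a b c : V}
    (hab : a ≠ b) (hac : a ≠ c) (hbc : b ≠ c) (ha : iso H a ∧ a ∈ W) (hb : iso H b ∧ b ∈ W)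
    (hc : iso H c ∧ c ∈ W) :
    Rl W (edit H ∅ {s(a,b), s(b,c), s(c,a)}) k := by
  set H1 := edit H ∅ {s(a,b), s(b,c), s(c,a)} with hH1
  have hadj : ∀ x y, H1.Adj x y ↔ H.Adj x y ∨ (x = a ∧ (y = b ∨ y = c)) ∨ (x = b ∧ (y = a ∨ y = c)) ∨
      (x = c ∧ (y = a ∨ y = b)) := by
    intro x y
    rw [hH1, edit_adj]
    simp only [Set.mem_singleton_iff, Set.mem_insert_iff, Sym2.eq_iff, Set.mem_empty_iff_false, not_false_iff, and_true]
    grind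
  obtain ⟨h1, h2, R, h3, h4⟩ := h
  have hab' : H1.Adj a b := by rw [hadj]; tauto
  have hac' : H1.Adj a c := by rw [hadj]; tauto
  refine ⟨?_, ?_, insert a R, ?_, ?_⟩
  · intro x
    by_cases xa : x = a
    · subst xa; right; refine ⟨b, c, hbc, fun y => ?_⟩
      rw [hadj]; have := ha.1 y; tauto
    by_cases xb : x = b
    · subst xb; right; refine ⟨a, c, hac, fun y => ?_⟩
      rw [hadj]; have := hb.1 y; tauto
    by_cases xc : x = c
    · subst xc; right; refine ⟨a, b, hab, fun y => ?_⟩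
      rw [hadj]; have := hc.1 y; tauto
    have e : ∀ y, H1.Adj x y ↔ H.Adj x y := by intro y; rw [hadj]; tauto
    rcases h1 x with h | ⟨a, b, hab, h⟩
    · left; intro y; rw [e]; exact h y
    · right; exact ⟨a, b, hab, fun y => by rw [e]; exact h y⟩
  · intro x y hxy
    rw [hadj] at hxy
    rcases hxy with h | ⟨rfl, _⟩ | ⟨rfl, _⟩ | ⟨rfl, _⟩
    · exact h2 _ _ h
    · exact ha.2
    · exact hb.2
    · exact hc.2
  · intro x y hxy
    rw [hadj] at hxy
    rcases hxy with h | ⟨rfl, _⟩ | ⟨rfl, _⟩ | ⟨rfl, _⟩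
    · obtain ⟨r, hr1, hr2⟩ := h3 _ _ h
      refine ⟨r, mem_insert_of_mem hr1, reach_map ?_ hr2⟩
      intro x y hxy
      have : H1.Adj x y := by rw [hadj]; exact Or.inl hxy
      exact this.reachable
    · exact ⟨x, mem_insert_self _ _, Reachable.refl _⟩
    · exact ⟨a, mem_insert_self _ _, hab'.reachable⟩
    · exact ⟨a, mem_insert_self _ _, hac'.reachable⟩
  · have hcard := card_insert_le a R
    have : (W.filter (iso H1)).card + 3 ≤ (W.filter (iso H)).card := by
      have e1 : ({a, b, c} : Finset V).card = 3 := by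
        rw [card_insert_of_notMem (by simp [hab, hac]), card_pair hbc]
      rw [← e1, ← card_union_of_disjoint]
      · apply card_le_card
        intro x hx
        simp only [mem_union, mem_filter, mem_insert, mem_singleton] at hx ⊢
        rcases hx with hx | rfl | rfl | rfl
        · refine ⟨hx.1, fun y hy => hx.2 y ?_⟩
          rw [hadj]; exact Or.inl hy
        · exact ⟨ha.2, ha.1⟩
        · exact ⟨hb.2, hb.1⟩
        · exact ⟨hc.2, hc.1⟩
      · rw [Finset.disjoint_left]
        intro x hx hy
        simp only [mem_filter, mem_insert, mem_singleton] at hx hy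
        rcases hy with rfl | rfl | rfl
        · exact hx.2 b hab'
        · exact hx.2 a hab'.symm
        · exact hx.2 a hac'.symm
    omega

lemma Rl.addc {W : Finset V} {Gc : V → V → Prop} (hGs : ∀ x y, Gc x y → Gc y x)
    {H : SimpleGraph V} {k k' : ℕ} (h : Rl W H k') {a b c : V} {l : List V}
    (hk : k' ≤ k + l.length + 1)
    (hl : ∀ w ∈ a :: b :: c :: l, iso H w ∧ w ∈ W) (hnd : (a :: b :: c :: l).Nodup)
    (hch : List.IsChain Gc (a :: b :: c :: (l ++ [a]))) :
    ∃ H1, Rl W H1 k ∧ H ≤ H1 ∧ (∀ x y, H1.Adj x y → H.Adj x y ∨ Gc x y) ∧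
      (∀ x, x ∉ a :: b :: c :: l → iso H x → iso H1 x) := by
  simp only [List.nodup_cons, List.mem_cons, not_or] at hnd
  simp only [List.mem_cons, forall_eq_or_imp] at hl
  obtain ⟨ha, hb, hc, hl⟩ := hl
  obtain ⟨⟨hab, hac, hal⟩, ⟨hbc, hbl⟩, hcl, hln⟩ := hnd
  rw [List.isChain_cons_cons, List.isChain_cons_cons] at hch
  obtain ⟨c1, c2, c3⟩ := hch
  have ht := h.tri (k := k + l.length) hk hab hac hbc ha hb hc
  set H0 := edit H ∅ {s(a,b), s(b,c), s(c,a)} with hH1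
  have hadj : ∀ x y, H0.Adj x y ↔ H.Adj x y ∨ (x = a ∧ (y = b ∨ y = c)) ∨ (x = b ∧ (y = a ∨ y = c)) ∨
      (x = c ∧ (y = a ∨ y = b)) := by
    intro x y
    rw [hH1, edit_adj]
    simp only [Set.mem_singleton_iff, Set.mem_insert_iff, Sym2.eq_iff, Set.mem_empty_iff_false, not_false_iff, and_true]
    grind
  have hiso : ∀ x, x ≠ a → x ≠ b → x ≠ c → iso H x → iso H0 x := by
    intro x ha hb hc hx y hy
    rw [hadj] at hy
    rcases hy with h | ⟨rfl, _⟩ | ⟨rfl, _⟩ | ⟨rfl, _⟩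
    · exact hx _ h
    all_goals simp_all
  obtain ⟨H1, g1, g2, g3, g4⟩ := Rl.insl hGs l ht (u := c) (v := a) (by rw [hadj]; tauto) (by
    intro w hw
    refine ⟨hiso w ?_ ?_ ?_ (hl w hw).1, (hl w hw).2⟩
    all_goals rintro rfl
    all_goals contradiction) hln c3
  refine ⟨H1, g1, ?_, ?_, ?_⟩
  · intro x y hxy
    apply g2 _ _ (by rw [hadj]; exact Or.inl hxy)
    intro e
    rw [Sym2.eq_iff] at e
    rcases e with ⟨rfl, rfl⟩ | ⟨rfl, rfl⟩
    · exact hc.1 _ hxy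
    · exact ha.1 _ hxy
  · intro x y hxy
    rcases g3 x y hxy with ⟨h, hne⟩ | h
    · rw [hadj] at h
      rw [ne_eq, Sym2.eq_iff] at hne
      rcases h with h | ⟨rfl, rfl | rfl⟩ | ⟨rfl, rfl | rfl⟩ | ⟨rfl, rfl | rfl⟩
      · exact Or.inl h
      · exact Or.inr c1
      · simp at hne
      · exact Or.inr (hGs _ _ c1)
      · exact Or.inr c2
      · simp at hne
      · exact Or.inr (hGs _ _ c2)
    · exact Or.inr h
  · intro x hx hxi
    simp only [List.mem_cons, not_or] at hx
    exact g4 x hx.2.2.2 (hiso x hx.1 hx.2.1 hx.2.2.1 hxi)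

lemma Rl.renameBy {W : Finset V} {H : SimpleGraph V} {k : ℕ} (h : Rl W H k) (σ : Equiv.Perm V)
    (hσ : ∀ x, σ x ∈ W ↔ x ∈ W) : Rl W (H.comap σ) k := by
  obtain ⟨h1, h2, R, h3, h4⟩ := h
  have hiso : ∀ x, iso (H.comap σ) x ↔ iso H (σ x) := by
    intro x
    constructor
    · intro h y hy
      apply h (σ.symm y)
      simp [SimpleGraph.comap_adj]; exact hy
    · intro h y hy; exact h _ hy
  refine ⟨?_, ?_, R.image σ.symm, ?_, ?_⟩
  · intro x
    rcases h1 (σ x) with h | ⟨a, b, hab, h⟩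
    · left; rw [hiso]; exact h
    · right; refine ⟨σ.symm a, σ.symm b, by simpa using hab, fun y => ?_⟩
      rw [SimpleGraph.comap_adj, h, Equiv.eq_symm_apply, Equiv.eq_symm_apply]
  · intro u v huv
    rw [← hσ]; exact h2 _ _ huv
  · intro v x hvx
    obtain ⟨r, hr1, hr2⟩ := h3 _ _ hvx
    refine ⟨σ.symm r, mem_image_of_mem _ hr1, ?_⟩
    rw [← (SimpleGraph.Iso.comap σ H).reachable_iff]
    simpa using hr2
  · have e1 : (W.filter (iso (H.comap σ))).card ≤ (W.filter (iso H)).card := by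
      apply card_le_card_of_injOn σ
      · intro x hx
        simp only [coe_filter, Set.mem_ofPred_eq] at hx ⊢
        exact ⟨(hσ x).2 hx.1, (hiso x).1 hx.2⟩
      · exact σ.injective.injOn
    have e2 := card_image_le (s := R) (f := σ.symm)
    omega

lemma D2.bd_eF {H : SimpleGraph V} (h : D2 H) (v : V) : bd (eF H) v = 0 := by
  rw [bd_eq_sum _ _ eF_nd]
  rcases h v with h1 | ⟨a, b, hab, h1⟩
  · apply sum_eq_zero; intro x _; rw [if_neg]; rw [mem_eF]; exact h1 x
  · rw [← sum_filter]
    have : (univ.filter (fun x => s(v,x) ∈ eF H)) = {a, b} := by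
      ext x; simp [mem_eF, h1]
    rw [this, sum_pair hab]; rfl

lemma D2.even_cut {H : SimpleGraph V} (h : D2 H) (X : Finset V) : Even (dc H X) := by
  have h1 := sum_bd X (eF H) eF_nd
  rw [sum_eq_zero (fun v _ => h.bd_eF v)] at h1
  rw [← ZMod.natCast_eq_zero_iff_even]; exact h1.symm

lemma Rl.switch0 {W : Finset V} {H : SimpleGraph V} {k : ℕ} (h : Rl W H k) {a b c d : V}
    (hac : H.Adj a c) (hbd : H.Adj b d) (h1 : a ≠ b) (h2 : a ≠ d) (h3 : b ≠ c) (h4 : c ≠ d)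
    (n1 : ¬ H.Adj a d) (n2 : ¬ H.Adj b c)
    (hr1 : (edit H {s(a,c), s(b,d)} {s(a,d), s(b,c)}).Reachable a c)
    (hr2 : (edit H {s(a,c), s(b,d)} {s(a,d), s(b,c)}).Reachable b d) :
    Rl W (edit H {s(a,c), s(b,d)} {s(a,d), s(b,c)}) k := by
  set H1 := edit H {s(a,c), s(b,d)} {s(a,d), s(b,c)} with hH1
  have nac := hac.ne
  have nbd := hbd.ne
  have hadj : ∀ x y, H1.Adj x y ↔ (H.Adj x y ∧ ¬ (x = a ∧ y = c) ∧ ¬ (x = c ∧ y = a) ∧ ¬ (x = b ∧ y = d) ∧ ¬ (x = d ∧ y = b)) ∨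
      (x = a ∧ y = d) ∨ (x = d ∧ y = a) ∨ (x = b ∧ y = c) ∨ (x = c ∧ y = b) := by
    intro x y
    rw [hH1, edit_adj]
    simp only [Set.mem_singleton_iff, Set.mem_insert_iff, Sym2.eq_iff]
    grind
  obtain ⟨g1, g2, R, g3, g4⟩ := h
  have hr : ∀ x y, H.Adj x y → H1.Reachable x y := by
    intro x y hxy
    by_cases c1 : x = a ∧ y = c
    · rw [c1.1, c1.2]; exact hr1
    by_cases c2 : x = c ∧ y = a
    · rw [c2.1, c2.2]; exact hr1.symm
    by_cases c3 : x = b ∧ y = d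
    · rw [c3.1, c3.2]; exact hr2
    by_cases c4 : x = d ∧ y = b
    · rw [c4.1, c4.2]; exact hr2.symm
    have : H1.Adj x y := by rw [hadj]; exact Or.inl ⟨hxy, c1, c2, c3, c4⟩
    exact this.reachable
  have hni : ∀ x y, H1.Adj x y → ∃ z, H.Adj x z := by
    intro x y hxy
    rw [hadj] at hxy
    rcases hxy with h | ⟨rfl, _⟩ | ⟨rfl, _⟩ | ⟨rfl, _⟩ | ⟨rfl, _⟩
    · exact ⟨_, h.1⟩
    · exact ⟨_, hac⟩
    · exact ⟨_, hbd.symm⟩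
    · exact ⟨_, hbd⟩
    · exact ⟨_, hac.symm⟩
  have hni2 : ∀ x y, H.Adj x y → ∃ z, H1.Adj x z := by
    intro x y hxy
    by_cases xa : x = a
    · exact ⟨d, by rw [hadj]; exact Or.inr (Or.inl ⟨xa, rfl⟩)⟩
    by_cases xb : x = b
    · exact ⟨c, by rw [hadj]; exact Or.inr (Or.inr (Or.inr (Or.inl ⟨xb, rfl⟩)))⟩
    by_cases xc : x = c
    · exact ⟨b, by rw [hadj]; exact Or.inr (Or.inr (Or.inr (Or.inr ⟨xc, rfl⟩)))⟩
    by_cases xd : x = d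
    · exact ⟨a, by rw [hadj]; exact Or.inr (Or.inr (Or.inl ⟨xd, rfl⟩))⟩
    exact ⟨y, by rw [hadj]; exact Or.inl ⟨hxy, fun h => xa h.1, fun h => xc h.1, fun h => xb h.1, fun h => xd h.1⟩⟩
  refine ⟨?_, ?_, R, ?_, ?_⟩
  · intro x
    by_cases xa : x = a
    · obtain ⟨t, ht, ht2⟩ := g1.other hac
      right; refine ⟨d, t, ?_, ?_⟩
      · rintro rfl; exact n1 ((ht2 _).2 (Or.inr rfl))
      · intro y; rw [hadj, xa]; have := ht2 y; grind
    by_cases xb : x = b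
    · obtain ⟨t, ht, ht2⟩ := g1.other hbd
      right; refine ⟨c, t, ?_, ?_⟩
      · rintro rfl; exact n2 ((ht2 _).2 (Or.inr rfl))
      · intro y; rw [hadj, xb]; have := ht2 y; grind
    by_cases xc : x = c
    · obtain ⟨t, ht, ht2⟩ := g1.other hac.symm
      right; refine ⟨b, t, ?_, ?_⟩
      · rintro rfl; exact n2 ((ht2 _).2 (Or.inr rfl)).symm
      · intro y; rw [hadj, xc]; have := ht2 y; grind
    by_cases xd : x = d
    · obtain ⟨t, ht, ht2⟩ := g1.other hbd.symm
      right; refine ⟨a, t, ?_, ?_⟩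
      · rintro rfl; exact n1 ((ht2 _).2 (Or.inr rfl)).symm
      · intro y; rw [hadj, xd]; have := ht2 y; grind
    have e : ∀ y, H1.Adj x y ↔ H.Adj x y := by intro y; rw [hadj]; simp only [xa, xb, xc, xd, false_and, not_false_eq_true, and_true, or_false]
    rcases g1 x with h | ⟨a, b, hab, h⟩
    · left; intro y; rw [e]; exact h y
    · right; exact ⟨a, b, hab, fun y => by rw [e]; exact h y⟩
  · intro x y hxy
    obtain ⟨z, hz⟩ := hni x y hxy
    exact g2 _ _ hz
  · intro x y hxy
    obtain ⟨z, hz⟩ := hni x y hxy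
    obtain ⟨r, hr1, hr2⟩ := g3 _ _ hz
    exact ⟨r, hr1, reach_map hr hr2⟩
  · have e : W.filter (iso H1) = W.filter (iso H) := by
      apply filter_congr
      intro x _
      constructor
      · intro h y hy; obtain ⟨z, hz⟩ := hni2 x y hy; exact h z hz
      · intro h y hy; obtain ⟨z, hz⟩ := hni x y hy; exact h z hz
    rw [e]; exact g4

lemma Rl.switch {W : Finset V} {H : SimpleGraph V} {k : ℕ} (h : Rl W H k) {a b c d : V}
    (hac : H.Adj a c) (hbd : H.Adj b d) (h1 : a ≠ b) (h2 : a ≠ d) (h3 : b ≠ c) (h4 : c ≠ d)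
    (n1 : ¬ H.Adj a d) (n2 : ¬ H.Adj b c) (n3 : ¬ H.Adj a b) (n4 : ¬ H.Adj c d) :
    Rl W (edit H {s(a,c), s(b,d)} {s(a,d), s(b,c)}) k ∨
    Rl W (edit H {s(a,c), s(d,b)} {s(a,b), s(d,c)}) k := by
  classical
  have nac := hac.ne
  have nbd := hbd.ne
  let H0 := H.deleteEdges {s(a,c), s(b,d)}
  have hbdH0 : bd (eF H0) = dl a + dl c + (dl b + dl d) := by
    have e : eF H0 = symmDiff (symmDiff (eF H) {s(a,c)}) {s(b,d)} := by
      ext e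
      induction e using Sym2.ind with
      | _ x y =>
        simp only [mem_symmDiff, mem_eF, mem_singleton, H0, SimpleGraph.deleteEdges_adj, Set.mem_insert_iff,
          Set.mem_singleton_iff]
        have hh1 : s(x,y) = s(a,c) → H.Adj x y := by
          rw [Sym2.eq_iff]; rintro (⟨rfl, rfl⟩ | ⟨rfl, rfl⟩)
          · exact hac
          · exact hac.symm
        have hh2 : s(x,y) = s(b,d) → H.Adj x y := by
          rw [Sym2.eq_iff]; rintro (⟨rfl, rfl⟩ | ⟨rfl, rfl⟩)
          · exact hbd
          · exact hbd.symm
        have hh3 : s(a,c) ≠ s(b,d) := by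
          rw [ne_eq, Sym2.eq_iff]; tauto
        have hh4 : s(x,y) = s(a,c) → s(x,y) ≠ s(b,d) := by
          intro h; rw [h]; exact hh3
        tauto
    rw [e, bd_symmDiff, bd_symmDiff, bd_single nac, bd_single nbd]
    have : bd (eF H) = 0 := by funext v; exact h.d2.bd_eF v
    rw [this]; ring
  have hpar : ∀ x, (∃ y, H0.Reachable x y ∧ y ≠ x ∧ (y = a ∨ y = b ∨ y = c ∨ y = d)) ∨ (x ≠ a ∧ x ≠ b ∧ x ≠ c ∧ x ≠ d) := by
    intro x
    by_contra hcon
    push Not at hcon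
    obtain ⟨q1, q2⟩ := hcon
    let X : Finset V := univ.filter (fun y => H0.Reachable x y)
    have hX : ∀ y, y ∈ X ↔ H0.Reachable x y := by simp [X]
    have s1 := sum_bd X (eF H0) eF_nd
    have s2 : (eF H0).filter (crs X) = ∅ := by
      rw [filter_eq_empty_iff]
      rintro e he ⟨u, hu, v, hv, rfl⟩
      rw [mem_eF] at he
      rw [hX] at hu hv
      exact hv (hu.trans he.reachable)
    rw [s2, hbdH0] at s1
    simp only [Pi.add_apply, sum_add_distrib, dl, sum_ite_eq', card_empty, Nat.cast_zero] at s1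
    have hxX : x ∈ X := by rw [hX]
    have q3 : ∀ y, y ∈ X → y ≠ x → y ≠ a ∧ y ≠ b ∧ y ≠ c ∧ y ≠ d := by
      intro y hy; exact q1 y ((hX y).1 hy)
    have mm : ∀ y, (y = a ∨ y = b ∨ y = c ∨ y = d) → (y ∈ X ↔ y = x) := by
      intro y hy
      constructor
      · intro h; by_contra hne; have := q3 y h hne; tauto
      · rintro rfl; exact hxX
    simp only [mm a (by tauto), mm b (by tauto), mm c (by tauto), mm d (by tauto)] at s1
    have hx : x = a ∨ x = b ∨ x = c ∨ x = d := by tauto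
    have nd : (1 : ZMod 2) ≠ 0 := by decide
    rcases hx with rfl | rfl | rfl | rfl
    · simp [h1, h1.symm, h2, h2.symm, nac, nac.symm] at s1
    · simp [h1, h1.symm, h3, h3.symm, nbd, nbd.symm] at s1
    · simp [h4, h4.symm, h3, h3.symm, nac, nac.symm] at s1
    · simp [h2, h2.symm, h4, h4.symm, nbd, nbd.symm] at s1
  have hle1 : ∀ x y, H0.Reachable x y → (edit H {s(a,c), s(b,d)} {s(a,d), s(b,c)}).Reachable x y := by
    intro x y; exact fun h => h.mono (by unfold edit; exact le_sup_left)
  have hle2 : ∀ x y, H0.Reachable x y → (edit H {s(a,c), s(d,b)} {s(a,b), s(d,c)}).Reachable x y := by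
    intro x y; exact fun h => h.mono (by unfold edit; rw [Sym2.eq_swap (a := d) (b := b)]; exact le_sup_left)
  have A1 : (edit H {s(a,c), s(b,d)} {s(a,d), s(b,c)}).Reachable a d :=
    SimpleGraph.Adj.reachable (by rw [edit_adj]; right; simp [h2])
  have A2 : (edit H {s(a,c), s(b,d)} {s(a,d), s(b,c)}).Reachable b c :=
    SimpleGraph.Adj.reachable (by rw [edit_adj]; right; simp [h3])
  have B1 : (edit H {s(a,c), s(d,b)} {s(a,b), s(d,c)}).Reachable a b :=
    SimpleGraph.Adj.reachable (by rw [edit_adj]; right; simp [h1])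
  have B2 : (edit H {s(a,c), s(d,b)} {s(a,b), s(d,c)}).Reachable d c :=
    SimpleGraph.Adj.reachable (by rw [edit_adj]; right; simp [h4.symm])
  -- reachability relation
  have hab_case : H0.Reachable a b → Rl W (edit H {s(a,c), s(b,d)} {s(a,d), s(b,c)}) k := by
    intro r
    exact h.switch0 hac hbd h1 h2 h3 h4 n1 n2 ((hle1 _ _ r).trans A2) ((hle1 _ _ r.symm).trans A1)
  have hcd_case : H0.Reachable c d → Rl W (edit H {s(a,c), s(b,d)} {s(a,d), s(b,c)}) k := by
    intro r
    exact h.switch0 hac hbd h1 h2 h3 h4 n1 n2 (A1.trans (hle1 _ _ r.symm)) (A2.trans (hle1 _ _ r))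
  have had_case : H0.Reachable a d → Rl W (edit H {s(a,c), s(d,b)} {s(a,b), s(d,c)}) k := by
    intro r
    exact h.switch0 hac hbd.symm h2 h1 h4.symm h3.symm n3 (fun h => n4 h.symm)
      ((hle2 _ _ r).trans B2) ((hle2 _ _ r.symm).trans B1)
  have hbc_case : H0.Reachable b c → Rl W (edit H {s(a,c), s(d,b)} {s(a,b), s(d,c)}) k := by
    intro r
    exact h.switch0 hac hbd.symm h2 h1 h4.symm h3.symm n3 (fun h => n4 h.symm)
      (B1.trans (hle2 _ _ r)) (B2.trans (hle2 _ _ r.symm))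
  rcases hpar a with ⟨y, hy, hne, rfl | rfl | rfl | rfl⟩ | hh
  · exact absurd rfl hne
  · exact Or.inl (hab_case hy)
  · rcases hpar b with ⟨z, hz, hne', rfl | rfl | rfl | rfl⟩ | hh
    · exact Or.inl (hab_case hz.symm)
    · exact absurd rfl hne'
    · exact Or.inr (hbc_case hz)
    · exact Or.inl (h.switch0 hac hbd h1 h2 h3 h4 n1 n2 (hle1 _ _ hy) (hle1 _ _ hz))
    · tauto
  · exact Or.inr (had_case hy)
  · tauto

end OPS2

set_option linter.unusedSectionVars false
set_option linter.unusedVariables false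
set_option linter.unusedSimpArgs false

section R4
variable {V : Type*} [Fintype V] [DecidableEq V]
open Finset

lemma adj_sym2 {H : SimpleGraph V} {x y u v : V} (h : s(x,y) = s(u,v)) : H.Adj x y ↔ H.Adj u v := by
  rw [← SimpleGraph.mem_edgeSet, h, SimpleGraph.mem_edgeSet]

lemma two_le_dc {G : SimpleGraph V} {X : Finset V} {u v x y : V} (h1 : G.Adj u v) (hu : u ∈ X) (hv : v ∉ X)
    (h2 : G.Adj x y) (hx : x ∈ X) (hy : y ∉ X) (hne : u ≠ x ∨ v ≠ y) : 2 ≤ dc G X := by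
  unfold dc
  have : 1 < ((eF G).filter (crs X)).card := by
    rw [one_lt_card]
    refine ⟨s(u,v), ?_, s(x,y), ?_, ?_⟩
    · rw [mem_filter, mem_eF]; exact ⟨h1, u, hu, v, hv, rfl⟩
    · rw [mem_filter, mem_eF]; exact ⟨h2, x, hx, y, hy, rfl⟩
    · rw [ne_eq, Sym2.eq_iff]
      rintro (⟨rfl, rfl⟩ | ⟨rfl, rfl⟩)
      · tauto
      · exact hy hu
  omega

structure Q4 (G : SimpleGraph V) (a b c d a' b' c' d' : V) : Prop where
  na : ∀ x, G.Adj a x ↔ x = b ∨ x = d ∨ x = a'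
  nb : ∀ x, G.Adj b x ↔ x = a ∨ x = c ∨ x = b'
  nc : ∀ x, G.Adj c x ↔ x = b ∨ x = d ∨ x = c'
  nd : ∀ x, G.Adj d x ↔ x = a ∨ x = c ∨ x = d'
  ac : a ≠ c
  bd : b ≠ d
  a1 : a' ≠ b
  a2 : a' ≠ c
  a3 : a' ≠ d
  b1 : b' ≠ a
  b2 : b' ≠ c
  b3 : b' ≠ d
  c1 : c' ≠ a
  c2 : c' ≠ b
  c3 : c' ≠ d
  d1 : d' ≠ a
  d2 : d' ≠ b
  d3 : d' ≠ c
  e1 : a' ≠ c'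
  e2 : b' ≠ d'

lemma Q4.flip {G : SimpleGraph V} {a b c d a' b' c' d' : V} (h : Q4 G a b c d a' b' c' d') :
    Q4 G b a d c b' a' d' c' := by
  obtain ⟨na, nb, nc, nd, ac, bd, a1, a2, a3, b1, b2, b3, c1, c2, c3, d1, d2, d3, e1, e2⟩ := h
  refine ⟨nb, na, nd, nc, bd, ac, b1, b3, b2, a1, a3, a2, d2, d1, d3, c2, c1, c3, e2, e1⟩

def g4 (G : SimpleGraph V) (a b c d c' d' : V) : SimpleGraph V :=
  edit G {e | c ∈ e ∨ d ∈ e} {s(a,c'), s(b,d')}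

lemma g4_adj {G : SimpleGraph V} {a b c d a' b' c' d' : V} (h : Q4 G a b c d a' b' c' d') (x y : V) :
    (g4 G a b c d c' d').Adj x y ↔ (G.Adj x y ∧ x ≠ c ∧ y ≠ c ∧ x ≠ d ∧ y ≠ d) ∨
      (x = a ∧ y = c') ∨ (x = c' ∧ y = a) ∨ (x = b ∧ y = d') ∨ (x = d' ∧ y = b) := by
  have := h.c1
  have := h.d2
  unfold g4
  rw [edit_adj]
  simp only [Set.mem_ofPred_eq, Set.mem_insert_iff, Set.mem_singleton_iff, Sym2.eq_iff, Sym2.mem_iff]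
  grind

lemma g4_sep {G : SimpleGraph V} {W : Finset V} (hC : Cub G W) {a b c d a' b' c' d' : V}
    (h : Q4 G a b c d a' b' c' d')
    (hs : ∀ A ⊆ W, a ∉ A → b ∉ A → c ∉ A → d ∉ A → a' ∈ A → c' ∈ A → dc G A ≠ 2)
    (X : Finset V) (hX : X ⊆ W) (ha : a ∈ X) (hb : b ∉ X) (hc : c ∉ X) (hd : d ∉ X) :
    2 ≤ dc (g4 G a b c d c' d') X := by
  have hadj := g4_adj h
  have ⟨na, nb, nc, nd, ac, bd, a1, a2, a3, b1, b2, b3, c1, c2, c3, d1, d2, d3, e1, e2⟩ := h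
  have gab : G.Adj a b := by rw [na]; grind
  have gaa : G.Adj a a' := by rw [na]; grind
  have gbb : G.Adj b b' := by rw [nb]; grind
  have gad : G.Adj a d := by rw [na]; grind
  have gbc : G.Adj b c := by rw [nb]; grind
  have hab : (g4 G a b c d c' d').Adj a b := by
    rw [hadj]; left; exact ⟨gab, ac, gbc.ne, gad.ne, bd⟩
  have key : ∀ u v, (g4 G a b c d c' d').Adj u v → u ∈ X → v ∉ X → (u ≠ a ∨ v ≠ b) → 2 ≤ dc (g4 G a b c d c' d') X := by
    intro u v huv hu hv hne
    exact two_le_dc huv hu hv hab ha hb hne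
  by_contra hlt
  have key' : ∀ u v, (g4 G a b c d c' d').Adj u v → u ∈ X → v ∉ X → u = a ∧ v = b := by
    intro u v huv hu hv
    by_contra hne
    exact hlt (key u v huv hu hv (by grind))
  have ha' : a' ∈ X := by
    by_contra hn
    have := key' a a' (by rw [hadj]; left; exact ⟨gaa, ac, a2, gad.ne, a3⟩) ha hn
    exact a1 this.2
  have hc' : c' ∈ X := by
    by_contra hn
    have := key' a c' (by rw [hadj]; grind) ha hn
    exact c2 this.2
  have hb' : b' ∉ X := by
    intro hn
    have := key' b' b (by rw [hadj]; left; exact ⟨gbb.symm, b2, gbc.ne, b3, bd⟩) hn hb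
    exact b1 this.1
  have hd' : d' ∉ X := by
    intro hn
    have := key' d' b (by rw [hadj]; grind) hn hb
    exact d1 this.1
  let A := X.erase a
  have hA : ∀ x, x ∈ A ↔ x ≠ a ∧ x ∈ X := by simp [A]
  have hAW : A ⊆ W := (erase_subset _ _).trans hX
  have h1 := hs A hAW (by simp [A]) (by simp [A, hb]) (by simp [A, hc]) (by simp [A, hd])
    (by rw [hA]; exact ⟨gaa.ne.symm, ha'⟩) (by rw [hA]; exact ⟨c1, hc'⟩)
  have h2 := hC.tec A hAW ⟨c', by rw [hA]; exact ⟨c1, hc'⟩⟩ (by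
    intro e; have : a ∈ A := by rw [e]; exact hX ha
    simp [A] at this)
  have h3 : (eF G).filter (crs A) ⊆ {s(a',a), s(c',c)} := by
    intro e he
    rw [mem_filter] at he
    obtain ⟨he, u, hu, v, hv, rfl⟩ := he
    rw [mem_eF] at he
    rw [hA] at hu hv
    have uc : u ≠ c := by rintro rfl; exact hc hu.2
    have ud : u ≠ d := by rintro rfl; exact hd hu.2
    have ub : u ≠ b := by rintro rfl; exact hb hu.2
    simp only [mem_insert, mem_singleton]
    by_cases va : v = a
    · subst va; rw [SimpleGraph.adj_comm, na] at he
      have : u = a' := by grind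
      subst this; left; rfl
    have hvX : v ∉ X := by grind
    by_cases vc : v = c
    · subst vc; rw [SimpleGraph.adj_comm, nc] at he
      have : u = c' := by grind
      subst this; right; rfl
    by_cases vd : v = d
    · subst vd; rw [SimpleGraph.adj_comm, nd] at he
      have : u = d' := by grind
      subst this; exact absurd hu.2 hd'
    have := key' u v (by rw [hadj]; left; exact ⟨he, uc, vc, ud, vd⟩) hu.2 hvX
    exact absurd this.1 hu.1
  have h4 := card_le_card h3
  have h5 := card_le_two (a := s(a',a)) (b := s(c',c))
  unfold dc at h1 h2
  omega

lemma g4_cub {G : SimpleGraph V} {W : Finset V} (hC : Cub G W) {a b c d a' b' c' d' : V}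
    (h : Q4 G a b c d a' b' c' d')
    (hs : ∀ A ⊆ W, a ∉ A → b ∉ A → c ∉ A → d ∉ A → a' ∈ A → c' ∈ A → dc G A ≠ 2)
    (hs' : ∀ A ⊆ W, a ∉ A → b ∉ A → c ∉ A → d ∉ A → b' ∈ A → d' ∈ A → dc G A ≠ 2) :
    Cub (g4 G a b c d c' d') (W \ {c, d}) := by
  have hadj := g4_adj h
  have ⟨na, nb, nc, nd, ac, bd, a1, a2, a3, b1, b2, b3, c1, c2, c3, d1, d2, d3, e1, e2⟩ := h
  have gab : G.Adj a b := by rw [na]; grind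
  have gaa : G.Adj a a' := by rw [na]; grind
  have gbb : G.Adj b b' := by rw [nb]; grind
  have gad : G.Adj a d := by rw [na]; grind
  have gbc : G.Adj b c := by rw [nb]; grind
  have gcc : G.Adj c c' := by rw [nc]; grind
  have gcd : G.Adj c d := by rw [nc]; grind
  have gdd : G.Adj d d' := by rw [nd]; grind
  have hac := ac
  have hbd := bd
  have nab := gab.ne
  have ncd := gcd.ne
  have nad := gad.ne
  have nbc := gbc.ne
  have ncc := gcc.ne
  have ndd := gdd.ne
  refine ⟨?_, ?_, ?_⟩
  · intro u v huv
    rw [hadj] at huv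
    simp only [mem_sdiff, mem_insert, mem_singleton, not_or]
    rcases huv with ⟨h, h1, h2, h3, h4⟩ | ⟨rfl, rfl⟩ | ⟨rfl, rfl⟩ | ⟨rfl, rfl⟩ | ⟨rfl, rfl⟩
    · exact ⟨hC.supp _ _ h, h1, h3⟩
    · exact ⟨hC.supp _ _ gab, ac, nad⟩
    · exact ⟨hC.supp _ _ gcc.symm, gcc.ne.symm, c3⟩
    · exact ⟨hC.supp _ _ gbb, nbc, bd⟩
    · exact ⟨hC.supp _ _ gdd.symm, d3, gdd.ne.symm⟩
  · intro x hx
    simp only [mem_sdiff, mem_insert, mem_singleton, not_or] at hx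
    obtain ⟨hxW, hxc, hxd⟩ := hx
    by_cases xa : x = a
    · subst xa
      refine ⟨b, a', c', a1.symm, c2.symm, e1, fun y => ?_⟩
      rw [hadj]; have := na y; grind
    by_cases xb : x = b
    · subst xb
      refine ⟨a, b', d', b1.symm, d1.symm, e2, fun y => ?_⟩
      rw [hadj]; have := nb y; grind
    obtain ⟨p, q, r, n1, n2, n3, hn⟩ := hC.deg x hxW
    let f : V → V := fun y => if y = c then a else if y = d then b else y
    have hxcc : G.Adj x c ↔ x = c' := by rw [SimpleGraph.adj_comm, nc]; grind
    have hxdd : G.Adj x d ↔ x = d' := by rw [SimpleGraph.adj_comm, nd]; grind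
    have hxaa : G.Adj x a ↔ x = a' := by rw [SimpleGraph.adj_comm, na]; grind
    have hxbb : G.Adj x b ↔ x = b' := by rw [SimpleGraph.adj_comm, nb]; grind
    have hinj : ∀ y z, G.Adj x y → G.Adj x z → y ≠ z → f y ≠ f z := by
      intro y z hy hz hne
      simp only [f]
      grind
    refine ⟨f p, f q, f r, hinj _ _ ((hn _).2 (by grind)) ((hn _).2 (by grind)) n1,
      hinj _ _ ((hn _).2 (by grind)) ((hn _).2 (by grind)) n2, hinj _ _ ((hn _).2 (by grind)) ((hn _).2 (by grind)) n3, ?_⟩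
    have h1 : ∀ y, (g4 G a b c d c' d').Adj x y ↔ ∃ z, G.Adj x z ∧ y = f z := by
      intro y
      rw [hadj]
      constructor
      · rintro (⟨h, h1, h2, h3, h4⟩ | ⟨rfl, rfl⟩ | ⟨rfl, rfl⟩ | ⟨rfl, rfl⟩ | ⟨rfl, rfl⟩)
        · exact ⟨y, h, by simp [f, h2, h4]⟩
        · grind
        · exact ⟨c, gcc.symm, by simp [f]⟩
        · grind
        · exact ⟨d, gdd.symm, by simp [f, ncd.symm]⟩
      · rintro ⟨z, hz, rfl⟩
        simp only [f]
        by_cases zc : z = c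
        · subst zc; rw [if_pos rfl]; grind
        · by_cases zd : z = d
          · subst zd; rw [if_neg zc, if_pos rfl]; grind
          · rw [if_neg zc, if_neg zd]; grind
    intro y
    rw [h1]
    constructor
    · rintro ⟨z, hz, rfl⟩
      rcases (hn z).1 hz with rfl | rfl | rfl <;> simp
    · rintro (rfl | rfl | rfl)
      · exact ⟨p, (hn _).2 (by grind), rfl⟩
      · exact ⟨q, (hn _).2 (by grind), rfl⟩
      · exact ⟨r, (hn _).2 (by grind), rfl⟩
  · intro X hX hXne hXW
    have hXW' : X ⊆ W := hX.trans sdiff_subset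
    have hcX : c ∉ X := fun h => by have := hX h; simp at this
    have hdX : d ∉ X := fun h => by have := hX h; simp at this
    have hcomm : g4 G b a d c d' c' = g4 G a b c d c' d' := by
      ext x y; rw [hadj, g4_adj h.flip]; grind
    by_cases ha : a ∈ X <;> by_cases hb : b ∈ X
    · -- both in
      have hle : dc G (X ∪ {c, d}) ≤ dc (g4 G a b c d c' d') X := by
        have hY : ∀ x, x ∈ X ∪ {c, d} ↔ x ∈ X ∨ x = c ∨ x = d := by intro x; simp only [mem_union, mem_insert, mem_singleton]
        apply card_le_card_of_injOn (fun e => if e = s(c,c') then s(a,c') else if e = s(d,d') then s(b,d') else e)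
        · intro e he
          simp only [coe_filter, Set.mem_ofPred_eq] at he ⊢
          obtain ⟨he, u, hu, v, hv, rfl⟩ := he
          rw [hY] at hu hv
          rw [mem_eF] at he
          have hvc : v ≠ c := by grind
          have hvd : v ≠ d := by grind
          by_cases uc : u = c
          · subst uc
            have : v = c' := by
              rcases (nc v).1 he with rfl | rfl | rfl
              · grind
              · grind
              · rfl
            subst this
            rw [if_pos rfl, mem_eF, hadj]
            exact ⟨by grind, a, ha, v, by grind, rfl⟩
          by_cases ud : u = d
          · subst ud
            have : v = d' := by
              rcases (nd v).1 he with rfl | rfl | rfl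
              · grind
              · grind
              · rfl
            subst this
            rw [if_neg (by rw [Sym2.eq_iff]; grind), if_pos rfl, mem_eF, hadj]
            exact ⟨by grind, b, hb, v, by grind, rfl⟩
          rw [if_neg (by rw [Sym2.eq_iff]; grind), if_neg (by rw [Sym2.eq_iff]; grind), mem_eF, hadj]
          exact ⟨by grind, u, by grind, v, by grind, rfl⟩
        · intro e he f hf hef
          simp only [coe_filter, Set.mem_ofPred_eq] at he hf hef
          have k1 : ∀ e ∈ eF G, e ≠ s(a,c') := by
            rintro e he rfl; rw [mem_eF, na] at he; grind
          have k2 : ∀ e ∈ eF G, e ≠ s(b,d') := by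
            rintro e he rfl; rw [mem_eF, nb] at he; grind
          have k3 : s(a,c') ≠ s(b,d') := by rw [ne_eq, Sym2.eq_iff]; grind
          have := k1 e he.1; have := k1 f hf.1; have := k2 e he.1; have := k2 f hf.1
          grind
      have := hC.tec (X ∪ {c, d}) (by
        intro x hx; simp only [mem_union, mem_insert, mem_singleton] at hx
        rcases hx with hx | rfl | rfl
        · exact hXW' hx
        · exact hC.supp _ _ gcd
        · exact hC.supp _ _ gdd) (hXne.mono subset_union_left) (by
        intro e; apply hXW; rw [← e]; ext x; simp only [mem_sdiff, mem_union, mem_insert, mem_singleton]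
        constructor
        · intro hx; refine ⟨Or.inl hx, ?_⟩; rintro (rfl | rfl) <;> contradiction
        · grind)
      omega
    · exact g4_sep hC h hs X hXW' ha hb hcX hdX
    · rw [← hcomm]
      exact g4_sep hC h.flip (fun A h1 h2 h3 h4 h5 => hs' A h1 h3 h2 h5 h4) X hXW' hb ha hdX hcX
    · have hle : dc G X ≤ dc (g4 G a b c d c' d') X := by
        apply card_le_card_of_injOn (fun e => if e = s(c,c') then s(a,c') else if e = s(d,d') then s(b,d') else e)
        · intro e he
          simp only [coe_filter, Set.mem_ofPred_eq] at he ⊢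
          obtain ⟨he, v, hv, u, hu, rfl⟩ := he
          rw [mem_eF] at he
          have hvc : v ≠ c := by rintro rfl; grind
          have hvd : v ≠ d := by rintro rfl; grind
          by_cases uc : u = c
          · subst uc
            have : v = c' := by
              rcases (nc v).1 he.symm with rfl | rfl | rfl
              · grind
              · grind
              · rfl
            subst this
            rw [if_pos Sym2.eq_swap, mem_eF, hadj]
            exact ⟨by grind, v, hv, a, ha, Sym2.eq_swap⟩
          by_cases ud : u = d
          · subst ud
            have : v = d' := by
              rcases (nd v).1 he.symm with rfl | rfl | rfl
              · grind
              · grind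
              · rfl
            subst this
            rw [if_neg (by rw [Sym2.eq_iff]; grind), if_pos Sym2.eq_swap, mem_eF, hadj]
            exact ⟨by grind, v, hv, b, hb, Sym2.eq_swap⟩
          rw [if_neg (by rw [Sym2.eq_iff]; grind), if_neg (by rw [Sym2.eq_iff]; grind), mem_eF, hadj]
          exact ⟨by grind, v, hv, u, hu, rfl⟩
        · intro e he f hf hef
          simp only [coe_filter, Set.mem_ofPred_eq] at he hf hef
          have k1 : ∀ e ∈ eF G, e ≠ s(a,c') := by
            rintro e he rfl; rw [mem_eF, na] at he; grind
          have k2 : ∀ e ∈ eF G, e ≠ s(b,d') := by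
            rintro e he rfl; rw [mem_eF, nb] at he; grind
          have k3 : s(a,c') ≠ s(b,d') := by rw [ne_eq, Sym2.eq_iff]; grind
          have := k1 e he.1; have := k1 f hf.1; have := k2 e he.1; have := k2 f hf.1
          grind
      have := hC.tec X hXW' hXne (by
        rintro rfl; exact hcX (hC.supp _ _ gcd))
      omega

end R4

set_option linter.unusedSectionVars false
set_option linter.unusedVariables false
set_option linter.unusedSimpArgs false

section R4b
variable {V : Type*} [Fintype V] [DecidableEq V]
open Finset

lemma D2.two {H : SimpleGraph V} (h : D2 H) {u p q r : V} (hu : ∀ x, H.Adj u x → x = p ∨ x = q ∨ x = r)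
    (h1 : p ≠ q) (h2 : p ≠ r) (h3 : q ≠ r) :
    (iso H u) ∨ (H.Adj u p ∧ H.Adj u q ∧ ¬ H.Adj u r) ∨ (H.Adj u p ∧ ¬ H.Adj u q ∧ H.Adj u r) ∨
    (¬ H.Adj u p ∧ H.Adj u q ∧ H.Adj u r) := by
  rcases h u with h | ⟨a, b, hab, h⟩
  · exact Or.inl h
  · right
    have ha := hu a ((h a).2 (Or.inl rfl))
    have hb := hu b ((h b).2 (Or.inr rfl))
    simp only [h]
    grind

lemma insG {G H : SimpleGraph V} {W : Finset V} {k : ℕ} {u v : V} (l : List V) (hR : Rl W H (k + l.length))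
    (huv : H.Adj u v) (hl : ∀ w ∈ l, iso H w ∧ w ∈ W) (hnd : l.Nodup)
    (hch : List.IsChain G.Adj (u :: (l ++ [v]))) (hG : ∀ x y, H.Adj x y → s(x,y) ≠ s(u,v) → G.Adj x y) :
    Good G W k := by
  obtain ⟨H1, h1, h2, h3, h4⟩ := Rl.insl (Gc := G.Adj) (fun x y h => h.symm) l hR huv hl hnd hch
  refine ⟨H1, ?_, h1⟩
  intro x y hxy
  rcases h3 x y hxy with h | h
  · exact hG x y h.1 h.2
  · exact h

lemma cycG {G H : SimpleGraph V} {W : Finset V} {k k' : ℕ} {a b c : V} {l : List V} (hR : Rl W H k')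
    (hk : k' ≤ k + l.length + 1)
    (hl : ∀ w ∈ a :: b :: c :: l, iso H w ∧ w ∈ W) (hnd : (a :: b :: c :: l).Nodup)
    (hch : List.IsChain G.Adj (a :: b :: c :: (l ++ [a]))) (hG : ∀ x y, H.Adj x y → G.Adj x y) :
    Good G W k := by
  obtain ⟨H1, h1, h2, h3, h4⟩ := Rl.addc (Gc := G.Adj) (fun x y h => h.symm) hR hk hl hnd hch
  refine ⟨H1, ?_, h1⟩
  intro x y hxy
  rcases h3 x y hxy with h | h
  · exact hG x y h
  · exact h

/-- two-step insertion -/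
lemma ins2G {G H : SimpleGraph V} {W : Finset V} {k : ℕ} {u v u' v' : V} (l l' : List V)
    (hR : Rl W H (k + l'.length + l.length))
    (huv : H.Adj u v) (huv' : H.Adj u' v') (hne : s(u',v') ≠ s(u,v)) (hl : ∀ w ∈ l, iso H w ∧ w ∈ W)
    (hl' : ∀ w ∈ l', iso H w ∧ w ∈ W) (hnd : (l ++ l').Nodup)
    (hch : List.IsChain G.Adj (u :: (l ++ [v]))) (hch' : List.IsChain G.Adj (u' :: (l' ++ [v'])))
    (hG : ∀ x y, H.Adj x y → s(x,y) ≠ s(u,v) → s(x,y) ≠ s(u',v') → G.Adj x y) :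
    Good G W k := by
  rw [List.nodup_append] at hnd
  obtain ⟨H1, h1, h2, h3, h4⟩ := Rl.insl (Gc := G.Adj) (fun x y h => h.symm) l hR huv hl hnd.1 hch
  refine insG l' h1 (h2 _ _ huv' hne) (fun w hw => ⟨h4 w (fun h => hnd.2.2 w h w hw rfl) (hl' w hw).1, (hl' w hw).2⟩) hnd.2.1 hch' ?_
  intro x y hxy hne'
  rcases h3 x y hxy with h | h
  · exact hG x y h.1 h.2 hne'
  · exact h

lemma swap_mem {W : Finset V} {a b : V} (ha : a ∈ W) (hb : b ∈ W) (x : V) : Equiv.swap a b x ∈ W ↔ x ∈ W := by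
  by_cases h1 : x = a
  · subst h1; simp [ha, hb]
  by_cases h2 : x = b
  · subst h2; simp [ha, hb]
  rw [Equiv.swap_apply_of_ne_of_ne h1 h2]

lemma g4_ext {G : SimpleGraph V} {W : Finset V} (hC : Cub G W) {a b c d a' b' c' d' : V}
    (h : Q4 G a b c d a' b' c' d') (k : ℕ) (hg : Good (g4 G a b c d c' d') (W \ {c, d}) k) : Good G W k := by
  have hadj := g4_adj h
  obtain ⟨H, hle, hR⟩ := hg
  have ⟨na, nb, nc, nd, ac, bd, a1, a2, a3, b1, b2, b3, c1, c2, c3, d1, d2, d3, e1, e2⟩ := h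
  have gab : G.Adj a b := by grind
  have gaa : G.Adj a a' := by grind
  have gbb : G.Adj b b' := by grind
  have gad : G.Adj a d := by grind
  have gbc : G.Adj b c := by grind
  have gcc : G.Adj c c' := by grind
  have gcd : G.Adj c d := by grind
  have gdd : G.Adj d d' := by grind
  have nab := gab.ne
  have ncd := gcd.ne
  have nad := gad.ne
  have nbc := gbc.ne
  have ncc := gcc.ne
  have ndd := gdd.ne
  have naa := gaa.ne
  have nbb := gbb.ne
  have aW := (hC.adj_mem gab).1
  have bW := (hC.adj_mem gab).2
  have cW := (hC.adj_mem gcd).1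
  have dW := (hC.adj_mem gcd).2
  have hR2 : Rl W H (k+2) := by
    refine (hR.mono_W sdiff_subset).mono_k ?_
    have : W \ (W \ {c,d}) ⊆ {c,d} := by intro x; simp only [mem_sdiff, mem_insert, mem_singleton]; tauto
    have := card_le_card this
    have := card_le_two (a := c) (b := d)
    omega
  have hH : ∀ x y, H.Adj x y → (G.Adj x y ∧ x ≠ c ∧ y ≠ c ∧ x ≠ d ∧ y ≠ d) ∨
      (x = a ∧ y = c') ∨ (x = c' ∧ y = a) ∨ (x = b ∧ y = d') ∨ (x = d' ∧ y = b) := fun x y hxy => (hadj x y).1 (hle hxy)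
  have ic : iso H c := by intro x hx; have := hH _ _ hx; grind
  have id : iso H d := by intro x hx; have := hH _ _ hx; grind
  have hHG : ∀ x y, H.Adj x y → s(x,y) ≠ s(a,c') → s(x,y) ≠ s(b,d') → G.Adj x y := by
    intro x y hxy h1 h2
    rw [ne_eq, Sym2.eq_iff] at h1 h2
    have := hH _ _ hxy; grind
  have sAB : s(a,c') ≠ s(b,d') := by rw [ne_eq, Sym2.eq_iff]; grind
  have hA := hR.d2.two (u := a) (p := a') (q := c') (r := b) (by intro x hx; have := hH _ _ hx; have := na x; grind) e1 a1 c2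
  have hB := hR.d2.two (u := b) (p := b') (q := d') (r := a) (by intro x hx; have := hH _ _ hx; have := nb x; grind) e2 b1 d1
  have swne : ∀ {x y u v : V}, H.Adj x y → ¬ H.Adj u v → s(x,y) ≠ s(u,v) := by
    intro x y u v h1 h2 h3
    rw [adj_sym2 h3] at h1; exact h2 h1
  have hcomm := SimpleGraph.adj_comm H a b
  have gd := gad.symm
  have gcb := gbc.symm
  have gdc := gcd.symm
  have gba := gab.symm
  rcases hA with hA | ⟨hA1, hA2, hA3⟩ | ⟨hA1, hA2, hA3⟩ | ⟨hA1, hA2, hA3⟩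
  · rcases hB with hB | ⟨hB1, hB2, hB3⟩ | ⟨hB1, hB2, hB3⟩ | ⟨hB1, hB2, hB3⟩
    · refine cycG (a := a) (b := b) (c := c) (l := [d]) hR2 (by simp) ?_ ?_ ?_ ?_
      · simp [hA, hB, ic, id, aW, bW, cW, dW]
      · simp [nab, ac, nad, nbc, bd, ncd]
      · simp [gab, gbc, gcd, gd]
      · intro x y hxy; exact hHG x y hxy (swne hxy (hA _)) (swne hxy (hB _))
    · refine insG (u := b) (v := d') [a, d] hR2 hB2 ?_ ?_ ?_ ?_
      · simp [hA, id, aW, dW]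
      · simp [nad]
      · simp [gba, gad, gdd]
      · intro x y hxy hne; exact hHG x y hxy (swne hxy (hA _)) hne
    · exact absurd hB3.symm (hA _)
    · exact absurd hB3.symm (hA _)
  · rcases hB with hB | ⟨hB1, hB2, hB3⟩ | ⟨hB1, hB2, hB3⟩ | ⟨hB1, hB2, hB3⟩
    · refine insG (u := a) (v := c') [b, c] hR2 hA2 ?_ ?_ ?_ ?_
      · simp [hB, ic, bW, cW]
      · simp [nbc]
      · simp [gab, gbc, gcc]
      · intro x y hxy hne; exact hHG x y hxy hne (swne hxy (hB _))
    · have R1 := Rl.ins (k := k+1) hR2 hA2 ic cW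
      have R2 := Rl.ins (k := k) (u := b) (v := d') (w := d) R1 (by rw [edit_adj]; left; exact ⟨hB2, sAB.symm⟩)
        (by
          intro x; rw [edit_adj]; have := id x
          simp only [Set.mem_insert_iff, Set.mem_singleton_iff, Sym2.eq_iff]
          grind) dW
      set H2 := edit (edit H {s(a,c')} {s(a,c), s(c,c')}) {s(b,d')} {s(b,d), s(d,d')} with hH2
      have H2a : ∀ x y, H2.Adj x y ↔ (H.Adj x y ∧ s(x,y) ≠ s(a,c') ∧ s(x,y) ≠ s(b,d')) ∨ s(x,y) = s(a,c) ∨ s(x,y) = s(c,c') ∨ s(x,y) = s(b,d) ∨ s(x,y) = s(d,d') := by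
        intro x y
        rw [hH2, edit_adj, edit_adj]
        clear swne hHG hH hadj na nb nc nd R1 R2 hH2 hR hR2 hle h hC
        simp only [Set.mem_insert_iff, Set.mem_singleton_iff, Sym2.eq_iff, ne_eq] at sAB ⊢
        generalize H.Adj x y = P
        grind
      have H2G : ∀ x y, H2.Adj x y → s(x,y) ≠ s(a,c) → s(x,y) ≠ s(b,d) → G.Adj x y := by
        intro x y hxy h1 h2
        rcases (H2a x y).1 hxy with h | h | h | h | h
        · exact hHG x y h.1 h.2.1 h.2.2
        · exact absurd h h1
        · rw [adj_sym2 h]; exact gcc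
        · exact absurd h h2
        · rw [adj_sym2 h]; exact gdd
      have hnac : ∀ x, ¬ H.Adj c x := ic
      have hnad : ∀ x, ¬ H.Adj d x := id
      have hnac' : ∀ x, ¬ H.Adj x c := fun x h => ic x h.symm
      have hnad' : ∀ x, ¬ H.Adj x d := fun x h => id x h.symm
      rcases R2.switch (a := a) (c := c) (b := b) (d := d) (by rw [H2a]; simp) (by rw [H2a]; simp) nab nad nbc ncd
        (by rw [H2a]; simp only [Sym2.eq_iff]; grind) (by rw [H2a]; simp only [Sym2.eq_iff]; grind)
        (by rw [H2a]; simp only [Sym2.eq_iff]; grind) (by rw [H2a]; simp only [Sym2.eq_iff]; grind) with R3 | R3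
      · refine ⟨_, ?_, R3⟩
        intro x y hxy
        rw [edit_adj] at hxy
        simp only [Set.mem_insert_iff, Set.mem_singleton_iff, not_or] at hxy
        rcases hxy with ⟨h1, h2, h3⟩ | ⟨h1 | h1, h2⟩
        · exact H2G x y h1 h2 h3
        · rw [adj_sym2 h1]; exact gad
        · rw [adj_sym2 h1]; exact gbc
      · refine ⟨_, ?_, R3⟩
        intro x y hxy
        rw [edit_adj] at hxy
        simp only [Set.mem_insert_iff, Set.mem_singleton_iff, not_or] at hxy
        rcases hxy with ⟨h1, h2, h3⟩ | ⟨h1 | h1, h2⟩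
        · exact H2G x y h1 h2 (by rw [Sym2.eq_swap (a := b)]; exact h3)
        · rw [adj_sym2 h1]; exact gab
        · rw [adj_sym2 h1]; exact gdc
    · exact absurd hB3.symm hA3
    · exact absurd hB3.symm hA3
  · rcases hB with hB | ⟨hB1, hB2, hB3⟩ | ⟨hB1, hB2, hB3⟩ | ⟨hB1, hB2, hB3⟩
    · exact absurd hA3.symm (hB _)
    · exact absurd hA3.symm hB3
    · refine insG (u := a) (v := b) [d, c] hR2 hA3 ?_ ?_ ?_ ?_
      · simp [ic, id, cW, dW]
      · simp [ncd.symm]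
      · simp [gad, gdc, gcb]
      · intro x y hxy hne; exact hHG x y hxy (swne hxy hA2) (swne hxy hB2)
    · refine insG (u := b) (v := d') [c, d] hR2 hB2 ?_ ?_ ?_ ?_
      · simp [ic, id, cW, dW]
      · simp [ncd]
      · simp [gbc, gcd, gdd]
      · intro x y hxy hne; exact hHG x y hxy (swne hxy hA2) hne
  · rcases hB with hB | ⟨hB1, hB2, hB3⟩ | ⟨hB1, hB2, hB3⟩ | ⟨hB1, hB2, hB3⟩
    · exact absurd hA3.symm (hB _)
    · exact absurd hA3.symm hB3
    · refine insG (u := a) (v := c') [d, c] hR2 hA2 ?_ ?_ ?_ ?_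
      · simp [ic, id, cW, dW]
      · simp [ncd.symm]
      · simp [gad, gdc, gcc]
      · intro x y hxy hne; exact hHG x y hxy hne (swne hxy hB2)
    · have R1 := hR2.renameBy (Equiv.swap a b) (swap_mem aW bW)
      have sa : Equiv.swap a b a = b := Equiv.swap_apply_left a b
      have sb : Equiv.swap a b b = a := Equiv.swap_apply_right a b
      have so : ∀ x, x ≠ a → x ≠ b → Equiv.swap a b x = x := fun x h1 h2 => Equiv.swap_apply_of_ne_of_ne h1 h2
      have sc := so c ac.symm nbc.symm
      have sd := so d nad.symm bd.symm
      have hcx : iso (H.comap (Equiv.swap a b)) c := by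
        intro x hx; rw [SimpleGraph.comap_adj, sc] at hx; exact ic _ hx
      have hdx : iso (H.comap (Equiv.swap a b)) d := by
        intro x hx; rw [SimpleGraph.comap_adj, sd] at hx; exact id _ hx
      have hNA : ∀ x, H.Adj a x → x = c' ∨ x = b := by
        intro x hx; have := hH _ _ hx; have := na x; grind
      have hNB : ∀ x, H.Adj b x → x = d' ∨ x = a := by
        intro x hx; have := hH _ _ hx; have := nb x; grind
      refine ins2G (H := H.comap (Equiv.swap a b)) (u := b) (v := c') (u' := a) (v' := d') [c] [d] R1 ?_ ?_ ?_ ?_ ?_ ?_ ?_ ?_ ?_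
      · rw [SimpleGraph.comap_adj, sb, so c' c1 c2]; exact hA2
      · rw [SimpleGraph.comap_adj, sa, so d' d1 d2]; exact hB2
      · rw [ne_eq, Sym2.eq_iff]; grind
      · simp [hcx, cW]
      · simp [hdx, dW]
      · simp [ncd]
      · simp [gbc, gcc]
      · simp [gad, gdd]
      · intro x y hxy h1 h2
        rw [SimpleGraph.comap_adj] at hxy
        rw [ne_eq, Sym2.eq_iff] at h1 h2
        by_cases xa : x = a
        · subst xa; rw [sa] at hxy
          rcases hNB _ hxy with h | h
          · have : y = d' := by
              have := congrArg (Equiv.swap x b) h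
              rw [Equiv.swap_apply_self, so d' d1 d2] at this; exact this
            grind
          · have : y = b := by
              have := congrArg (Equiv.swap x b) h
              rw [Equiv.swap_apply_self, sa] at this; exact this
            rw [this]; exact gab
        by_cases xb : x = b
        · subst xb; rw [sb] at hxy
          rcases hNA _ hxy with h | h
          · have : y = c' := by
              have := congrArg (Equiv.swap a x) h
              rw [Equiv.swap_apply_self, so c' c1 c2] at this; exact this
            grind
          · have : y = a := by
              have := congrArg (Equiv.swap a x) h
              rw [Equiv.swap_apply_self, sb] at this; exact this
            rw [this]; exact gba
        rw [so x xa xb] at hxy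
        by_cases ya : y = a
        · subst ya; rw [sa] at hxy
          rcases hNB _ hxy.symm with h | h <;> grind
        by_cases yb : y = b
        · subst yb; rw [sb] at hxy
          rcases hNA _ hxy.symm with h | h <;> grind
        rw [so y ya yb] at hxy
        exact hHG x y hxy (by rw [ne_eq, Sym2.eq_iff]; grind) (by rw [ne_eq, Sym2.eq_iff]; grind)

lemma red4 {G : SimpleGraph V} {W : Finset V} (hC : Cub G W) {a b c d a' b' c' d' : V}
    (h : Q4 G a b c d a' b' c' d')
    (hs : ∀ A ⊆ W, a ∉ A → b ∉ A → c ∉ A → d ∉ A → a' ∈ A → c' ∈ A → dc G A ≠ 2)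
    (hs' : ∀ A ⊆ W, a ∉ A → b ∉ A → c ∉ A → d ∉ A → b' ∈ A → d' ∈ A → dc G A ≠ 2) :
    ∃ (G' : SimpleGraph V) (W' : Finset V), Cub G' W' ∧ W'.card < W.card ∧ W'.Nonempty ∧ ∀ k, Good G' W' k → Good G W k := by
  have gab : G.Adj a b := by rw [h.na]; simp
  have gcd : G.Adj c d := by rw [h.nc]; simp
  have gad : G.Adj a d := by rw [h.na]; simp
  refine ⟨_, _, g4_cub hC h hs hs', ?_, ⟨a, ?_⟩, fun k => g4_ext hC h k⟩
  · apply card_lt_card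
    refine ⟨sdiff_subset, fun hh => ?_⟩
    have := hh (hC.supp _ _ gcd)
    simp at this
  · simp [hC.supp _ _ gab, h.ac, gad.ne]

end R4b

set_option linter.unusedSectionVars false
set_option linter.unusedVariables false
set_option linter.unusedSimpArgs false

section R6
variable {V : Type*} [Fintype V] [DecidableEq V]
open Finset

structure D6 (G : SimpleGraph V) (a b c d p q u v : V) : Prop where
  na : ∀ x, G.Adj a x ↔ x = b ∨ x = d ∨ x = p
  nb : ∀ x, G.Adj b x ↔ x = a ∨ x = c ∨ x = d
  nc : ∀ x, G.Adj c x ↔ x = b ∨ x = d ∨ x = q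
  nd : ∀ x, G.Adj d x ↔ x = a ∨ x = c ∨ x = b
  np : ∀ x, G.Adj p x ↔ x = a ∨ x = q ∨ x = u
  nq : ∀ x, G.Adj q x ↔ x = c ∨ x = p ∨ x = v
  ac : a ≠ c
  aq : a ≠ q
  cp : c ≠ p
  pb : p ≠ b
  pd : p ≠ d
  qb : q ≠ b
  qd : q ≠ d
  ua : u ≠ a
  ub : u ≠ b
  uc : u ≠ c
  ud : u ≠ d
  uq : u ≠ q
  va : v ≠ a
  vb : v ≠ b
  vc : v ≠ c
  vd : v ≠ d
  vp : v ≠ p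

def g6 (G : SimpleGraph V) (a c p q u v : V) : SimpleGraph V :=
  edit G {e | p ∈ e ∨ q ∈ e} {s(a,u), s(c,v)}

lemma g6_adj {G : SimpleGraph V} {a b c d p q u v : V} (h : D6 G a b c d p q u v) (x y : V) :
    (g6 G a c p q u v).Adj x y ↔ (G.Adj x y ∧ x ≠ p ∧ y ≠ p ∧ x ≠ q ∧ y ≠ q) ∨
      (x = a ∧ y = u) ∨ (x = u ∧ y = a) ∨ (x = c ∧ y = v) ∨ (x = v ∧ y = c) := by
  have := h.ua
  have := h.vc
  unfold g6
  rw [edit_adj]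
  simp only [Set.mem_ofPred_eq, Set.mem_insert_iff, Set.mem_singleton_iff, Sym2.eq_iff, Sym2.mem_iff]
  grind

lemma g6_cub {G : SimpleGraph V} {W : Finset V} (hC : Cub G W) {a b c d p q u v : V}
    (h : D6 G a b c d p q u v) :
    Cub (g6 G a c p q u v) (W \ {p, q}) := by
  have hadj := g6_adj h
  have ⟨na, nb, nc, nd, np, nq, ac, aq, cp, pb, pd, qb, qd, ua, ub, uc, ud, uq, va, vb, vc, vd, vp⟩ := h
  have gab : G.Adj a b := by grind
  have gad : G.Adj a d := by grind
  have gap : G.Adj a p := by grind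
  have gbc : G.Adj b c := by grind
  have gbd : G.Adj b d := by grind
  have gcd : G.Adj c d := by grind
  have gcq : G.Adj c q := by grind
  have gpq : G.Adj p q := by grind
  have gpu : G.Adj p u := by grind
  have gqv : G.Adj q v := by grind
  have nab := gab.ne
  have nad := gad.ne
  have nap := gap.ne
  have nbc := gbc.ne
  have nbd := gbd.ne
  have ncd := gcd.ne
  have ncq := gcq.ne
  have npq := gpq.ne
  have npu := gpu.ne
  have nqv := gqv.ne
  refine ⟨?_, ?_, ?_⟩
  · intro x y hxy
    rw [hadj] at hxy
    simp only [mem_sdiff, mem_insert, mem_singleton, not_or]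
    rcases hxy with ⟨h, h1, h2, h3, h4⟩ | ⟨rfl, rfl⟩ | ⟨rfl, rfl⟩ | ⟨rfl, rfl⟩ | ⟨rfl, rfl⟩
    · exact ⟨hC.supp _ _ h, h1, h3⟩
    · exact ⟨hC.supp _ _ gab, nap, aq⟩
    · exact ⟨hC.supp _ _ gpu.symm, npu.symm, uq⟩
    · exact ⟨hC.supp _ _ gcd, cp, ncq⟩
    · exact ⟨hC.supp _ _ gqv.symm, vp, nqv.symm⟩
  · intro x hx
    simp only [mem_sdiff, mem_insert, mem_singleton, not_or] at hx
    obtain ⟨hxW, hxc, hxd⟩ := hx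
    by_cases xa : x = a
    · subst xa
      refine ⟨b, d, u, nbd, ub.symm, ud.symm, fun y => ?_⟩
      rw [hadj]; have := na y; grind
    by_cases xb : x = c
    · subst xb
      refine ⟨b, d, v, nbd, vb.symm, vd.symm, fun y => ?_⟩
      rw [hadj]; have := nc y; grind
    obtain ⟨p1, q1, r1, n1, n2, n3, hn⟩ := hC.deg x hxW
    let f : V → V := fun y => if y = p then a else if y = q then c else y
    have hxcc : G.Adj x p ↔ x = u := by rw [SimpleGraph.adj_comm, np]; grind
    have hxdd : G.Adj x q ↔ x = v := by rw [SimpleGraph.adj_comm, nq]; grind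
    have hxaa : G.Adj x a ↔ x = b ∨ x = d := by rw [SimpleGraph.adj_comm, na]; grind
    have hxbb : G.Adj x c ↔ x = b ∨ x = d := by rw [SimpleGraph.adj_comm, nc]; grind
    have hinj : ∀ y z, G.Adj x y → G.Adj x z → y ≠ z → f y ≠ f z := by
      intro y z hy hz hne
      simp only [f]
      grind
    refine ⟨f p1, f q1, f r1, hinj _ _ ((hn _).2 (by grind)) ((hn _).2 (by grind)) n1,
      hinj _ _ ((hn _).2 (by grind)) ((hn _).2 (by grind)) n2, hinj _ _ ((hn _).2 (by grind)) ((hn _).2 (by grind)) n3, ?_⟩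
    have h1 : ∀ y, (g6 G a c p q u v).Adj x y ↔ ∃ z, G.Adj x z ∧ y = f z := by
      intro y
      rw [hadj]
      constructor
      · rintro (⟨h, h1, h2, h3, h4⟩ | ⟨rfl, rfl⟩ | ⟨rfl, rfl⟩ | ⟨rfl, rfl⟩ | ⟨rfl, rfl⟩)
        · exact ⟨y, h, by simp [f, h2, h4]⟩
        · exact absurd rfl xa
        · exact ⟨p, gpu.symm, by simp [f]⟩
        · exact absurd rfl xb
        · exact ⟨q, gqv.symm, by simp [f, npq.symm]⟩
      · rintro ⟨z, hz, rfl⟩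
        simp only [f]
        by_cases zc : z = p
        · subst zc; rw [if_pos rfl]; grind
        · by_cases zd : z = q
          · subst zd; rw [if_neg zc, if_pos rfl]; grind
          · rw [if_neg zc, if_neg zd]; grind
    intro y
    rw [h1]
    constructor
    · rintro ⟨z, hz, rfl⟩
      rcases (hn z).1 hz with rfl | rfl | rfl <;> simp
    · rintro (rfl | rfl | rfl)
      · exact ⟨p1, (hn _).2 (by grind), rfl⟩
      · exact ⟨q1, (hn _).2 (by grind), rfl⟩
      · exact ⟨r1, (hn _).2 (by grind), rfl⟩
  · intro X hX hXne hXW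
    have hXW' : X ⊆ W := hX.trans sdiff_subset
    have hpX : p ∉ X := fun h => by have := hX h; simp at this
    have hqX : q ∉ X := fun h => by have := hX h; simp at this
    have gab' : (g6 G a c p q u v).Adj a b := by rw [hadj]; grind
    have gad' : (g6 G a c p q u v).Adj a d := by rw [hadj]; grind
    have gbc' : (g6 G a c p q u v).Adj b c := by rw [hadj]; grind
    have gcd' : (g6 G a c p q u v).Adj c d := by rw [hadj]; grind
    by_cases ha : a ∈ X <;> by_cases hc : c ∈ X
    · -- both in
      have hle : dc G (X ∪ {p, q}) ≤ dc (g6 G a c p q u v) X := by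
        have hY : ∀ x, x ∈ X ∪ {p, q} ↔ x ∈ X ∨ x = p ∨ x = q := by intro x; simp only [mem_union, mem_insert, mem_singleton]
        apply card_le_card_of_injOn (fun e => if e = s(p,u) then s(a,u) else if e = s(q,v) then s(c,v) else e)
        · intro e he
          simp only [coe_filter, Set.mem_ofPred_eq] at he ⊢
          obtain ⟨he, x, hx, y, hy, rfl⟩ := he
          rw [hY] at hx hy
          rw [mem_eF] at he
          have hyc : y ≠ p := by grind
          have hyd : y ≠ q := by grind
          by_cases xc : x = p
          · subst xc
            have : y = u := by
              rcases (np y).1 he with rfl | rfl | rfl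
              · grind
              · grind
              · rfl
            subst this
            rw [if_pos rfl, mem_eF, hadj]
            exact ⟨by grind, a, ha, y, by grind, rfl⟩
          by_cases xd : x = q
          · subst xd
            have : y = v := by
              rcases (nq y).1 he with rfl | rfl | rfl
              · grind
              · grind
              · rfl
            subst this
            rw [if_neg (by rw [Sym2.eq_iff]; grind), if_pos rfl, mem_eF, hadj]
            exact ⟨by grind, c, hc, y, by grind, rfl⟩
          rw [if_neg (by rw [Sym2.eq_iff]; grind), if_neg (by rw [Sym2.eq_iff]; grind), mem_eF, hadj]
          exact ⟨by grind, x, by grind, y, by grind, rfl⟩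
        · intro e he f hf hef
          simp only [coe_filter, Set.mem_ofPred_eq] at he hf hef
          have k1 : ∀ e ∈ eF G, e ≠ s(a,u) := by
            rintro e he rfl; rw [mem_eF, na] at he; grind
          have k2 : ∀ e ∈ eF G, e ≠ s(c,v) := by
            rintro e he rfl; rw [mem_eF, nc] at he; grind
          have k3 : s(a,u) ≠ s(c,v) := by rw [ne_eq, Sym2.eq_iff]; grind
          have := k1 e he.1; have := k1 f hf.1; have := k2 e he.1; have := k2 f hf.1
          clear hadj na nb nc nd np nq k1 k2
          grind
      have := hC.tec (X ∪ {p, q}) (by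
        intro x hx; simp only [mem_union, mem_insert, mem_singleton] at hx
        rcases hx with hx | rfl | rfl
        · exact hXW' hx
        · exact hC.supp _ _ gpq
        · exact hC.supp _ _ gqv) (hXne.mono subset_union_left) (by
        intro e; apply hXW; rw [← e]; ext x; simp only [mem_sdiff, mem_union, mem_insert, mem_singleton]
        constructor
        · intro hx; refine ⟨Or.inl hx, ?_⟩; rintro (rfl | rfl) <;> contradiction
        · tauto)
      omega
    · by_cases hb : b ∈ X <;> by_cases hd : d ∈ X
      · exact two_le_dc gbc' hb hc gcd'.symm hd hc (by grind)
      · exact two_le_dc gbc' hb hc gad' ha hd (by grind)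
      · exact two_le_dc gab' ha hb gcd'.symm hd hc (by grind)
      · exact two_le_dc gab' ha hb gad' ha hd (by grind)
    · by_cases hb : b ∈ X <;> by_cases hd : d ∈ X
      · exact two_le_dc gab'.symm hb ha gad'.symm hd ha (by grind)
      · exact two_le_dc gab'.symm hb ha gcd' hc hd (by grind)
      · exact two_le_dc gbc'.symm hc hb gad'.symm hd ha (by grind)
      · exact two_le_dc gbc'.symm hc hb gcd' hc hd (by grind)
    · have hle : dc G X ≤ dc (g6 G a c p q u v) X := by
        apply card_le_card_of_injOn (fun e => if e = s(p,u) then s(a,u) else if e = s(q,v) then s(c,v) else e)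
        · intro e he
          simp only [coe_filter, Set.mem_ofPred_eq] at he ⊢
          obtain ⟨he, y, hy, x, hx, rfl⟩ := he
          rw [mem_eF] at he
          have hyc : y ≠ p := by rintro rfl; grind
          have hyd : y ≠ q := by rintro rfl; grind
          by_cases xc : x = p
          · subst xc
            have : y = u := by
              rcases (np y).1 he.symm with rfl | rfl | rfl
              · grind
              · grind
              · rfl
            subst this
            rw [if_pos Sym2.eq_swap, mem_eF, hadj]
            exact ⟨by grind, y, hy, a, ha, Sym2.eq_swap⟩
          by_cases xd : x = q
          · subst xd
            have : y = v := by
              rcases (nq y).1 he.symm with rfl | rfl | rfl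
              · grind
              · grind
              · rfl
            subst this
            rw [if_neg (by rw [Sym2.eq_iff]; grind), if_pos Sym2.eq_swap, mem_eF, hadj]
            exact ⟨by grind, y, hy, c, hc, Sym2.eq_swap⟩
          rw [if_neg (by rw [Sym2.eq_iff]; grind), if_neg (by rw [Sym2.eq_iff]; grind), mem_eF, hadj]
          exact ⟨by grind, y, hy, x, hx, rfl⟩
        · intro e he f hf hef
          simp only [coe_filter, Set.mem_ofPred_eq] at he hf hef
          have k1 : ∀ e ∈ eF G, e ≠ s(a,u) := by
            rintro e he rfl; rw [mem_eF, na] at he; grind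
          have k2 : ∀ e ∈ eF G, e ≠ s(c,v) := by
            rintro e he rfl; rw [mem_eF, nc] at he; grind
          have k3 : s(a,u) ≠ s(c,v) := by rw [ne_eq, Sym2.eq_iff]; grind
          have := k1 e he.1; have := k1 f hf.1; have := k2 e he.1; have := k2 f hf.1
          clear hadj na nb nc nd np nq k1 k2
          grind
      have := hC.tec X hXW' hXne (by
        rintro rfl; exact hpX (hC.supp _ _ gpq))
      omega

lemma par4 (ab ad au bc bd cd cv : Prop)
    (ha : (¬ab ∧ ¬ad ∧ ¬au) ∨ (ab ∧ ad ∧ ¬au) ∨ (ab ∧ ¬ad ∧ au) ∨ (¬ab ∧ ad ∧ au))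
    (hb : (¬ab ∧ ¬bc ∧ ¬bd) ∨ (ab ∧ bc ∧ ¬bd) ∨ (ab ∧ ¬bc ∧ bd) ∨ (¬ab ∧ bc ∧ bd))
    (hc : (¬bc ∧ ¬cd ∧ ¬cv) ∨ (bc ∧ cd ∧ ¬cv) ∨ (bc ∧ ¬cd ∧ cv) ∨ (¬bc ∧ cd ∧ cv))
    (hd : (¬ad ∧ ¬cd ∧ ¬bd) ∨ (ad ∧ cd ∧ ¬bd) ∨ (ad ∧ ¬cd ∧ bd) ∨ (¬ad ∧ cd ∧ bd)) :
    (au ∧ cv) ∨ (¬au ∧ ¬cv ∧ ((¬ab ∧ ¬ad ∧ ¬bc ∧ ¬bd ∧ ¬cd) ∨ (ab ∧ ad ∧ bc ∧ cd ∧ ¬bd) ∨ (ab ∧ ad ∧ bd ∧ ¬bc ∧ ¬cd) ∨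
      (bc ∧ cd ∧ bd ∧ ¬ab ∧ ¬ad))) := by
  by_cases h1 : ab <;> by_cases h2 : ad <;> by_cases h3 : bc <;> by_cases h4 : bd <;> by_cases h5 : cd <;> simp_all

lemma D2.two' {H : SimpleGraph V} (h : D2 H) {u p q r : V} (hu : ∀ x, H.Adj u x → x = p ∨ x = q ∨ x = r)
    (h1 : p ≠ q) (h2 : p ≠ r) (h3 : q ≠ r) :
    (¬ H.Adj u p ∧ ¬ H.Adj u q ∧ ¬ H.Adj u r) ∨ (H.Adj u p ∧ H.Adj u q ∧ ¬ H.Adj u r) ∨ (H.Adj u p ∧ ¬ H.Adj u q ∧ H.Adj u r) ∨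
    (¬ H.Adj u p ∧ H.Adj u q ∧ H.Adj u r) := by
  rcases h.two hu h1 h2 h3 with h | h
  · left; exact ⟨h _, h _, h _⟩
  · right; exact h

lemma g6_ext {G : SimpleGraph V} {W : Finset V} (hC : Cub G W) {a b c d p q u v : V}
    (h : D6 G a b c d p q u v) (k : ℕ) (hg : Good (g6 G a c p q u v) (W \ {p, q}) k) : Good G W k := by
  have hadj := g6_adj h
  obtain ⟨H, hle, hR⟩ := hg
  have ⟨na, nb, nc, nd, np, nq, ac, aq, cp, pb, pd, qb, qd, ua, ub, uc, ud, uq, va, vb, vc, vd, vp⟩ := h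
  have gab : G.Adj a b := by grind
  have gad : G.Adj a d := by grind
  have gap : G.Adj a p := by grind
  have gbc : G.Adj b c := by grind
  have gbd : G.Adj b d := by grind
  have gcd : G.Adj c d := by grind
  have gcq : G.Adj c q := by grind
  have gpq : G.Adj p q := by grind
  have gpu : G.Adj p u := by grind
  have gqv : G.Adj q v := by grind
  have nab := gab.ne
  have nad := gad.ne
  have nap := gap.ne
  have nbc := gbc.ne
  have nbd := gbd.ne
  have ncd := gcd.ne
  have ncq := gcq.ne
  have npq := gpq.ne
  have npu := gpu.ne
  have nqv := gqv.ne
  have aW := (hC.adj_mem gab).1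
  have bW := (hC.adj_mem gab).2
  have cW := (hC.adj_mem gcd).1
  have dW := (hC.adj_mem gcd).2
  have pW := (hC.adj_mem gpq).1
  have qW := (hC.adj_mem gpq).2
  have hR2 : Rl W H (k+2) := by
    refine (hR.mono_W sdiff_subset).mono_k ?_
    have : W \ (W \ {p,q}) ⊆ {p,q} := by intro x; simp only [mem_sdiff, mem_insert, mem_singleton]; tauto
    have := card_le_card this
    have := card_le_two (a := p) (b := q)
    omega
  have hH : ∀ x y, H.Adj x y → (G.Adj x y ∧ x ≠ p ∧ y ≠ p ∧ x ≠ q ∧ y ≠ q) ∨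
      (x = a ∧ y = u) ∨ (x = u ∧ y = a) ∨ (x = c ∧ y = v) ∨ (x = v ∧ y = c) := fun x y hxy => (hadj x y).1 (hle hxy)
  have ip : iso H p := by intro x hx; have := hH _ _ hx; grind
  have iq : iso H q := by intro x hx; have := hH _ _ hx; grind
  have hHG : ∀ x y, H.Adj x y → s(x,y) ≠ s(a,u) → s(x,y) ≠ s(c,v) → G.Adj x y := by
    intro x y hxy h1 h2
    rw [ne_eq, Sym2.eq_iff] at h1 h2
    have := hH _ _ hxy; grind
  have sAB : s(c,v) ≠ s(a,u) := by rw [ne_eq, Sym2.eq_iff]; grind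
  have hNa : ∀ x, H.Adj a x → x = b ∨ x = d ∨ x = u := by intro x hx; have := hH _ _ hx; have := na x; grind
  have hNb : ∀ x, H.Adj b x → x = a ∨ x = c ∨ x = d := by intro x hx; have := hH _ _ hx; have := nb x; grind
  have hNc : ∀ x, H.Adj c x → x = b ∨ x = d ∨ x = v := by intro x hx; have := hH _ _ hx; have := nc x; grind
  have hNd : ∀ x, H.Adj d x → x = a ∨ x = c ∨ x = b := by intro x hx; have := hH _ _ hx; have := nd x; grind
  have hA := hR.d2.two' hNa nbd ub.symm ud.symm
  have hB := hR.d2.two' hNb ac nad ncd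
  have hCc := hR.d2.two' hNc nbd vb.symm vd.symm
  have hD := hR.d2.two' hNd ac nab.symm.symm nbc.symm
  rw [SimpleGraph.adj_comm H b a] at hB
  rw [SimpleGraph.adj_comm H c b] at hCc
  rw [SimpleGraph.adj_comm H d a, SimpleGraph.adj_comm H d c, SimpleGraph.adj_comm H d b] at hD
  have hP := par4 _ _ _ _ _ _ _ hA hB hCc hD
  clear hA hB hCc hD
  have swne : ∀ {x y u v : V}, H.Adj x y → ¬ H.Adj u v → s(x,y) ≠ s(u,v) := by
    intro x y u v h1 h2 h3
    rw [adj_sym2 h3] at h1; exact h2 h1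
  have gpa := gap.symm
  have gqp := gpq.symm
  have gda := gad.symm
  have gdb := gbd.symm
  have gdc := gcd.symm
  have gcb := gbc.symm
  have gqc := gcq.symm
  have gba := gab.symm
  rcases hP with ⟨h1, h2⟩ | ⟨h1, h2, hh⟩
  · refine ins2G (u := a) (v := u) (u' := c) (v' := v) [p] [q] hR2 h1 h2 sAB ?_ ?_ ?_ ?_ ?_ ?_
    · simp [ip, pW]
    · simp [iq, qW]
    · simp [npq]
    · simp [gap, gpu]
    · simp [gcq, gqv]
    · intro x y hxy k1 k2; exact hHG x y hxy k1 k2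
  have hHG' : ∀ x y, H.Adj x y → G.Adj x y := fun x y hxy => hHG x y hxy (swne hxy h1) (swne hxy h2)
  rcases hh with ⟨k1, k2, k3, k4, k5⟩ | ⟨k1, k2, k3, k4, k5⟩ | ⟨k1, k2, k3, k4, k5⟩ | ⟨k1, k2, k3, k4, k5⟩
  · have ia : iso H a := by intro x hx; rcases hNa x hx with rfl | rfl | rfl <;> contradiction
    have ib : iso H b := by
      intro x hx; rcases hNb x hx with rfl | rfl | rfl
      · exact k1 hx.symm
      · exact k3 hx
      · exact k4 hx
    have ic : iso H c := by
      intro x hx; rcases hNc x hx with rfl | rfl | rfl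
      · exact k3 hx.symm
      · exact k5 hx
      · exact h2 hx
    have id : iso H d := by
      intro x hx; rcases hNd x hx with rfl | rfl | rfl
      · exact k2 hx.symm
      · exact k5 hx.symm
      · exact k4 hx.symm
    refine cycG (a := p) (b := a) (c := b) (l := [d, c, q]) hR2 (by simp) ?_ ?_ ?_ hHG'
    · simp [ia, ib, ic, id, ip, iq, aW, bW, cW, dW, pW, qW]
    · simp [nab, ac, nad, nbc, nbd, ncd.symm, nap.symm, pb, pd, cp.symm, npq, aq, qb.symm, qd.symm, ncq]
    · simp [gpa, gab, gbd, gdc, gcq, gqp]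
  · have R1 := hR2.renameBy (Equiv.swap c d) (swap_mem cW dW)
    have sc : Equiv.swap c d c = d := Equiv.swap_apply_left c d
    have sd : Equiv.swap c d d = c := Equiv.swap_apply_right c d
    have so : ∀ x, x ≠ c → x ≠ d → Equiv.swap c d x = x := fun x h1 h2 => Equiv.swap_apply_of_ne_of_ne h1 h2
    have sp := so p cp.symm pd
    have sq := so q ncq.symm qd
    have hNc' : ∀ x, H.Adj c x → x = b ∨ x = d := by
      intro x hx; rcases hNc x hx with rfl | rfl | rfl
      · simp
      · simp
      · exact absurd hx h2
    have hNd' : ∀ x, H.Adj d x → x = a ∨ x = c := by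
      intro x hx; rcases hNd x hx with rfl | rfl | rfl
      · simp
      · simp
      · exact absurd hx.symm k5
    refine insG (H := H.comap (Equiv.swap c d)) (u := c) (v := a) [q, p] R1 ?_ ?_ ?_ ?_ ?_
    · rw [SimpleGraph.comap_adj, sc, so a ac nad]; exact k2.symm
    · have i1 : iso (H.comap (Equiv.swap c d)) p := by
        intro x hx; rw [SimpleGraph.comap_adj, sp] at hx; exact ip _ hx
      have i2 : iso (H.comap (Equiv.swap c d)) q := by
        intro x hx; rw [SimpleGraph.comap_adj, sq] at hx; exact iq _ hx
      simp [i1, i2, pW, qW]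
    · simp [npq.symm]
    · simp [gcq, gqp, gpa]
    · have main : ∀ x y, x = c ∨ x = d → (H.comap (Equiv.swap c d)).Adj x y → s(x,y) ≠ s(c,a) → G.Adj x y := by
        intro x y hx hxy hne
        rw [SimpleGraph.comap_adj] at hxy
        rcases hx with rfl | rfl
        · rw [sc] at hxy
          rcases hNd' _ hxy with hh | hh
          · have : y = a := by
              have := congrArg (Equiv.swap x d) hh
              rw [Equiv.swap_apply_self, so a ac nad] at this; exact this
            subst this; exact absurd rfl hne
          · have : y = d := by
              have := congrArg (Equiv.swap x d) hh
              rw [Equiv.swap_apply_self, sc] at this; exact this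
            subst this; exact gcd
        · rw [sd] at hxy
          rcases hNc' _ hxy with hh | hh
          · have : y = b := by
              have := congrArg (Equiv.swap c x) hh
              rw [Equiv.swap_apply_self, so b nbc nbd] at this; exact this
            subst this; exact gdb
          · have : y = c := by
              have := congrArg (Equiv.swap c x) hh
              rw [Equiv.swap_apply_self, sd] at this; exact this
            subst this; exact gdc
      intro x y hxy hne
      by_cases hx : x = c ∨ x = d
      · exact main x y hx hxy hne
      by_cases hy : y = c ∨ y = d
      · exact (main y x hy hxy.symm (by rw [Sym2.eq_swap]; exact hne)).symm
      rw [SimpleGraph.comap_adj, so x (fun h => hx (Or.inl h)) (fun h => hx (Or.inr h)),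
        so y (fun h => hy (Or.inl h)) (fun h => hy (Or.inr h))] at hxy
      exact hHG' _ _ hxy
  · have ic : iso H c := by
      intro x hx; rcases hNc x hx with rfl | rfl | rfl
      · exact k4 hx.symm
      · exact k5 hx
      · exact h2 hx
    refine insG (H := H) (u := d) (v := a) [c, q, p] (hR2.mono_k (by simp)) k2.symm ?_ ?_ ?_ (fun x y hxy _ => hHG' x y hxy)
    · simp [ic, ip, iq, cW, pW, qW]
    · simp [npq.symm, ncq, cp]
    · simp [gdc, gcq, gqp, gpa]
  · have ia : iso H a := by intro x hx; rcases hNa x hx with rfl | rfl | rfl <;> contradiction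
    refine insG (H := H) (u := b) (v := c) [a, p, q] (hR2.mono_k (by simp)) k1 ?_ ?_ ?_ (fun x y hxy _ => hHG' x y hxy)
    · simp [ia, ip, iq, aW, pW, qW]
    · simp [npq, nap, aq]
    · simp [gba, gap, gpq, gqc]

lemma red6 {G : SimpleGraph V} {W : Finset V} (hC : Cub G W) {a b c d p q u v : V}
    (h : D6 G a b c d p q u v) :
    ∃ (G' : SimpleGraph V) (W' : Finset V), Cub G' W' ∧ W'.card < W.card ∧ W'.Nonempty ∧ ∀ k, Good G' W' k → Good G W k := by
  have gab : G.Adj a b := by rw [h.na]; simp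
  have gap : G.Adj a p := by rw [h.na]; simp
  have gpq : G.Adj p q := by rw [h.np]; simp
  refine ⟨_, _, g6_cub hC h, ?_, ⟨a, ?_⟩, fun k => g6_ext hC h k⟩
  · apply card_lt_card
    refine ⟨sdiff_subset, fun hh => ?_⟩
    have := hh (hC.supp _ _ gpq)
    simp at this
  · simp [hC.supp _ _ gab, h.aq, gap.ne]

end R6

set_option linter.unusedSectionVars false
set_option linter.unusedVariables false
set_option linter.unusedSimpArgs false

section R5
variable {V : Type*} [Fintype V] [DecidableEq V]
open Finset

lemma dc_compl {G : SimpleGraph V} {W X : Finset V} (hs : ∀ u v, G.Adj u v → u ∈ W) (hX : X ⊆ W) :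
    dc G (W \ X) = dc G X := by
  unfold dc
  congr 1
  apply filter_congr
  intro e he
  induction e with | h x y =>
  rw [mem_eF] at he
  have hx := hs _ _ he
  have hy := hs _ _ he.symm
  rw [crs_mk, crs_mk]
  simp only [mem_sdiff]
  tauto

structure Q5 (G : SimpleGraph V) (v0 v1 v2 v3 v4 w0 w1 w2 w3 w4 : V) : Prop where
  n0 : ∀ x, G.Adj v0 x ↔ x = v4 ∨ x = v1 ∨ x = w0
  n1 : ∀ x, G.Adj v1 x ↔ x = v0 ∨ x = v2 ∨ x = w1
  n2 : ∀ x, G.Adj v2 x ↔ x = v1 ∨ x = v3 ∨ x = w2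
  n3 : ∀ x, G.Adj v3 x ↔ x = v2 ∨ x = v4 ∨ x = w3
  n4 : ∀ x, G.Adj v4 x ↔ x = v3 ∨ x = v0 ∨ x = w4
  nd : [v0,v1,v2,v3,v4,w0,w1,w2,w3,w4].Nodup

lemma Q5.rot {G : SimpleGraph V} {v0 v1 v2 v3 v4 w0 w1 w2 w3 w4 : V} (h : Q5 G v0 v1 v2 v3 v4 w0 w1 w2 w3 w4) :
    Q5 G v1 v2 v3 v4 v0 w1 w2 w3 w4 w0 := by
  obtain ⟨n0, n1, n2, n3, n4, nd⟩ := h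
  refine ⟨n1, n2, n3, n4, n0, ?_⟩
  simp only [List.nodup_cons, List.mem_cons, List.not_mem_nil, or_false, not_or, List.nodup_nil, and_true, not_false_eq_true] at nd ⊢
  grind

def g5 (G : SimpleGraph V) (v0 v1 v2 v3 v4 w0 w1 w2 w4 : V) : SimpleGraph V :=
  edit G {e | v0 ∈ e ∨ v1 ∈ e ∨ v2 ∈ e ∨ v4 ∈ e} {s(w2,v3), s(w4,v3), s(w0,w1)}

lemma g5_adj {G : SimpleGraph V} {v0 v1 v2 v3 v4 w0 w1 w2 w3 w4 : V} (h : Q5 G v0 v1 v2 v3 v4 w0 w1 w2 w3 w4) (x y : V) :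
    (g5 G v0 v1 v2 v3 v4 w0 w1 w2 w4).Adj x y ↔
      (G.Adj x y ∧ x ≠ v0 ∧ x ≠ v1 ∧ x ≠ v2 ∧ x ≠ v4 ∧ y ≠ v0 ∧ y ≠ v1 ∧ y ≠ v2 ∧ y ≠ v4) ∨
      (x = w2 ∧ y = v3) ∨ (x = v3 ∧ y = w2) ∨ (x = w4 ∧ y = v3) ∨ (x = v3 ∧ y = w4) ∨
      (x = w0 ∧ y = w1) ∨ (x = w1 ∧ y = w0) := by
  have nd := h.nd
  simp only [List.nodup_cons, List.mem_cons, List.not_mem_nil, or_false, not_or, List.nodup_nil, and_true, not_false_eq_true] at nd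
  have h1 : w2 ≠ v3 := by grind
  have h2 : w4 ≠ v3 := by grind
  have h3 : w0 ≠ w1 := by grind
  clear nd
  unfold g5
  rw [edit_adj]
  simp only [Set.mem_ofPred_eq, Set.mem_insert_iff, Set.mem_singleton_iff, Sym2.eq_iff, Sym2.mem_iff]
  grind

lemma inj5 {E : Type*} [DecidableEq E] {D D' S : Finset E} {A0 A1 A2 A4 B2 B4 B : E} {p0 p1 p2 p4 : Prop}
    (hcr : ∀ e ∈ D, (e ∈ D' ∧ e ≠ B2 ∧ e ≠ B4 ∧ e ≠ B) ∨ (e = A0 ∧ p0) ∨ (e = A1 ∧ p1) ∨ (e = A2 ∧ p2) ∨ (e = A4 ∧ p4))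
    (a2 : p2 → B2 ∈ D') (a4 : p4 → B4 ∈ D') (a01 : p0 → ¬ p1 → B ∈ D') (a10 : p1 → ¬ p0 → B ∈ D')
    (e1 : B2 ≠ B4) (e2 : B2 ≠ B) (e3 : B4 ≠ B) (hS : S ⊆ D) (hS0 : A0 ∈ S → ¬ p1) (hS1 : A1 ∈ S → ¬ p0) :
    S.card ≤ D'.card := by
  have key : ∀ e ∈ S, ∃ f, f ∈ D' ∧ ((f = e ∧ f ≠ B2 ∧ f ≠ B4 ∧ f ≠ B) ∨ (e = A0 ∧ p0 ∧ f = B) ∨ (e = A1 ∧ p1 ∧ f = B) ∨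
      (e = A2 ∧ f = B2) ∨ (e = A4 ∧ f = B4)) := by
    intro e he
    rcases hcr e (hS he) with ⟨h, h1, h2, h3⟩ | ⟨rfl, h⟩ | ⟨rfl, h⟩ | ⟨rfl, h⟩ | ⟨rfl, h⟩
    · exact ⟨e, h, Or.inl ⟨rfl, h1, h2, h3⟩⟩
    · exact ⟨B, a01 h (hS0 he), Or.inr (Or.inl ⟨rfl, h, rfl⟩)⟩
    · exact ⟨B, a10 h (hS1 he), Or.inr (Or.inr (Or.inl ⟨rfl, h, rfl⟩))⟩
    · exact ⟨B2, a2 h, Or.inr (Or.inr (Or.inr (Or.inl ⟨rfl, rfl⟩)))⟩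
    · exact ⟨B4, a4 h, Or.inr (Or.inr (Or.inr (Or.inr ⟨rfl, rfl⟩)))⟩
  choose! f hf using key
  refine card_le_card_of_injOn f (fun e he => (hf e he).1) ?_
  intro e he e' he' hee
  have h1 := (hf e he).2
  have h2 := (hf e' he').2
  rw [← hee] at h2
  have he := mem_coe.1 he
  have he' := mem_coe.1 he'
  clear hcr hf a2 a4 a01 a10
  rcases h1 with ⟨h, h3, h4, h5⟩ | ⟨h, h3, h4⟩ | ⟨h, h3, h4⟩ | ⟨h, h3⟩ | ⟨h, h3⟩ <;>
  rcases h2 with ⟨k, k3, k4, k5⟩ | ⟨k, k3, k4⟩ | ⟨k, k3, k4⟩ | ⟨k, k3⟩ | ⟨k, k3⟩ <;>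
  simp_all

lemma g5_tec {G : SimpleGraph V} {W : Finset V} (hC : Cub G W) {v0 v1 v2 v3 v4 w0 w1 w2 w3 w4 : V}
    (h : Q5 G v0 v1 v2 v3 v4 w0 w1 w2 w3 w4) (hna : ¬ G.Adj w0 w1) (m : V → V)
    (hcut : ∀ X ⊆ W, dc G X = 3 → (X.filter (fun u => m u ∉ X)).card ≤ 1)
    (m0 : m w0 = v0) (m1 : m w1 = v1) (m2 : m v2 = w2) (m3 : m v3 = w3) (m4 : m v4 = w4)
    (X : Finset V) (hX : X ⊆ W) (hne : X.Nonempty)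
    (h0 : v0 ∉ X) (h1 : v1 ∉ X) (h2 : v2 ∉ X) (h3 : v3 ∉ X) (h4 : v4 ∉ X) :
    2 ≤ dc (g5 G v0 v1 v2 v3 v4 w0 w1 w2 w4) X := by
  have hadj := g5_adj h
  obtain ⟨n0, n1, n2, n3, n4, nd⟩ := h
  simp only [List.nodup_cons, List.mem_cons, List.not_mem_nil, or_false, not_or, List.nodup_nil, and_true, not_false_eq_true] at nd
  have g0 : G.Adj v0 w0 := by rw [n0]; simp
  have g1 : G.Adj v1 w1 := by rw [n1]; simp
  have g2 : G.Adj v2 w2 := by rw [n2]; simp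
  have g3 : G.Adj v3 w3 := by rw [n3]; simp
  have g4 : G.Adj v4 w4 := by rw [n4]; simp
  have hd2 := hC.tec X hX hne (by rintro rfl; exact h0 (hC.supp _ _ g0))
  -- edges of G crossing X: y ∈ X, x ∉ X
  have hcr : ∀ e ∈ (eF G).filter (crs X), (e ∈ (eF (g5 G v0 v1 v2 v3 v4 w0 w1 w2 w4)).filter (crs X) ∧ e ≠ s(w2,v3) ∧ e ≠ s(w4,v3) ∧ e ≠ s(w0,w1)) ∨
      (e = s(w0,v0) ∧ w0 ∈ X) ∨ (e = s(w1,v1) ∧ w1 ∈ X) ∨ (e = s(w2,v2) ∧ w2 ∈ X) ∨ (e = s(w4,v4) ∧ w4 ∈ X) := by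
    intro e he
    rw [mem_filter] at he
    obtain ⟨he, y, hy, x, hx, rfl⟩ := he
    rw [mem_eF] at he
    have y0 : y ≠ v0 := by rintro rfl; exact h0 hy
    have y1 : y ≠ v1 := by rintro rfl; exact h1 hy
    have y2 : y ≠ v2 := by rintro rfl; exact h2 hy
    have y3 : y ≠ v3 := by rintro rfl; exact h3 hy
    have y4 : y ≠ v4 := by rintro rfl; exact h4 hy
    by_cases x0 : x = v0
    · subst x0
      have : y = w0 := by have := (n0 y).1 he.symm; tauto
      subst this; exact Or.inr (Or.inl ⟨rfl, hy⟩)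
    by_cases x1 : x = v1
    · subst x1
      have : y = w1 := by have := (n1 y).1 he.symm; tauto
      subst this; exact Or.inr (Or.inr (Or.inl ⟨rfl, hy⟩))
    by_cases x2 : x = v2
    · subst x2
      have : y = w2 := by have := (n2 y).1 he.symm; tauto
      subst this; exact Or.inr (Or.inr (Or.inr (Or.inl ⟨rfl, hy⟩)))
    by_cases x4 : x = v4
    · subst x4
      have : y = w4 := by have := (n4 y).1 he.symm; tauto
      subst this; exact Or.inr (Or.inr (Or.inr (Or.inr ⟨rfl, hy⟩)))
    left
    rw [mem_filter, mem_eF, hadj]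
    refine ⟨⟨Or.inl ⟨he, y0, y1, y2, y4, x0, x1, x2, x4⟩, y, hy, x, hx, rfl⟩, ?_, ?_, ?_⟩
    · intro hh; rw [← SimpleGraph.mem_edgeSet, hh, SimpleGraph.mem_edgeSet, SimpleGraph.adj_comm, n3] at he; grind
    · intro hh; rw [← SimpleGraph.mem_edgeSet, hh, SimpleGraph.mem_edgeSet, SimpleGraph.adj_comm, n3] at he; grind
    · intro hh; rw [← SimpleGraph.mem_edgeSet, hh, SimpleGraph.mem_edgeSet] at he; exact hna he
  have a2 : w2 ∈ X → s(w2,v3) ∈ (eF (g5 G v0 v1 v2 v3 v4 w0 w1 w2 w4)).filter (crs X) := by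
    intro hw; rw [mem_filter, mem_eF, hadj]; exact ⟨Or.inr (Or.inl ⟨rfl, rfl⟩), w2, hw, v3, h3, rfl⟩
  have a4 : w4 ∈ X → s(w4,v3) ∈ (eF (g5 G v0 v1 v2 v3 v4 w0 w1 w2 w4)).filter (crs X) := by
    intro hw; rw [mem_filter, mem_eF, hadj]; exact ⟨Or.inr (Or.inr (Or.inr (Or.inl ⟨rfl, rfl⟩))), w4, hw, v3, h3, rfl⟩
  have a01 : w0 ∈ X → w1 ∉ X → s(w0,w1) ∈ (eF (g5 G v0 v1 v2 v3 v4 w0 w1 w2 w4)).filter (crs X) := by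
    intro hw hw'; rw [mem_filter, mem_eF, hadj]; exact ⟨Or.inr (Or.inr (Or.inr (Or.inr (Or.inr (Or.inl ⟨rfl, rfl⟩))))), w0, hw, w1, hw', rfl⟩
  have a10 : w1 ∈ X → w0 ∉ X → s(w0,w1) ∈ (eF (g5 G v0 v1 v2 v3 v4 w0 w1 w2 w4)).filter (crs X) := by
    intro hw hw'; rw [mem_filter, mem_eF, hadj]; exact ⟨Or.inr (Or.inr (Or.inr (Or.inr (Or.inr (Or.inl ⟨rfl, rfl⟩))))), w1, hw, w0, hw', Sym2.eq_swap⟩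
  have e1 : s(w2,v3) ≠ s(w4,v3) := by rw [ne_eq, Sym2.eq_iff]; grind
  have e2 : s(w2,v3) ≠ s(w0,w1) := by rw [ne_eq, Sym2.eq_iff]; grind
  have e3 : s(w4,v3) ≠ s(w0,w1) := by rw [ne_eq, Sym2.eq_iff]; grind
  have f1 : s(w0,v0) ≠ s(w1,v1) := by rw [ne_eq, Sym2.eq_iff]; grind
  have f2 : s(w0,v0) ≠ s(w2,v2) := by rw [ne_eq, Sym2.eq_iff]; grind
  have f3 : s(w0,v0) ≠ s(w4,v4) := by rw [ne_eq, Sym2.eq_iff]; grind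
  have f4 : s(w1,v1) ≠ s(w2,v2) := by rw [ne_eq, Sym2.eq_iff]; grind
  have f5 : s(w1,v1) ≠ s(w4,v4) := by rw [ne_eq, Sym2.eq_iff]; grind
  have f6 : s(w2,v2) ≠ s(w4,v4) := by rw [ne_eq, Sym2.eq_iff]; grind
  have inj : ∀ S : Finset (Sym2 V), S ⊆ (eF G).filter (crs X) → (s(w0,v0) ∈ S → w1 ∉ X) → (s(w1,v1) ∈ S → w0 ∉ X) →
      S.card ≤ dc (g5 G v0 v1 v2 v3 v4 w0 w1 w2 w4) X := by
    intro S hS hS0 hS1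
    exact inj5 hcr a2 a4 a01 a10 e1 e2 e3 hS hS0 hS1
  by_cases hw : w0 ∈ X ∧ w1 ∈ X
  · obtain ⟨hw0, hw1⟩ := hw
    have c0 : s(w0,v0) ∈ (eF G).filter (crs X) := by
      rw [mem_filter, mem_eF]; exact ⟨g0.symm, w0, hw0, v0, h0, rfl⟩
    have c1 : s(w1,v1) ∈ (eF G).filter (crs X) := by
      rw [mem_filter, mem_eF]; exact ⟨g1.symm, w1, hw1, v1, h1, rfl⟩
    have hi := inj (((eF G).filter (crs X)).erase s(w0,v0) |>.erase s(w1,v1))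
      ((erase_subset _ _).trans (erase_subset _ _)) (by intro hh; simp at hh) (by intro hh; simp at hh)
    rw [card_erase_of_mem (by rw [mem_erase]; exact ⟨f1.symm, c1⟩), card_erase_of_mem c0] at hi
    have hdd : dc G X = ((eF G).filter (crs X)).card := rfl
    have hn3 : dc G X ≠ 3 := by
      intro h3
      have := hcut X hX h3
      have h2 : ({w0, w1} : Finset V) ⊆ X.filter (fun u => m u ∉ X) := by
        intro x; simp only [mem_insert, mem_singleton, mem_filter]
        rintro (rfl | rfl)
        · rw [m0]; exact ⟨hw0, h0⟩
        · rw [m1]; exact ⟨hw1, h1⟩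
      have h2 := card_le_card h2
      rw [card_pair (by grind)] at h2
      omega
    have hn2 : dc G X ≠ 2 := by
      intro hX2
      have hsub : ({s(w0,v0), s(w1,v1)} : Finset (Sym2 V)) ⊆ (eF G).filter (crs X) := by
        intro e; simp only [mem_insert, mem_singleton]; rintro (rfl | rfl)
        · exact c0
        · exact c1
      have heq := eq_of_subset_of_card_le hsub (by rw [card_pair f1]; omega)
      have hk : ∀ y x, G.Adj y x → y ∈ X → x ∉ X → s(y,x) = s(w0,v0) ∨ s(y,x) = s(w1,v1) := by
        intro y x hyx hy hx
        have : s(y,x) ∈ (eF G).filter (crs X) := by rw [mem_filter, mem_eF]; exact ⟨hyx, y, hy, x, hx, rfl⟩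
        rw [← heq] at this
        simpa only [mem_insert, mem_singleton] using this
      have hw2 : w2 ∉ X := by intro hh; have := hk _ _ g2.symm hh h2; grind
      have hw3 : w3 ∉ X := by intro hh; have := hk _ _ g3.symm hh h3; rw [Sym2.eq_iff, Sym2.eq_iff] at this; grind
      have hw4 : w4 ∉ X := by intro hh; have := hk _ _ g4.symm hh h4; grind
      let Y := X ∪ {v0, v1, v2, v3, v4}
      have hY : ∀ x, x ∈ Y ↔ x ∈ X ∨ x = v0 ∨ x = v1 ∨ x = v2 ∨ x = v3 ∨ x = v4 := by
        intro x; simp only [Y, mem_union, mem_insert, mem_singleton]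
      have hYW : Y ⊆ W := by
        intro x hx; rw [hY] at hx
        rcases hx with hx | rfl | rfl | rfl | rfl | rfl
        · exact hX hx
        · exact hC.supp _ _ g0
        · exact hC.supp _ _ g1
        · exact hC.supp _ _ g2
        · exact hC.supp _ _ g3
        · exact hC.supp _ _ g4
      have w2Y : w2 ∉ Y := by rw [hY]; grind
      have w3Y : w3 ∉ Y := by rw [hY]; grind
      have w4Y : w4 ∉ Y := by rw [hY]; grind
      have hYd : (eF G).filter (crs Y) ⊆ {s(v2,w2), s(v3,w3), s(v4,w4)} := by
        intro e he
        rw [mem_filter] at he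
        obtain ⟨he, y, hy, x, hx, rfl⟩ := he
        rw [mem_eF] at he
        rw [hY] at hy hx
        simp only [not_or] at hx
        simp only [mem_insert, mem_singleton]
        rcases hy with hy | rfl | rfl | rfl | rfl | rfl
        · have := hk y x he hy hx.1
          rw [Sym2.eq_iff, Sym2.eq_iff] at this
          grind
        · have := (n0 x).1 he; grind
        · have := (n1 x).1 he; grind
        · have := (n2 x).1 he; grind
        · have := (n3 x).1 he; grind
        · have := (n4 x).1 he; grind
      have hYc : dc G Y ≤ 3 := (card_le_card hYd).trans card_le_three
      have hY2 := hC.tec Y hYW ⟨v0, by rw [hY]; simp⟩ (by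
        intro e; exact w2Y (e ▸ hC.supp _ _ g2.symm))
      have p1 := hC.dc_parity hX
      have p2 := hC.dc_parity hYW
      have hcY : Y.card = X.card + 5 := by
        have h5 : ({v0, v1, v2, v3, v4} : Finset V).card = 5 := by
          rw [show ({v0, v1, v2, v3, v4} : Finset V) = [v0,v1,v2,v3,v4].toFinset by ext; simp]
          rw [List.toFinset_card_of_nodup]
          · rfl
          · simp only [List.nodup_cons, List.mem_cons, List.not_mem_nil, or_false, not_or, List.nodup_nil, and_true, not_false_eq_true]
            grind
        rw [← h5]
        apply card_union_of_disjoint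
        rw [Finset.disjoint_left]
        intro x hx; simp only [mem_insert, mem_singleton]
        grind
      have hY3 := hcut Y hYW (by omega)
      have h2 : ({v2, v3} : Finset V) ⊆ Y.filter (fun u => m u ∉ Y) := by
        intro x; simp only [mem_insert, mem_singleton, mem_filter]
        rintro (rfl | rfl)
        · rw [m2]; exact ⟨by rw [hY]; simp, w2Y⟩
        · rw [m3]; exact ⟨by rw [hY]; simp, w3Y⟩
      have h2 := card_le_card h2
      rw [card_pair (by grind)] at h2
      omega
    omega
  · have := inj _ (Subset.refl _) (by
      intro hh hh'
      rw [mem_filter] at hh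
      have := hh.2
      rw [crs_mk] at this
      grind) (by
      intro hh hh'
      rw [mem_filter] at hh
      have := hh.2
      rw [crs_mk] at this
      grind)
    exact hd2.trans this

end R5

set_option linter.unusedSectionVars false
set_option linter.unusedVariables false
set_option linter.unusedSimpArgs false

section R5b
variable {V : Type*} [Fintype V] [DecidableEq V]
open Finset

lemma g5_cub {G : SimpleGraph V} {W : Finset V} (hC : Cub G W) {v0 v1 v2 v3 v4 w0 w1 w2 w3 w4 : V}
    (h : Q5 G v0 v1 v2 v3 v4 w0 w1 w2 w3 w4) (hna : ¬ G.Adj w0 w1) (m : V → V)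
    (hcut : ∀ X ⊆ W, dc G X = 3 → (X.filter (fun u => m u ∉ X)).card ≤ 1)
    (m0 : m w0 = v0) (m1 : m w1 = v1) (m2 : m v2 = w2) (m3 : m v3 = w3) (m4 : m v4 = w4) :
    Cub (g5 G v0 v1 v2 v3 v4 w0 w1 w2 w4) (W \ {v0, v1, v2, v4}) := by
  have htec := g5_tec hC h hna m hcut m0 m1 m2 m3 m4
  have hadj := g5_adj h
  obtain ⟨n0, n1, n2, n3, n4, nd⟩ := h
  simp only [List.nodup_cons, List.mem_cons, List.not_mem_nil, or_false, not_or, List.nodup_nil, and_true, not_false_eq_true] at nd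
  have g0 : G.Adj v0 w0 := by rw [n0]; simp
  have g1 : G.Adj v1 w1 := by rw [n1]; simp
  have g2 : G.Adj v2 w2 := by rw [n2]; simp
  have g3 : G.Adj v3 w3 := by rw [n3]; simp
  have g4 : G.Adj v4 w4 := by rw [n4]; simp
  have hsupp : ∀ u v, (g5 G v0 v1 v2 v3 v4 w0 w1 w2 w4).Adj u v → u ∈ W \ {v0, v1, v2, v4} := by
    intro u v huv
    rw [hadj] at huv
    simp only [mem_sdiff, mem_insert, mem_singleton, not_or]
    have k0 := hC.supp _ _ g0.symm
    have k1 := hC.supp _ _ g1.symm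
    have k2 := hC.supp _ _ g2.symm
    have k3 := hC.supp _ _ g3
    have k4 := hC.supp _ _ g4.symm
    have k5 := hC.supp u v
    clear hcut htec
    grind
  refine ⟨hsupp, ?_, ?_⟩
  · intro x hx
    simp only [mem_sdiff, mem_insert, mem_singleton, not_or] at hx
    obtain ⟨hxW, hx0, hx1, hx2, hx4⟩ := hx
    clear hcut htec hsupp
    by_cases x3 : x = v3
    · subst x3
      refine ⟨w2, w3, w4, by grind, by grind, by grind, fun y => ?_⟩
      rw [hadj]; have := n3 y; grind
    obtain ⟨p, q, r, e1, e2, e3, hn⟩ := hC.deg x hxW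
    let f : V → V := fun y => if y = v2 then v3 else if y = v4 then v3 else if y = v0 then w1 else if y = v1 then w0 else y
    have hx0' : G.Adj x v0 ↔ x = w0 := by rw [SimpleGraph.adj_comm, n0]; grind
    have hx1' : G.Adj x v1 ↔ x = w1 := by rw [SimpleGraph.adj_comm, n1]; grind
    have hx2' : G.Adj x v2 ↔ x = w2 := by rw [SimpleGraph.adj_comm, n2]; grind
    have hx3' : G.Adj x v3 ↔ x = w3 := by rw [SimpleGraph.adj_comm, n3]; grind
    have hx4' : G.Adj x v4 ↔ x = w4 := by rw [SimpleGraph.adj_comm, n4]; grind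
    have hna' : ¬ G.Adj w1 w0 := fun h => hna h.symm
    have hinj : ∀ y z, G.Adj x y → G.Adj x z → y ≠ z → f y ≠ f z := by
      intro y z hy hz hne
      simp only [f]
      clear hn hadj n0 n1 n2 n3 n4
      grind
    refine ⟨f p, f q, f r, hinj _ _ ((hn _).2 (by grind)) ((hn _).2 (by grind)) e1,
      hinj _ _ ((hn _).2 (by grind)) ((hn _).2 (by grind)) e2, hinj _ _ ((hn _).2 (by grind)) ((hn _).2 (by grind)) e3, ?_⟩
    have h1 : ∀ y, (g5 G v0 v1 v2 v3 v4 w0 w1 w2 w4).Adj x y ↔ ∃ z, G.Adj x z ∧ y = f z := by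
      intro y
      rw [hadj]
      constructor
      · rintro (⟨h, h1, h2, h3, h4, h5, h6, h7, h8⟩ | ⟨rfl, rfl⟩ | ⟨rfl, rfl⟩ | ⟨rfl, rfl⟩ | ⟨rfl, rfl⟩ | ⟨rfl, rfl⟩ | ⟨rfl, rfl⟩)
        · exact ⟨y, h, by simp [f, h5, h6, h7, h8]⟩
        · exact ⟨v2, g2.symm, by simp only [f]; grind⟩
        · grind
        · exact ⟨v4, g4.symm, by simp only [f]; grind⟩
        · grind
        · exact ⟨v0, g0.symm, by simp only [f]; grind⟩
        · exact ⟨v1, g1.symm, by simp only [f]; grind⟩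
      · rintro ⟨z, hz, rfl⟩
        simp only [f]
        clear hn hadj n0 n1 n2 n3 n4 hinj
        grind
    intro y
    rw [h1]
    constructor
    · rintro ⟨z, hz, rfl⟩
      rcases (hn z).1 hz with rfl | rfl | rfl <;> simp
    · intro hy
      rcases hy with rfl | rfl | rfl
      · exact ⟨p, (hn _).2 (by grind), rfl⟩
      · exact ⟨q, (hn _).2 (by grind), rfl⟩
      · exact ⟨r, (hn _).2 (by grind), rfl⟩
  · have k3 : v3 ∈ W := hC.supp _ _ g3
    intro X hX hne hXW
    have hX' : ∀ x ∈ X, x ∈ W ∧ x ≠ v0 ∧ x ≠ v1 ∧ x ≠ v2 ∧ x ≠ v4 := by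
      intro x hx; have := hX hx; simpa [mem_sdiff, not_or] using this
    by_cases h3 : v3 ∈ X
    · rw [← dc_compl hsupp hX]
      have hm : ∀ x, x ∈ (W \ {v0, v1, v2, v4}) \ X ↔ (x ∈ W ∧ x ≠ v0 ∧ x ≠ v1 ∧ x ≠ v2 ∧ x ≠ v4) ∧ x ∉ X := by
        intro x; simp [mem_sdiff, not_or]
      apply htec
      · exact sdiff_subset.trans sdiff_subset
      · rw [sdiff_nonempty]; intro hs; exact hXW (Subset.antisymm hX hs)
      all_goals rw [hm]; tauto
    · exact htec X (hX.trans sdiff_subset) hne (fun h => (hX' _ h).2.1 rfl) (fun h => (hX' _ h).2.2.1 rfl)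
        (fun h => (hX' _ h).2.2.2.1 rfl) h3 (fun h => (hX' _ h).2.2.2.2 rfl)

lemma g5_ext {G : SimpleGraph V} {W : Finset V} (hC : Cub G W) {v0 v1 v2 v3 v4 w0 w1 w2 w3 w4 : V}
    (h : Q5 G v0 v1 v2 v3 v4 w0 w1 w2 w3 w4) (hna : ¬ G.Adj w0 w1) (k : ℕ)
    (hg : Good (g5 G v0 v1 v2 v3 v4 w0 w1 w2 w4) (W \ {v0, v1, v2, v4}) k) : Good G W (k+1) := by
  have hadj := g5_adj h
  obtain ⟨H, hle, hR⟩ := hg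
  obtain ⟨n0, n1, n2, n3, n4, nd⟩ := h
  simp only [List.nodup_cons, List.mem_cons, List.not_mem_nil, or_false, not_or, List.nodup_nil, and_true, not_false_eq_true] at nd
  have g0 : G.Adj v0 w0 := by rw [n0]; simp
  have g1 : G.Adj v1 w1 := by rw [n1]; simp
  have g2 : G.Adj v2 w2 := by rw [n2]; simp
  have g3 : G.Adj v3 w3 := by rw [n3]; simp
  have g4 : G.Adj v4 w4 := by rw [n4]; simp
  have g01 : G.Adj v0 v1 := by rw [n0]; simp
  have g12 : G.Adj v1 v2 := by rw [n1]; simp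
  have g23 : G.Adj v2 v3 := by rw [n2]; simp
  have g34 : G.Adj v3 v4 := by rw [n3]; simp
  have g40 : G.Adj v4 v0 := by rw [n4]; simp
  have u0 : v0 ∈ W := hC.supp _ _ g0
  have u1 : v1 ∈ W := hC.supp _ _ g1
  have u2 : v2 ∈ W := hC.supp _ _ g2
  have u3 : v3 ∈ W := hC.supp _ _ g3
  have u4 : v4 ∈ W := hC.supp _ _ g4
  have hR2 : Rl W H (k+4) := by
    refine (hR.mono_W sdiff_subset).mono_k ?_
    have : W \ (W \ {v0,v1,v2,v4}) ⊆ {v0,v1,v2,v4} := by intro x; simp only [mem_sdiff, mem_insert, mem_singleton]; tauto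
    have := card_le_card this
    have := card_le_four (a := v0) (b := v1) (c := v2) (d := v4)
    omega
  have hH : ∀ x y, H.Adj x y → (G.Adj x y ∧ x ≠ v0 ∧ x ≠ v1 ∧ x ≠ v2 ∧ x ≠ v4 ∧ y ≠ v0 ∧ y ≠ v1 ∧ y ≠ v2 ∧ y ≠ v4) ∨
      (x = w2 ∧ y = v3) ∨ (x = v3 ∧ y = w2) ∨ (x = w4 ∧ y = v3) ∨ (x = v3 ∧ y = w4) ∨
      (x = w0 ∧ y = w1) ∨ (x = w1 ∧ y = w0) := fun x y hxy => (hadj x y).1 (hle hxy)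
  clear hadj
  have i0 : iso H v0 := by intro x hx; have := hH _ _ hx; grind
  have i1 : iso H v1 := by intro x hx; have := hH _ _ hx; grind
  have i2 : iso H v2 := by intro x hx; have := hH _ _ hx; grind
  have i4 : iso H v4 := by intro x hx; have := hH _ _ hx; grind
  have hHG : ∀ x y, H.Adj x y → s(x,y) ≠ s(w2,v3) → s(x,y) ≠ s(v3,w4) → s(x,y) ≠ s(w0,w1) → G.Adj x y := by
    intro x y hxy h1 h2 h3
    rw [ne_eq, Sym2.eq_iff] at h1 h2 h3
    have := hH _ _ hxy; grind
  have e1 : s(w2,v3) ≠ s(v3,w4) := by rw [ne_eq, Sym2.eq_iff]; grind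
  have e2 : s(w2,v3) ≠ s(w0,w1) := by rw [ne_eq, Sym2.eq_iff]; grind
  have e3 : s(v3,w4) ≠ s(w0,w1) := by rw [ne_eq, Sym2.eq_iff]; grind
  have hN3 : ∀ x, H.Adj v3 x → x = w2 ∨ x = w3 ∨ x = w4 := by
    intro x hx; have := hH _ _ hx; have := n3 x; grind
  have hZ := hR.d2.two (u := v3) hN3 (by grind) (by grind) (by grind)
  have swne : ∀ {x y u v : V}, H.Adj x y → ¬ H.Adj u v → s(x,y) ≠ s(u,v) := by
    intro x y u v h1 h2 h3
    rw [adj_sym2 h3] at h1; exact h2 h1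
  have swne' : ∀ {x y u v : V}, H.Adj x y → ¬ H.Adj v u → s(x,y) ≠ s(u,v) := by
    intro x y u v h1 h2
    exact swne h1 (fun h => h2 h.symm)
  have nds : [v0, v1, v2, v3, v4].Nodup := by
    simp only [List.nodup_cons, List.mem_cons, List.not_mem_nil, or_false, not_or, List.nodup_nil, and_true, not_false_eq_true]
    grind
  simp only [List.nodup_cons, List.mem_cons, List.not_mem_nil, or_false, not_or, List.nodup_nil, and_true, not_false_eq_true] at nds
  by_cases he : H.Adj w0 w1
  · rcases hZ with hZ | ⟨hA, hB, hC'⟩ | ⟨hA, hB, hC'⟩ | ⟨hA, hB, hC'⟩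
    · refine insG (u := w0) (v := w1) [v0, v4, v3, v2, v1] (hR2.mono_k (by simp)) he ?_ ?_ ?_ ?_
      · simp [i0, i1, i2, i4, hZ, u0, u1, u2, u3, u4]
      · simp only [List.nodup_cons, List.mem_cons, List.not_mem_nil, or_false, not_or, List.nodup_nil, and_true, not_false_eq_true]; grind
      · simp [g0.symm, g40.symm, g34.symm, g23.symm, g12.symm, g1]
      · intro x y hxy hne; exact hHG x y hxy (swne' hxy (hZ _)) (swne hxy (hZ _)) hne
    · refine ins2G (u := w2) (v := v3) (u' := w0) (v' := w1) [v2] [v0, v1] hR2 hA.symm he e2.symm ?_ ?_ ?_ ?_ ?_ ?_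
      · simp [i2, u2]
      · simp [i0, i1, u0, u1]
      · simp; grind
      · simp [g2.symm, g23]
      · simp [g0.symm, g01, g1]
      · intro x y hxy h1 h2; exact hHG x y hxy h1 (swne hxy hC') h2
    · obtain ⟨H1, R1, h2, h3, h4⟩ := Rl.insl (Gc := G.Adj) (k := k+3) (fun x y h => h.symm) [v2] hR2 hA.symm (by simp [i2, u2]) (by simp) (by simp [g2.symm, g23])
      refine ins2G (u := v3) (v := w4) (u' := w0) (v' := w1) [v4] [v0, v1] (R1.mono_k (by simp)) (h2 _ _ hC' e1.symm) (h2 _ _ he e2.symm) e3.symm ?_ ?_ ?_ ?_ ?_ ?_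
      · simp only [List.mem_singleton, forall_eq]; exact ⟨h4 _ (by simp; grind) i4, u4⟩
      · simp only [List.mem_cons, List.not_mem_nil, or_false, forall_eq_or_imp, forall_eq]
        exact ⟨⟨h4 _ (by simp; grind) i0, u0⟩, h4 _ (by simp; grind) i1, u1⟩
      · simp; grind
      · simp [g34, g4]
      · simp [g0.symm, g01, g1]
      · intro x y hxy k1 k2
        rcases h3 x y hxy with hh | hh
        · exact hHG x y hh.1 hh.2 k1 k2
        · exact hh
    · refine ins2G (u := v3) (v := w4) (u' := w0) (v' := w1) [v4] [v0, v1] hR2 hC' he e3.symm ?_ ?_ ?_ ?_ ?_ ?_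
      · simp [i4, u4]
      · simp [i0, i1, u0, u1]
      · simp; grind
      · simp [g34, g4]
      · simp [g0.symm, g01, g1]
      · intro x y hxy h1 h2; exact hHG x y hxy (swne' hxy hA) h1 h2
  · rcases hZ with hZ | ⟨hA, hB, hC'⟩ | ⟨hA, hB, hC'⟩ | ⟨hA, hB, hC'⟩
    · refine cycG (a := v0) (b := v1) (c := v2) (l := [v3, v4]) hR2 (by simp) ?_ ?_ ?_ ?_
      · simp [i0, i1, i2, i4, hZ, u0, u1, u2, u3, u4]
      · simp only [List.nodup_cons, List.mem_cons, List.not_mem_nil, or_false, not_or, List.nodup_nil, and_true, not_false_eq_true]; grind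
      · simp [g01, g12, g23, g34, g40]
      · intro x y hxy; exact hHG x y hxy (swne' hxy (hZ _)) (swne hxy (hZ _)) (swne hxy he)
    · refine insG (u := w2) (v := v3) [v2, v1, v0, v4] (hR2.mono_k (by simp)) hA.symm ?_ ?_ ?_ ?_
      · simp [i0, i1, i2, i4, u0, u1, u2, u3, u4]
      · simp only [List.nodup_cons, List.mem_cons, List.not_mem_nil, or_false, not_or, List.nodup_nil, and_true, not_false_eq_true]; grind
      · simp [g2.symm, g12.symm, g01.symm, g40.symm, g34.symm]
      · intro x y hxy hne; exact hHG x y hxy hne (swne hxy hC') (swne hxy he)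
    · have R1 := hR2.renameBy (Equiv.swap v3 v2) (swap_mem u3 u2)
      have s3 : Equiv.swap v3 v2 v3 = v2 := Equiv.swap_apply_left _ _
      have s2 : Equiv.swap v3 v2 v2 = v3 := Equiv.swap_apply_right _ _
      have so : ∀ x, x ≠ v3 → x ≠ v2 → Equiv.swap v3 v2 x = x := fun x h1 h2 => Equiv.swap_apply_of_ne_of_ne h1 h2
      have sw4 := so w4 (by grind) (by grind)
      refine insG (H := H.comap (Equiv.swap v3 v2)) (u := v2) (v := w4) [v1, v0, v4] R1 ?_ ?_ ?_ ?_ ?_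
      · rw [SimpleGraph.comap_adj, s2, sw4]; exact hC'
      · simp only [List.mem_cons, List.not_mem_nil, or_false, forall_eq_or_imp, forall_eq]
        refine ⟨⟨?_, u1⟩, ⟨?_, u0⟩, ?_, u4⟩
        · intro x hx; rw [SimpleGraph.comap_adj, so v1 (by grind) (by grind)] at hx; exact i1 _ hx
        · intro x hx; rw [SimpleGraph.comap_adj, so v0 (by grind) (by grind)] at hx; exact i0 _ hx
        · intro x hx; rw [SimpleGraph.comap_adj, so v4 (by grind) (by grind)] at hx; exact i4 _ hx
      · simp only [List.nodup_cons, List.mem_cons, List.not_mem_nil, or_false, not_or, List.nodup_nil, and_true, not_false_eq_true]; grind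
      · simp [g12.symm, g01.symm, g40.symm, g4]
      · have key : ∀ y, H.Adj v3 (Equiv.swap v3 v2 y) → y ≠ w4 → y = w2 := by
          intro y hy h1
          have h5 : Equiv.swap v3 v2 y = w2 ∨ Equiv.swap v3 v2 y = w4 := by
            have := hN3 _ hy
            rcases this with h | h | h
            · exact Or.inl h
            · rw [h] at hy; exact absurd hy hB
            · exact Or.inr h
          rcases h5 with h | h
          · have := congrArg (Equiv.swap v3 v2) h
            rw [Equiv.swap_apply_self, so w2 (by grind) (by grind)] at this; exact this
          · have := congrArg (Equiv.swap v3 v2) h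
            rw [Equiv.swap_apply_self, sw4] at this; exact absurd this h1
        intro x y hxy h1
        rw [SimpleGraph.comap_adj] at hxy
        rw [ne_eq, Sym2.eq_iff] at h1
        by_cases x3 : x = v3
        · rw [x3, s3] at hxy; exact absurd hxy (i2 _)
        by_cases y3 : y = v3
        · rw [y3, s3] at hxy; exact absurd hxy.symm (i2 _)
        by_cases x2 : x = v2
        · rw [x2, s2] at hxy
          rw [x2, key y hxy (fun h => h1 (Or.inl ⟨x2, h⟩))]; exact g2
        by_cases y2 : y = v2
        · rw [y2, s2] at hxy
          rw [y2, key x hxy.symm (fun h => h1 (Or.inr ⟨h, y2⟩))]; exact g2.symm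
        rw [so x x3 x2, so y y3 y2] at hxy
        exact hHG x y hxy (by rw [ne_eq, Sym2.eq_iff]; grind) (by rw [ne_eq, Sym2.eq_iff]; grind) (swne hxy he)
    · refine insG (u := v3) (v := w4) [v2, v1, v0, v4] (hR2.mono_k (by simp)) hC' ?_ ?_ ?_ ?_
      · simp [i0, i1, i2, i4, u0, u1, u2, u3, u4]
      · simp only [List.nodup_cons, List.mem_cons, List.not_mem_nil, or_false, not_or, List.nodup_nil, and_true, not_false_eq_true]; grind
      · simp [g23.symm, g12.symm, g01.symm, g40.symm, g4]
      · intro x y hxy hne; exact hHG x y hxy (swne' hxy hA) hne (swne hxy he)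

lemma Rl.bot (W : Finset V) : Rl W (⊥ : SimpleGraph V) W.card := by
  refine ⟨fun u => Or.inl (fun x hx => hx), fun u v huv => absurd huv (by simp), ∅, fun v x hvx => absurd hvx (by simp), ?_⟩
  have := card_le_card (filter_subset (iso (⊥ : SimpleGraph V)) W)
  simp only [card_empty]; omega

lemma N3.of3 {G : SimpleGraph V} {u p q r : V} (h : N3 G u) (hp : G.Adj u p) (hq : G.Adj u q) (hr : G.Adj u r)
    (h1 : p ≠ q) (h2 : p ≠ r) (h3 : q ≠ r) : ∀ x, G.Adj u x ↔ x = p ∨ x = q ∨ x = r := by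
  obtain ⟨a, b, c, -, -, -, hn⟩ := h
  rw [hn] at hp hq hr
  intro x; rw [hn]
  grind

lemma red5a {G : SimpleGraph V} {W : Finset V} (hC : Cub G W) {v0 v1 v2 v3 v4 w0 w1 w2 w3 w4 : V}
    (h : Q5 G v0 v1 v2 v3 v4 w0 w1 w2 w3 w4) (hna : ¬ G.Adj w0 w1) (m : V → V)
    (hcut : ∀ X ⊆ W, dc G X = 3 → (X.filter (fun u => m u ∉ X)).card ≤ 1)
    (m0 : m w0 = v0) (m1 : m w1 = v1) (m2 : m v2 = w2) (m3 : m v3 = w3) (m4 : m v4 = w4) :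
    ∃ (G' : SimpleGraph V) (W' : Finset V), Cub G' W' ∧ W'.card + 4 = W.card ∧ 10 ≤ W.card ∧
      ∀ k, Good G' W' k → Good G W (k+1) := by
  refine ⟨_, _, g5_cub hC h hna m hcut m0 m1 m2 m3 m4, ?_, ?_, fun k => g5_ext hC h hna k⟩
  · have hnd : ([v0, v1, v2, v4]).Nodup := by
      have := h.nd
      simp only [List.nodup_cons, List.mem_cons, List.not_mem_nil, or_false, not_or, List.nodup_nil, and_true, not_false_eq_true] at this ⊢
      grind
    have h4 : ({v0, v1, v2, v4} : Finset V).card = 4 := by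
      rw [show ({v0, v1, v2, v4} : Finset V) = [v0,v1,v2,v4].toFinset by ext; simp]
      rw [List.toFinset_card_of_nodup hnd]; rfl
    rw [← h4]
    apply card_sdiff_add_card_eq_card
    intro x; simp only [mem_insert, mem_singleton]
    rintro (rfl | rfl | rfl | rfl)
    · exact hC.supp _ w0 (by rw [h.n0]; simp)
    · exact hC.supp _ w1 (by rw [h.n1]; simp)
    · exact hC.supp _ w2 (by rw [h.n2]; simp)
    · exact hC.supp _ w4 (by rw [h.n4]; simp)
  · have h10 := List.toFinset_card_of_nodup h.nd
    have : [v0,v1,v2,v3,v4,w0,w1,w2,w3,w4].toFinset ⊆ W := by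
      intro x
      simp only [List.mem_toFinset, List.mem_cons, List.not_mem_nil, or_false]
      have k0 := hC.adj_mem ((h.n0 w0).2 (by simp))
      have k1 := hC.adj_mem ((h.n1 w1).2 (by simp))
      have k2 := hC.adj_mem ((h.n2 w2).2 (by simp))
      have k3 := hC.adj_mem ((h.n3 w3).2 (by simp))
      have k4 := hC.adj_mem ((h.n4 w4).2 (by simp))
      rintro (rfl | rfl | rfl | rfl | rfl | rfl | rfl | rfl | rfl | rfl)
      exacts [k0.1, k1.1, k2.1, k3.1, k4.1, k0.2, k1.2, k2.2, k3.2, k4.2]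
    have := card_le_card this
    rw [h10] at this; exact this

set_option maxHeartbeats 800000 in
lemma red5 {G : SimpleGraph V} {W : Finset V} (hC : Cub G W) {v0 v1 v2 v3 v4 w0 w1 w2 w3 w4 : V}
    (h : Q5 G v0 v1 v2 v3 v4 w0 w1 w2 w3 w4) (m : V → V)
    (hcut : ∀ X ⊆ W, dc G X = 3 → (X.filter (fun u => m u ∉ X)).card ≤ 1)
    (hmm : ∀ v ∈ W, m (m v) = v)
    (m0 : m v0 = w0) (m1 : m v1 = w1) (m2 : m v2 = w2) (m3 : m v3 = w3) (m4 : m v4 = w4) :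
    Good G W 2 ∨ ∃ (G' : SimpleGraph V) (W' : Finset V), Cub G' W' ∧ W'.card + 4 = W.card ∧ 10 ≤ W.card ∧
      ∀ k, Good G' W' k → Good G W (k+1) := by
  have k0 := hC.adj_mem ((h.n0 w0).2 (by simp))
  have k1 := hC.adj_mem ((h.n1 w1).2 (by simp))
  have k2 := hC.adj_mem ((h.n2 w2).2 (by simp))
  have k3 := hC.adj_mem ((h.n3 w3).2 (by simp))
  have k4 := hC.adj_mem ((h.n4 w4).2 (by simp))
  have b0 : m w0 = v0 := by rw [← m0]; exact hmm _ k0.1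
  have b1 : m w1 = v1 := by rw [← m1]; exact hmm _ k1.1
  have b2 : m w2 = v2 := by rw [← m2]; exact hmm _ k2.1
  have b3 : m w3 = v3 := by rw [← m3]; exact hmm _ k3.1
  have b4 : m w4 = v4 := by rw [← m4]; exact hmm _ k4.1
  by_cases a0 : G.Adj w0 w1
  swap; · exact Or.inr (red5a hC h a0 m hcut b0 b1 m2 m3 m4)
  by_cases a1 : G.Adj w1 w2
  swap; · exact Or.inr (red5a hC h.rot a1 m hcut b1 b2 m3 m4 m0)
  by_cases a2 : G.Adj w2 w3
  swap; · exact Or.inr (red5a hC h.rot.rot a2 m hcut b2 b3 m4 m0 m1)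
  by_cases a3 : G.Adj w3 w4
  swap; · exact Or.inr (red5a hC h.rot.rot.rot a3 m hcut b3 b4 m0 m1 m2)
  by_cases a4 : G.Adj w4 w0
  swap; · exact Or.inr (red5a hC h.rot.rot.rot.rot a4 m hcut b4 b0 m1 m2 m3)
  left
  obtain ⟨n0, n1, n2, n3, n4, nd⟩ := h
  have nd' := nd
  simp only [List.nodup_cons, List.mem_cons, List.not_mem_nil, or_false, not_or, List.nodup_nil, and_true, not_false_eq_true] at nd
  have g0 : G.Adj v0 w0 := by rw [n0]; simp
  have g1 : G.Adj v1 w1 := by rw [n1]; simp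
  have g2 : G.Adj v2 w2 := by rw [n2]; simp
  have g3 : G.Adj v3 w3 := by rw [n3]; simp
  have g4 : G.Adj v4 w4 := by rw [n4]; simp
  have g01 : G.Adj v0 v1 := by rw [n0]; simp
  have g12 : G.Adj v1 v2 := by rw [n1]; simp
  have g23 : G.Adj v2 v3 := by rw [n2]; simp
  have g34 : G.Adj v3 v4 := by rw [n3]; simp
  have q0 := (hC.deg w0 k0.2).of3 g0.symm a0 a4.symm (by grind) (by grind) (by grind)
  have q1 := (hC.deg w1 k1.2).of3 g1.symm a1 a0.symm (by grind) (by grind) (by grind)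
  have q2 := (hC.deg w2 k2.2).of3 g2.symm a2 a1.symm (by grind) (by grind) (by grind)
  have q3 := (hC.deg w3 k3.2).of3 g3.symm a3 a2.symm (by grind) (by grind) (by grind)
  have q4 := (hC.deg w4 k4.2).of3 g4.symm a4 a3.symm (by grind) (by grind) (by grind)
  have hU : W = [v0,v1,v2,v3,v4,w0,w1,w2,w3,w4].toFinset := by
    by_contra hne
    have hsub : [v0,v1,v2,v3,v4,w0,w1,w2,w3,w4].toFinset ⊆ W := by
      intro x
      simp only [List.mem_toFinset, List.mem_cons, List.not_mem_nil, or_false]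
      rintro (rfl | rfl | rfl | rfl | rfl | rfl | rfl | rfl | rfl | rfl)
      exacts [k0.1, k1.1, k2.1, k3.1, k4.1, k0.2, k1.2, k2.2, k3.2, k4.2]
    have := hC.tec _ hsub ⟨v0, by simp⟩ (fun e => hne e.symm)
    have h0 : dc G [v0,v1,v2,v3,v4,w0,w1,w2,w3,w4].toFinset = 0 := by
      unfold dc
      rw [card_eq_zero, filter_eq_empty_iff]
      rintro e he ⟨x, hx, y, hy, rfl⟩
      rw [mem_eF] at he
      simp only [List.mem_toFinset, List.mem_cons, List.not_mem_nil, or_false] at hx hy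
      clear nd nd' hsub hne this hmm hcut
      rcases hx with rfl | rfl | rfl | rfl | rfl | rfl | rfl | rfl | rfl | rfl
      · rw [n0] at he; apply hy; rcases he with rfl | rfl | rfl <;> simp
      · rw [n1] at he; apply hy; rcases he with rfl | rfl | rfl <;> simp
      · rw [n2] at he; apply hy; rcases he with rfl | rfl | rfl <;> simp
      · rw [n3] at he; apply hy; rcases he with rfl | rfl | rfl <;> simp
      · rw [n4] at he; apply hy; rcases he with rfl | rfl | rfl <;> simp
      · rw [q0] at he; apply hy; rcases he with rfl | rfl | rfl <;> simp
      · rw [q1] at he; apply hy; rcases he with rfl | rfl | rfl <;> simp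
      · rw [q2] at he; apply hy; rcases he with rfl | rfl | rfl <;> simp
      · rw [q3] at he; apply hy; rcases he with rfl | rfl | rfl <;> simp
      · rw [q4] at he; apply hy; rcases he with rfl | rfl | rfl <;> simp
    omega
  have hcard : W.card = 10 := by rw [hU, List.toFinset_card_of_nodup nd']; rfl
  refine cycG (a := v0) (b := v1) (c := v2) (l := [v3, v4, w4, w3, w2, w1, w0]) (Rl.bot W) (by simp [hcard]) ?_ ?_ ?_ ?_
  · intro x hx
    refine ⟨fun y hy => hy, ?_⟩
    simp only [List.mem_cons, List.not_mem_nil, or_false] at hx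
    rcases hx with rfl | rfl | rfl | rfl | rfl | rfl | rfl | rfl | rfl | rfl
    exacts [k0.1, k1.1, k2.1, k3.1, k4.1, k4.2, k3.2, k2.2, k1.2, k0.2]
  · simp only [List.nodup_cons, List.mem_cons, List.not_mem_nil, or_false, not_or, List.nodup_nil, and_true, not_false_eq_true]
    clear n0 n1 n2 n3 n4 q0 q1 q2 q3 q4 hU hcut hmm nd'
    grind
  · simp [g01, g12, g23, g34, g4, a3.symm, a2.symm, a1.symm, a0.symm, g0.symm]
  · intro x y hxy; exact absurd hxy (by simp)

end R5b

set_option linter.unusedSectionVars false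
set_option linter.unusedVariables false
set_option linter.unusedSimpArgs false

section CY
variable {V : Type*} [Fintype V] [DecidableEq V]
open Finset

lemma D2.isCycles {F : SimpleGraph V} (h : D2 F) : F.IsCycles := by
  intro v hv
  rcases h v with h | ⟨a, b, hab, hn⟩
  · obtain ⟨x, hx⟩ := hv; exact absurd hx (h x)
  · have : F.neighborSet v = {a, b} := by
      ext x; rw [SimpleGraph.mem_neighborSet, hn]; simp
    rw [this, Set.ncard_pair hab]

lemma D2.of2 {F : SimpleGraph V} (h : D2 F) {u p q : V} (hp : F.Adj u p) (hq : F.Adj u q) (h1 : p ≠ q) :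
    ∀ x, F.Adj u x ↔ x = p ∨ x = q := by
  rcases h u with h | ⟨a, b, hab, hn⟩
  · exact absurd hp (h _)
  · rw [hn] at hp hq
    intro x; rw [hn]; grind

/-- Hamilton path of the cycle component through a given edge. -/
lemma D2.cy {F : SimpleGraph V} (h : D2 F) {u v : V} (huv : F.Adj u v) :
    ∃ p : F.Walk u v, p.IsPath ∧ (∀ x, x ∈ p.support ↔ F.Reachable u x) ∧ 2 ≤ p.length := by
  obtain ⟨p0, hp0⟩ := (h.isCycles.reachable_deleteEdges huv).exists_isPath
  have hle : F.deleteEdges {s(u,v)} ≤ F := SimpleGraph.deleteEdges_le _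
  have hpp : (p0.mapLe hle).IsPath := (Walk.isPath_mapLe hle).2 hp0
  have hed : ∀ e ∈ (p0.mapLe hle).edges, e ≠ s(u,v) := by
    intro e he
    rw [Walk.edges_mapLe_eq_edges] at he
    have := p0.edges_subset_edgeSet he
    rw [SimpleGraph.edgeSet_deleteEdges] at this
    exact this.2
  generalize p0.mapLe hle = p at hpp hed
  have hadjp : ∀ i, i < p.length → F.Adj (p.getVert i) (p.getVert (i+1)) := fun i hi => p.adj_getVert_succ hi
  have hinj := hpp.getVert_injOn
  have hne : ∀ i, i < p.length → s(p.getVert i, p.getVert (i+1)) ≠ s(u,v) := by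
    intro i hi
    apply hed
    rw [Walk.mk_mem_edges_iff_exists]
    exact ⟨i, hi, rfl⟩
  have h0 := p.getVert_zero
  have hl := p.getVert_length
  have hlen : 2 ≤ p.length := by
    by_contra hlt
    have : p.length = 0 ∨ p.length = 1 := by omega
    rcases this with h1 | h1
    · rw [h1, h0] at hl; exact huv.ne hl
    · have := hne 0 (by omega)
      rw [h1] at hl
      rw [h0, zero_add, hl] at this; exact this rfl
  refine ⟨p, hpp, ?_, hlen⟩
  have hcl : ∀ x y, x ∈ p.support → F.Adj x y → y ∈ p.support := by
    intro x y hx hxy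
    rw [Walk.mem_support_iff_exists_getVert] at hx
    obtain ⟨i, rfl, hi⟩ := hx
    have hm : ∀ j, p.getVert j ∈ p.support := fun j => p.getVert_mem_support j
    by_cases i0 : i = 0
    · subst i0
      rw [h0] at hxy
      have a1 := hadjp 0 (by omega)
      rw [h0] at a1
      have : p.getVert 1 ≠ v := by
        intro hh; have := hne 0 (by omega); rw [h0, zero_add, hh] at this; exact this rfl
      rcases (h.of2 huv a1 this.symm y).1 hxy with rfl | rfl
      · exact p.end_mem_support
      · exact hm _
    by_cases il : i = p.length
    · subst il
      rw [hl] at hxy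
      have a1 := hadjp (p.length - 1) (by omega)
      have e : p.length - 1 + 1 = p.length := by omega
      rw [e, hl] at a1
      have : p.getVert (p.length - 1) ≠ u := by
        intro hh; have := hne (p.length - 1) (by omega); rw [e, hh, hl] at this; exact this rfl
      rcases (h.of2 huv.symm a1.symm this.symm y).1 hxy with rfl | rfl
      · exact p.start_mem_support
      · exact hm _
    · have a1 := hadjp i (by omega)
      have a2 := hadjp (i-1) (by omega)
      have e : i - 1 + 1 = i := by omega
      rw [e] at a2
      have : p.getVert (i+1) ≠ p.getVert (i-1) := by
        intro hh
        have := hinj (by rw [Set.mem_ofPred_eq]; omega) (by rw [Set.mem_ofPred_eq]; omega) hh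
        omega
      rcases (h.of2 a1 a2.symm this y).1 hxy with rfl | rfl <;> exact hm _
  intro x
  constructor
  · intro hx
    exact ⟨p.takeUntil x hx⟩
  · rintro ⟨q⟩
    have : ∀ {a b : V} (q : F.Walk a b), a ∈ p.support → b ∈ p.support := by
      intro a b q
      induction q with
      | nil => exact id
      | cons hh q ih => intro ha; exact ih (hcl _ _ ha hh)
    exact this q p.start_mem_support

/-- closed tours of a vertex set -/
def TW (G : SimpleGraph V) (X : Finset V) (l : ℕ) : Prop :=
  ∃ (a : V) (T : G.Walk a a), (∀ v, v ∈ T.support ↔ v ∈ X) ∧ (∀ e, T.edges.count e ≤ 2) ∧ T.length ≤ l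

lemma TW.merge {G : SimpleGraph V} {X Y : Finset V} {l l' : ℕ} (h : TW G X l) (h' : TW G Y l') (hd : Disjoint X Y)
    {x y : V} (hx : x ∈ X) (hy : y ∈ Y) (hxy : G.Adj x y) : TW G (X ∪ Y) (l + l' + 2) := by
  obtain ⟨a, T, hs, hc, hl⟩ := h
  obtain ⟨b, S, hs', hc', hl'⟩ := h'
  have hxT := (hs x).2 hx
  have hyS := (hs' y).2 hy
  rw [Finset.disjoint_left] at hd
  refine ⟨x, (T.rotate x hxT).append (Walk.cons hxy ((S.rotate y hyS).append (Walk.cons hxy.symm Walk.nil))), ?_, ?_, ?_⟩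
  · intro v
    simp only [Walk.mem_support_append_iff, Walk.support_cons, List.mem_cons, Walk.mem_support_rotate_iff, hs, hs', mem_union,
      Walk.support_nil, List.not_mem_nil, or_false]
    constructor
    · rintro (h | rfl | h | rfl | rfl) <;> tauto
    · tauto
  · intro e
    simp only [Walk.edges_append, Walk.edges_cons, List.count_append, List.count_cons, Walk.edges_nil, List.count_nil,
      (T.rotate_edges x hxT).perm.count_eq, (S.rotate_edges y hyS).perm.count_eq]
    have c1 := hc e
    have c2 := hc' e
    have m1 : e ∈ T.edges → ∀ z ∈ e, z ∈ X := by
      intro he z hz; rw [← hs]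
      induction e with | h p q =>
      rw [Sym2.mem_iff] at hz
      rcases hz with rfl | rfl
      · exact T.fst_mem_support_of_mem_edges he
      · exact T.snd_mem_support_of_mem_edges he
    have m2 : e ∈ S.edges → ∀ z ∈ e, z ∈ Y := by
      intro he z hz; rw [← hs']
      induction e with | h p q =>
      rw [Sym2.mem_iff] at hz
      rcases hz with rfl | rfl
      · exact S.fst_mem_support_of_mem_edges he
      · exact S.snd_mem_support_of_mem_edges he
    by_cases e1 : e ∈ T.edges
    · have hz1 : ∀ z ∈ e, z ∈ X := m1 e1
      have : e ∉ S.edges := by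
        intro e2
        have := m2 e2
        induction e with | h p q =>
        exact hd (hz1 p (by simp)) (this p (by simp))
      rw [List.count_eq_zero_of_not_mem this]
      have n1 : s(x,y) ≠ e := by rintro rfl; exact hd (hz1 y (by simp)) hy
      have n2 : s(y,x) ≠ e := by rintro rfl; exact hd (hz1 y (by simp)) hy
      simp [n1, n2]; omega
    · rw [List.count_eq_zero_of_not_mem e1]
      by_cases e2 : e ∈ S.edges
      · have hz2 := m2 e2
        have n1 : s(x,y) ≠ e := by rintro rfl; exact hd hx (hz2 x (by simp))
        have n2 : s(y,x) ≠ e := by rintro rfl; exact hd hx (hz2 x (by simp))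
        simp [n1, n2]; omega
      · rw [List.count_eq_zero_of_not_mem e2]
        split_ifs <;> omega
  · simp only [Walk.length_append, Walk.length_cons, Walk.length_rotate, Walk.length_nil]
    omega

/-- From a relaxed structure to a tour. -/
lemma Good.tour {G : SimpleGraph V} (hconn : G.Connected) {k : ℕ} (h : Good G univ k) :
    ∃ l, TW G univ l ∧ l + 2 ≤ Fintype.card V + k := by
  obtain ⟨H, hle, hd2, -, R, hR, hk⟩ := h
  have step : ∀ y : V, ∃ Y : Finset V, y ∈ Y ∧ (∀ u (_ : V), u ∈ Y → H.Reachable y u) ∧ (∀ u v, u ∈ Y → H.Adj u v → v ∈ Y) ∧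
      ∃ l, TW G Y l ∧ l + 2 ≤ Y.card + (Y.filter (iso H)).card + 2 * (Y.filter (· ∈ R)).card := by
    intro y
    by_cases hy : iso H y
    · refine ⟨{y}, by simp, by simp, ?_, 0, ⟨y, Walk.nil, by simp, by simp, by simp⟩, ?_⟩
      · intro u v hu huv; rw [mem_singleton] at hu; subst hu; exact absurd huv (hy _)
      · have : ({y} : Finset V).filter (iso H) = {y} := by
          ext x; simp only [mem_filter, mem_singleton]
          constructor
          · exact fun h => h.1
          · rintro rfl; exact ⟨rfl, hy⟩
        rw [this]; simp
    · unfold iso at hy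
      push Not at hy
      obtain ⟨z, hz⟩ := hy
      obtain ⟨p, hp, hs, hl⟩ := hd2.cy hz
      refine ⟨p.support.toFinset, by simp, ?_, ?_, p.length + 1, ?_, ?_⟩
      · intro u v hu; rw [List.mem_toFinset, hs] at hu; exact hu
      · intro u v hu huv; rw [List.mem_toFinset, hs] at hu ⊢; exact hu.trans huv.reachable
      · refine ⟨z, Walk.cons (hle hz.symm) (p.mapLe hle), ?_, ?_, ?_⟩
        · intro v
          rw [Walk.support_cons, List.mem_cons, Walk.support_mapLe_eq_support, List.mem_toFinset]
          constructor
          · rintro (rfl | h)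
            · exact p.end_mem_support
            · exact h
          · exact Or.inr
        · intro e
          rw [Walk.edges_cons, List.count_cons, Walk.edges_mapLe_eq_edges]
          have := hp.isTrail.count_edges_le_one e
          split_ifs <;> omega
        · simp
      · rw [List.toFinset_card_of_nodup hp.support_nodup, Walk.length_support]
        obtain ⟨r, hr, hry⟩ := hR y z hz
        have : 0 < (p.support.toFinset.filter (· ∈ R)).card := by
          apply card_pos.2
          exact ⟨r, by rw [mem_filter, List.mem_toFinset, hs]; exact ⟨hry.symm, hr⟩⟩
        omega
  let P : Finset V → Prop := fun X => X.Nonempty ∧ (∀ u v, u ∈ X → H.Adj u v → v ∈ X) ∧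
      ∃ l, TW G X l ∧ l + 2 ≤ X.card + (X.filter (iso H)).card + 2 * (X.filter (· ∈ R)).card
  have main : ∀ j : ℕ, ∀ X, P X → Fintype.card V - X.card ≤ j → P univ := by
    intro j
    induction j with
    | zero =>
      intro X hX hc
      have : X = univ := by
        rw [← card_eq_iff_eq_univ]
        have := card_le_univ X; omega
      exact this ▸ hX
    | succ j ih =>
      intro X hX hc
      by_cases hXu : X = univ
      · exact hXu ▸ hX
      have hXP := hX
      obtain ⟨⟨x0, hx0⟩, hcl, l, hT, hb⟩ := hX
      obtain ⟨w, hw⟩ : ∃ w, w ∉ X := by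
        by_contra hh; push Not at hh; exact hXu (eq_univ_iff_forall.2 hh)
      obtain ⟨x, hx, y, hy, hxy⟩ : ∃ x ∈ X, ∃ y ∉ X, G.Adj x y := by
        by_contra hh
        push Not at hh
        obtain ⟨q⟩ := hconn.preconnected x0 w
        have : ∀ {a b : V} (q : G.Walk a b), a ∈ X → b ∈ X := by
          intro a b q
          induction q with
          | nil => exact id
          | cons ha q ih =>
            intro h1; apply ih
            by_contra h2; exact hh _ h1 _ h2 ha
        exact hw (this q hx0)
      obtain ⟨Y, hyY, hYr, hYc, l', hT', hb'⟩ := step y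
      have hreach : ∀ {a b : V} (q : H.Walk a b), a ∈ X → b ∈ X := by
        intro a b q
        induction q with
        | nil => exact id
        | cons ha q ih => intro h1; exact ih (hcl _ _ h1 ha)
      have hdis : Disjoint X Y := by
        rw [Finset.disjoint_left]
        intro z hz hzY
        obtain ⟨q⟩ := (hYr z z hzY).symm
        exact hy (hreach q hz)
      have hcard := card_union_of_disjoint hdis
      apply ih (X ∪ Y)
      · refine ⟨⟨x0, by simp [hx0]⟩, ?_, l + l' + 2, hT.merge hT' hdis hx hyY hxy, ?_⟩
        · intro u v hu huv
          rw [mem_union] at hu ⊢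
          rcases hu with hu | hu
          · exact Or.inl (hcl _ _ hu huv)
          · exact Or.inr (hYc _ _ hu huv)
        · rw [hcard, filter_union, filter_union, card_union_of_disjoint (disjoint_filter_filter hdis), card_union_of_disjoint (disjoint_filter_filter hdis)]
          omega
      · have : 0 < Y.card := card_pos.2 ⟨y, hyY⟩
        omega
  obtain ⟨y⟩ := hconn.nonempty
  obtain ⟨Y, hyY, hYr, hYc, l', hT', hb'⟩ := step y
  obtain ⟨-, -, l, hT, hb⟩ := main _ Y ⟨⟨y, hyY⟩, hYc, l', hT', hb'⟩ le_rfl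
  refine ⟨l, hT, ?_⟩
  have e : (univ.filter (· ∈ R)) = R := by ext; simp
  rw [e, card_univ] at hb
  omega

end CY

set_option linter.unusedSectionVars false
set_option linter.unusedVariables false
set_option linter.unusedSimpArgs false

section FIN
variable {V : Type*} [Fintype V] [DecidableEq V]
open Finset

lemma cub_univ (G : SimpleGraph V) [DecidableRel G.Adj]
    (hcubic : ∀ v : V, G.degree v = 3) (hconn : G.Connected)
    (hdel : ∀ v : V, (G.induce ({v}ᶜ : Set V)).Connected) : Cub G univ := by
  refine ⟨by simp, ?_, ?_⟩
  · intro u _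
    obtain ⟨a, b, c, h1, h2, h3, h⟩ := card_eq_three.1 (hcubic u)
    refine ⟨a, b, c, h1, h2, h3, fun x => ?_⟩
    rw [← SimpleGraph.mem_neighborFinset, h]; simp
  · intro X _ ⟨x0, hx0⟩ hXu
    obtain ⟨w, hw⟩ : ∃ w, w ∉ X := by
      by_contra hh; push Not at hh; exact hXu (eq_univ_iff_forall.2 hh)
    obtain ⟨x, hx, y, hy, hxy⟩ : ∃ x ∈ X, ∃ y ∉ X, G.Adj x y := by
      by_contra hh
      push Not at hh
      obtain ⟨q⟩ := hconn.preconnected x0 w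
      have : ∀ {a b : V} (q : G.Walk a b), a ∈ X → b ∈ X := by
        intro a b q
        induction q with
        | nil => exact id
        | cons ha q ih =>
          intro h1; apply ih
          by_contra h2; exact hh _ h1 _ h2 ha
      exact hw (this q hx0)
    by_cases hs : ∃ z ∈ X, z ≠ x
    · obtain ⟨z, hz, hzx⟩ := hs
      by_contra hlt
      obtain ⟨q⟩ := (hdel x).preconnected ⟨z, hzx⟩ ⟨y, hxy.ne.symm⟩
      have : ∀ {a b : ({x}ᶜ : Set V)} (q : (G.induce ({x}ᶜ : Set V)).Walk a b), a.1 ∈ X → b.1 ∈ X := by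
        intro a b q
        induction q with
        | nil => exact id
        | @cons a b c ha q ih =>
          intro h1; apply ih
          by_contra h2
          exact hlt (two_le_dc hxy hx hy ha h1 h2 (Or.inl (fun e => a.2 e.symm)))
      exact hy (this q hz)
    · push Not at hs
      have h2 : 1 < (G.neighborFinset x).card := by have := hcubic x; rw [SimpleGraph.degree] at this; omega
      obtain ⟨a, ha, b, hb, hab⟩ := one_lt_card.1 h2
      rw [SimpleGraph.mem_neighborFinset] at ha hb
      exact two_le_dc ha hx (fun h => ha.ne (hs a h).symm) hb hx (fun h => hb.ne (hs b h).symm) (Or.inr hab)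

lemma final (G : SimpleGraph V) (hconn : G.Connected) (hn : 8 ≤ Fintype.card V)
    (h : ∃ k, Good G univ k ∧ (k ≤ 2 ∨ 61236 * k ≤ 20411 * Fintype.card V)) :
    ∃ (a : V) (T : G.Walk a a),
      (∀ u : V, u ∈ T.support) ∧
      (∀ e : Sym2 V, T.edges.count e ≤ 2) ∧
      (T.length : ℝ) ≤ (4 / 3 - 1 / 61236) * (Fintype.card V : ℝ) - 2 := by
  obtain ⟨k, hg, hk⟩ := h
  obtain ⟨l, ⟨a, T, hs, hc, hl⟩, hb⟩ := hg.tour hconn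
  refine ⟨a, T, fun u => (hs u).2 (mem_univ u), hc, ?_⟩
  have h1 : 61236 * (T.length + 2) ≤ 81647 * Fintype.card V := by omega
  have h2 : (61236 : ℝ) * (T.length + 2) ≤ 81647 * Fintype.card V := by exact_mod_cast h1
  linarith

end FIN

set_option linter.unusedSectionVars false
set_option linter.unusedVariables false
set_option linter.unusedSimpArgs false

section K1
variable {V : Type*} [Fintype V] [DecidableEq V]
open Finset

/-- the 2-factor: `G` minus the matching -/
def fg (G : SimpleGraph V) (m : V → V) : SimpleGraph V where
  Adj u v := G.Adj u v ∧ m u ≠ v ∧ m v ≠ u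
  symm := ⟨fun u v h => ⟨h.1.symm, h.2.2, h.2.1⟩⟩
  loopless := ⟨fun u h => h.1.ne rfl⟩

structure Mt (G : SimpleGraph V) (W : Finset V) (m : V → V) : Prop where
  cub : Cub G W
  mem : ∀ v ∈ W, m v ∈ W
  inv : ∀ v ∈ W, m (m v) = v
  adj : ∀ v ∈ W, G.Adj v (m v)
  cut : ∀ X ⊆ W, dc G X = 3 → (X.filter (fun u => m u ∉ X)).card ≤ 1

open Classical in
noncomputable def cpt (F : SimpleGraph V) (v : V) : Finset V := univ.filter (fun x => F.Reachable v x)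

lemma mem_cmp {F : SimpleGraph V} {v x : V} : x ∈ cpt F v ↔ F.Reachable v x := by
  simp [cpt]

lemma self_mem_cmp {F : SimpleGraph V} {v : V} : v ∈ cpt F v := mem_cmp.2 (Reachable.refl _)

lemma cmp_eq {F : SimpleGraph V} {v x : V} (h : x ∈ cpt F v) : cpt F x = cpt F v := by
  ext y; rw [mem_cmp] at *
  rw [mem_cmp]
  exact ⟨fun hh => h.trans hh, fun hh => h.symm.trans hh⟩

lemma cmp_eq_adj {F : SimpleGraph V} {v x : V} (h : F.Adj v x) : cpt F x = cpt F v :=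
  cmp_eq (mem_cmp.2 h.reachable)

def FC (F : SimpleGraph V) (X : Finset V) : Prop := ∀ u v, u ∈ X → F.Adj u v → v ∈ X

lemma cmp_FC {F : SimpleGraph V} {v : V} : FC F (cpt F v) := by
  intro x y hx hxy
  rw [mem_cmp] at *
  exact hx.trans hxy.reachable

lemma FC.reach {F : SimpleGraph V} {X : Finset V} (h : FC F X) {u v : V} (hu : u ∈ X) (huv : F.Reachable u v) : v ∈ X := by
  obtain ⟨q⟩ := huv
  induction q with
  | nil => exact hu
  | cons ha q ih => exact ih (h _ _ hu ha)

lemma FC.cmp_sub {F : SimpleGraph V} {X : Finset V} (h : FC F X) {u : V} (hu : u ∈ X) : cpt F u ⊆ X := by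
  intro x hx; rw [mem_cmp] at hx; exact h.reach hu hx

namespace Mt
variable {G : SimpleGraph V} {W : Finset V} {m : V → V}

lemma fadj (h : Mt G W m) {u v : V} : (fg G m).Adj u v ↔ G.Adj u v ∧ m u ≠ v := by
  constructor
  · exact fun hh => ⟨hh.1, hh.2.1⟩
  · rintro ⟨h1, h2⟩
    refine ⟨h1, h2, fun h3 => h2 ?_⟩
    rw [← h3, h.inv _ (h.cub.adj_mem h1).2]

lemma n3 (h : Mt G W m) {v : V} (hv : v ∈ W) : ∃ p q, p ≠ q ∧ p ≠ m v ∧ q ≠ m v ∧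
    (∀ x, G.Adj v x ↔ x = m v ∨ x = p ∨ x = q) ∧ (∀ x, (fg G m).Adj v x ↔ x = p ∨ x = q) := by
  obtain ⟨a, b, c, h1, h2, h3, hn⟩ := h.cub.deg v hv
  have hm := h.adj v hv
  rw [hn] at hm
  rcases hm with e | e | e
  · refine ⟨b, c, h3, by grind, by grind, by intro x; rw [hn]; grind, fun x => ?_⟩
    rw [h.fadj, hn]; grind
  · refine ⟨a, c, h2, by grind, by grind, by intro x; rw [hn]; grind, fun x => ?_⟩
    rw [h.fadj, hn]; grind
  · refine ⟨a, b, h1, by grind, by grind, by intro x; rw [hn]; grind, fun x => ?_⟩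
    rw [h.fadj, hn]; grind

lemma d2 (h : Mt G W m) : D2 (fg G m) := by
  intro u
  by_cases hu : u ∈ W
  · obtain ⟨p, q, h1, -, -, -, h2⟩ := h.n3 hu
    exact Or.inr ⟨p, q, h1, h2⟩
  · left; intro x hx; exact hu (h.cub.supp _ _ hx.1)

lemma FCW (h : Mt G W m) : FC (fg G m) W := fun u v _ huv => (h.cub.adj_mem huv.1).2

lemma inj (h : Mt G W m) {u v : V} (hu : u ∈ W) (hv : v ∈ W) (e : m u = m v) : u = v := by
  rw [← h.inv u hu, e, h.inv v hv]

lemma ne (h : Mt G W m) {u : V} (hu : u ∈ W) : m u ≠ u := (h.adj u hu).ne.symm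

lemma dc_FC (h : Mt G W m) {X : Finset V} (hX : X ⊆ W) (hF : FC (fg G m) X) :
    dc G X = (X.filter (fun u => m u ∉ X)).card := by
  symm
  unfold dc
  apply card_bij (fun u _ => s(u, m u))
  · intro u hu
    rw [mem_filter] at hu
    rw [mem_filter, mem_eF]
    exact ⟨h.adj u (hX hu.1), u, hu.1, m u, hu.2, rfl⟩
  · intro u hu v hv e
    rw [mem_filter] at hu hv
    rw [Sym2.eq_iff] at e
    rcases e with e | e
    · exact e.1
    · rw [e.1] at hu; exact absurd hu.1 hv.2
  · intro e he
    rw [mem_filter] at he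
    obtain ⟨he, u, hu, v, hv, rfl⟩ := he
    rw [mem_eF] at he
    have : m u = v := by
      by_contra hne
      exact hv (hF u v hu (h.fadj.2 ⟨he, hne⟩))
    refine ⟨u, by rw [mem_filter, this]; exact ⟨hu, hv⟩, by rw [this]⟩

lemma out_facts (h : Mt G W m) {X : Finset V} (hX : X ⊆ W) (hF : FC (fg G m) X) (hne : X.Nonempty) (hXW : X ≠ W) :
    2 ≤ (X.filter (fun u => m u ∉ X)).card ∧ (X.filter (fun u => m u ∉ X)).card ≠ 3 ∧
    (X.filter (fun u => m u ∉ X)).card % 2 = X.card % 2 ∧ (X.filter (fun u => m u ∉ X)).card ≤ X.card := by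
  have hd := h.dc_FC hX hF
  refine ⟨?_, ?_, ?_, card_filter_le _ _⟩
  · rw [← hd]; exact h.cub.tec X hX hne hXW
  · intro h3; have := h.cut X hX (by rw [hd]; exact h3); omega
  · rw [← hd]; exact h.cub.dc_parity hX

end Mt

/-- Hamilton path list of the component through an edge. -/
lemma D2.cyl {F : SimpleGraph V} (h : D2 F) {u v : V} (huv : F.Adj u v) :
    ∃ l : List V, (u :: (l ++ [v])).Nodup ∧ List.IsChain F.Adj (u :: (l ++ [v])) ∧
      (∀ x, x ∈ u :: (l ++ [v]) ↔ x ∈ cpt F u) ∧ l.length + 2 = (cpt F u).card ∧ 1 ≤ l.length := by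
  obtain ⟨p, hp, hs, hl⟩ := h.cy huv
  obtain ⟨l, hl'⟩ : ∃ l, p.support = u :: (l ++ [v]) := by
    have h1 := p.support_eq_cons
    have h2 : p.support.tail ≠ [] := by
      intro hh
      have := congrArg List.length hh
      rw [List.length_tail, Walk.length_support] at this
      simp only [List.length_nil] at this; omega
    have h3 := List.dropLast_append_getLast h2
    have h4 : p.support.tail.getLast h2 = v := by
      rw [List.getLast_tail, Walk.getLast_support]
    rw [h4] at h3
    exact ⟨p.support.tail.dropLast, by rw [h3]; exact h1⟩
  have hch := p.isChain_adj_support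
  have hnd := hp.support_nodup
  have hlen := p.length_support
  have hm : ∀ x, x ∈ p.support ↔ x ∈ cpt F u := by intro x; rw [hs, mem_cmp]
  rw [hl'] at hch hnd hlen hm
  have hcard : (cpt F u).card = (u :: (l ++ [v])).length := by
    rw [← List.toFinset_card_of_nodup hnd]
    congr 1; ext x; rw [List.mem_toFinset, hm]
  simp only [List.length_cons, List.length_append, List.length_nil] at hlen hcard
  exact ⟨l, hnd, hch, hm, by omega, by omega⟩

namespace Mt
variable {G : SimpleGraph V} {W : Finset V} {m : V → V}

lemma cmp_sub (h : Mt G W m) {v : V} (hv : v ∈ W) : cpt (fg G m) v ⊆ W := h.FCW.cmp_sub hv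

lemma card_ge4 (h : Mt G W m) {v : V} (hv : v ∈ W) : 4 ≤ (cpt (fg G m) v).card := by
  obtain ⟨p, q, h1, -, -, -, hn⟩ := h.n3 hv
  obtain ⟨l, -, -, -, hl, hl'⟩ := h.d2.cyl ((hn p).2 (Or.inl rfl))
  by_contra hlt
  have h3 : (cpt (fg G m) v).card = 3 := by omega
  by_cases hW : cpt (fg G m) v = W
  · have := h.cub.even
    rw [← hW, h3] at this; exact absurd this (by decide)
  · have := h.out_facts (h.cmp_sub hv) cmp_FC ⟨v, self_mem_cmp⟩ hW
    omega

end Mt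

end K1

set_option linter.unusedSectionVars false
set_option linter.unusedVariables false
set_option linter.unusedSimpArgs false

section K2
variable {V : Type*} [Fintype V] [DecidableEq V]
open Finset

def gw {n : ℕ} [NeZero n] (S : Finset (Fin n → V)) (v x : V) : ℕ :=
  ∑ Z ∈ S, ∑ i : Fin n, if Z i = v ∧ Z (i+1) = x then 1 else 0

def mu {n : ℕ} [NeZero n] (m : V → V) (Z : Fin n → V) : ℕ :=
  ∑ i : Fin n, if m (Z i) = Z (i+1) then 1 else 0

lemma gw_tot {n : ℕ} [NeZero n] {G : SimpleGraph V} {W : Finset V} (S : Finset (Fin n → V))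
    (hS : ∀ Z ∈ S, ∀ i, G.Adj (Z i) (Z (i+1)) ∧ Z i ∈ W) :
    ∑ v ∈ W, ∑ x, (if s(v,x) ∈ eF G then gw S v x else 0) = n * S.card := by
  have h1 : ∀ v ∈ W, ∑ x, (if s(v,x) ∈ eF G then gw S v x else 0) =
      ∑ Z ∈ S, ∑ i : Fin n, if Z i = v then 1 else 0 := by
    intro v hv
    have : ∀ x, (if s(v,x) ∈ eF G then gw S v x else 0) =
      ∑ Z ∈ S, ∑ i : Fin n, if Z (i+1) = x then (if Z i = v then 1 else 0) else 0 := by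
      intro x
      split_ifs with he
      · unfold gw
        refine sum_congr rfl fun Z _ => sum_congr rfl fun i _ => ?_
        split_ifs <;> simp_all
      · symm
        refine sum_eq_zero fun Z hZ => sum_eq_zero fun i _ => ?_
        split_ifs with e1 e2
        · exfalso; apply he; rw [mem_eF, ← e1, ← e2]; exact (hS Z hZ i).1
        · rfl
        · rfl
    simp only [this]
    rw [sum_comm]
    refine sum_congr rfl fun Z _ => ?_
    rw [sum_comm]
    refine sum_congr rfl fun i _ => ?_
    simp
  rw [sum_congr rfl h1, sum_comm]
  have h2 : ∀ Z ∈ S, ∑ v ∈ W, ∑ i : Fin n, (if Z i = v then 1 else 0) = n := by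
    intro Z hZ
    rw [sum_comm]
    have : ∀ i : Fin n, ∑ v ∈ W, (if Z i = v then 1 else 0) = 1 := by
      intro i
      rw [sum_ite_eq]; simp [(hS Z hZ i).2]
    simp [this]
  rw [sum_congr rfl h2]; simp [mul_comm]

lemma gw_m {n : ℕ} [NeZero n] {W : Finset V} (m : V → V) (S : Finset (Fin n → V))
    (hS : ∀ Z ∈ S, ∀ i, Z i ∈ W) :
    ∑ v ∈ W, gw S v (m v) = ∑ Z ∈ S, mu m Z := by
  unfold gw mu
  rw [sum_comm]
  refine sum_congr rfl fun Z hZ => ?_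
  rw [sum_comm]
  refine sum_congr rfl fun i _ => ?_
  have : ∀ v ∈ W, (if Z i = v ∧ Z (i+1) = m v then 1 else 0) =
     if Z i = v then (if m (Z i) = Z (i+1) then 1 else 0) else 0 := by
    intro v _
    split_ifs <;> simp_all
  rw [sum_congr rfl this, sum_ite_eq, if_pos (hS Z hZ i)]

lemma Cub.wpm2 {G : SimpleGraph V} {W : Finset V} (h : Cub G W) (Q : Finset (Fin 4 → V)) (S : Finset (Fin 6 → V))
    (hQ : ∀ Z ∈ Q, ∀ i, G.Adj (Z i) (Z (i+1))) (hS : ∀ Z ∈ S, ∀ i, G.Adj (Z i) (Z (i+1))) :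
    ∃ m, Mt G W m ∧ 2000 * (4 * Q.card) + 6 * S.card ≤ 3 * (2000 * ∑ Z ∈ Q, mu m Z + ∑ Z ∈ S, mu m Z) := by
  have hQ' : ∀ Z ∈ Q, ∀ i, G.Adj (Z i) (Z (i+1)) ∧ Z i ∈ W := fun Z hZ i => ⟨hQ Z hZ i, (h.adj_mem (hQ Z hZ i)).1⟩
  have hS' : ∀ Z ∈ S, ∀ i, G.Adj (Z i) (Z (i+1)) ∧ Z i ∈ W := fun Z hZ i => ⟨hS Z hZ i, (h.adj_mem (hS Z hZ i)).1⟩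
  obtain ⟨m, h1, h2, h3⟩ := h.wpm (fun v x => 2000 * gw Q v x + gw S v x)
  refine ⟨m, ⟨h, fun v hv => (h1 v hv).1, fun v hv => (h1 v hv).2.1, fun v hv => (h1 v hv).2.2, h2⟩, ?_⟩
  have e1 : ∀ v x, (if s(v,x) ∈ eF G then 2000 * gw Q v x + gw S v x else 0) =
    2000 * (if s(v,x) ∈ eF G then gw Q v x else 0) + (if s(v,x) ∈ eF G then gw S v x else 0) := by
    intro v x; split_ifs <;> simp
  simp only [e1, sum_add_distrib, ← mul_sum] at h3
  rw [gw_tot Q hQ', gw_tot S hS', gw_m m Q (fun Z hZ i => (hQ' Z hZ i).2), gw_m m S (fun Z hZ i => (hS' Z hZ i).2)] at h3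
  exact h3

/-- per-tuple estimate for 4-tuples -/
lemma Mt.mu4 {G : SimpleGraph V} {W : Finset V} {m : V → V} (h : Mt G W m) {Z : Fin 4 → V} (hZ : ∀ i, Z i ∈ W)
    (hinj : Function.Injective Z) :
    3 * mu m Z + (if mu m Z = 0 then 4 else 0) ≤ 4 + (if (m (Z 0) = Z 1 ∧ m (Z 2) = Z 3) ∨ (m (Z 1) = Z 2 ∧ m (Z 3) = Z 0) then 2 else 0) := by
  have key : ∀ i, ¬ (m (Z i) = Z (i+1) ∧ m (Z (i+1)) = Z (i+1+1)) := by
    rintro i ⟨h1, h2⟩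
    rw [← h1, h.inv _ (hZ i)] at h2
    have := hinj h2
    clear h1 h2; revert this; revert i; decide
  have k0 := key 0; have k1 := key 1; have k2 := key 2; have k3 := key 3
  unfold mu
  rw [Fin.sum_univ_four]
  simp only [show (0:Fin 4)+1 = 1 from rfl, show (1:Fin 4)+1 = 2 from rfl, show (2:Fin 4)+1 = 3 from rfl, show (3:Fin 4)+1 = 0 from rfl] at *
  clear key
  by_cases c0 : m (Z 0) = Z 1 <;> by_cases c1 : m (Z 1) = Z 2 <;> by_cases c2 : m (Z 2) = Z 3 <;>
    by_cases c3 : m (Z 3) = Z 0 <;> simp_all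

lemma Mt.mu6 {G : SimpleGraph V} {W : Finset V} {m : V → V} (h : Mt G W m) {Z : Fin 6 → V} (hZ : ∀ i, Z i ∈ W)
    (hinj : Function.Injective Z) :
    3 * mu m Z + (if mu m Z = 0 then 6 else 0) ≤ 6 + (if (m (Z 0) = Z 1 ∧ m (Z 2) = Z 3 ∧ m (Z 4) = Z 5) ∨
      (m (Z 1) = Z 2 ∧ m (Z 3) = Z 4 ∧ m (Z 5) = Z 0) then 3 else 0) := by
  have key : ∀ i, ¬ (m (Z i) = Z (i+1) ∧ m (Z (i+1)) = Z (i+1+1)) := by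
    rintro i ⟨h1, h2⟩
    rw [← h1, h.inv _ (hZ i)] at h2
    have := hinj h2
    clear h1 h2; revert this; revert i; decide
  have k0 := key 0; have k1 := key 1; have k2 := key 2; have k3 := key 3; have k4 := key 4; have k5 := key 5
  unfold mu
  rw [Fin.sum_univ_six]
  simp only [show (0:Fin 6)+1 = 1 from rfl, show (1:Fin 6)+1 = 2 from rfl, show (2:Fin 6)+1 = 3 from rfl, show (3:Fin 6)+1 = 4 from rfl,
    show (4:Fin 6)+1 = 5 from rfl, show (5:Fin 6)+1 = 0 from rfl] at *
  clear key
  by_cases c0 : m (Z 0) = Z 1 <;> by_cases c1 : m (Z 1) = Z 2 <;> by_cases c2 : m (Z 2) = Z 3 <;>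
    by_cases c3 : m (Z 3) = Z 4 <;> by_cases c4 : m (Z 4) = Z 5 <;> by_cases c5 : m (Z 5) = Z 0 <;> simp_all

/-- summed version -/
lemma wsum {α : Type*} [DecidableEq α] (S : Finset α) (f : α → ℕ) (A : α → Prop) [DecidablePred A] (k c : ℕ)
    (h : ∀ Z ∈ S, 3 * f Z + (if f Z = 0 then k else 0) ≤ k + (if A Z then c else 0)) :
    3 * ∑ Z ∈ S, f Z + k * (S.filter (fun Z => f Z = 0)).card ≤ k * S.card + c * (S.filter A).card := by
  have := sum_le_sum h
  rw [sum_add_distrib, sum_add_distrib, ← mul_sum] at this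
  simp only [← sum_filter, sum_const, smul_eq_mul] at this
  linarith

end K2

set_option linter.unusedSectionVars false
set_option linter.unusedVariables false
set_option linter.unusedSimpArgs false

section K3
variable {V : Type*} [Fintype V] [DecidableEq V]
open Finset

def SepP (G : SimpleGraph V) (W : Finset V) (a b c d x y : V) : Prop :=
  ∃ A ⊆ W, a ∉ A ∧ b ∉ A ∧ c ∉ A ∧ d ∉ A ∧ x ∈ A ∧ y ∈ A ∧ dc G A = 2

def IQ (G : SimpleGraph V) (W : Finset V) (a b c d : V) : Prop :=
  (a ≠ c ∧ b ≠ d ∧ G.Adj a b ∧ G.Adj b c ∧ G.Adj c d ∧ G.Adj d a ∧ (G.Adj a c ∨ G.Adj b d)) ∨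
  ∃ a' b' c' d', Q4 G a b c d a' b' c' d' ∧ (SepP G W a b c d a' c' ∨ SepP G W a b c d b' d')

lemma SepP.rot {G : SimpleGraph V} {W : Finset V} {a b c d x y : V} (h : SepP G W a b c d x y) : SepP G W b c d a x y := by
  obtain ⟨A, h0, h1, h2, h3, h4, h5, h6, h7⟩ := h
  exact ⟨A, h0, h2, h3, h4, h1, h5, h6, h7⟩

lemma SepP.swap {G : SimpleGraph V} {W : Finset V} {a b c d x y : V} (h : SepP G W a b c d x y) : SepP G W a b c d y x := by
  obtain ⟨A, h0, h1, h2, h3, h4, h5, h6, h7⟩ := h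
  exact ⟨A, h0, h1, h2, h3, h4, h6, h5, h7⟩

lemma SepP.flip {G : SimpleGraph V} {W : Finset V} {a b c d x y : V} (h : SepP G W a b c d x y) : SepP G W b a d c x y := by
  obtain ⟨A, h0, h1, h2, h3, h4, h5, h6, h7⟩ := h
  exact ⟨A, h0, h2, h1, h4, h3, h5, h6, h7⟩

lemma Q4.rot {G : SimpleGraph V} {a b c d a' b' c' d' : V} (h : Q4 G a b c d a' b' c' d') :
    Q4 G b c d a b' c' d' a' := by
  obtain ⟨na, nb, nc, nd, ac, bd, a1, a2, a3, b1, b2, b3, c1, c2, c3, d1, d2, d3, e1, e2⟩ := h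
  refine ⟨fun x => by rw [nb]; tauto, fun x => by rw [nc], fun x => by rw [nd]; tauto, fun x => by rw [na],
    bd, ac.symm, b2, b3, b1, c2, c3, c1, d2, d3, d1, a1, a2, a3, e2, e1.symm⟩

lemma IQ.rot {G : SimpleGraph V} {W : Finset V} {a b c d : V} (h : IQ G W a b c d) : IQ G W b c d a := by
  rcases h with ⟨h1, h2, h3, h4, h5, h6, h7⟩ | ⟨a', b', c', d', h, hs⟩
  · exact Or.inl ⟨h2, h1.symm, h4, h5, h6, h3, h7.symm.imp id (fun h => h.symm)⟩
  · refine Or.inr ⟨_, _, _, _, h.rot, ?_⟩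
    exact hs.symm.imp SepP.rot (fun h => h.rot.swap)

lemma IQ.flip {G : SimpleGraph V} {W : Finset V} {a b c d : V} (h : IQ G W a b c d) : IQ G W b a d c := by
  rcases h with ⟨h1, h2, h3, h4, h5, h6, h7⟩ | ⟨a', b', c', d', h, hs⟩
  · exact Or.inl ⟨h2, h1, h3.symm, h6.symm, h5.symm, h4.symm, h7.symm⟩
  · refine Or.inr ⟨_, _, _, _, h.flip, ?_⟩
    exact hs.symm.imp SepP.flip SepP.flip

/-- `(a,d,c,b)` -/
lemma IQ.refl' {G : SimpleGraph V} {W : Finset V} {a b c d : V} (h : IQ G W a b c d) : IQ G W a d c b :=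
  h.flip.rot

lemma IQ.basic {G : SimpleGraph V} {W : Finset V} {a b c d : V} (h : IQ G W a b c d) :
    a ≠ c ∧ b ≠ d ∧ G.Adj a b ∧ G.Adj b c ∧ G.Adj c d ∧ G.Adj d a := by
  rcases h with ⟨h1, h2, h3, h4, h5, h6, h7⟩ | ⟨a', b', c', d', h, hs⟩
  · exact ⟨h1, h2, h3, h4, h5, h6⟩
  · exact ⟨h.ac, h.bd, (h.na _).2 (by simp), (h.nb _).2 (by simp), (h.nc _).2 (by simp), (h.nd _).2 (by simp)⟩

structure Cx (G : SimpleGraph V) (W : Finset V) (m : V → V) : Prop extends Mt G W m where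
  nW : ∀ v ∈ W, cpt (fg G m) v ≠ W
  n5 : ∀ v ∈ W, (cpt (fg G m) v).card ≠ 5
  n6 : ∀ a b c d p q u v, ¬ D6 G a b c d p q u v
  n4 : ∀ a b c d a' b' c' d', Q4 G a b c d a' b' c' d' → SepP G W a b c d a' c' ∨ SepP G W a b c d b' d'

/-- crossing edges of a separating set -/
lemma Q4.cross {G : SimpleGraph V} {a b c d a' b' c' d' : V} (h : Q4 G a b c d a' b' c' d') {A : Finset V}
    (ha : a ∉ A) (hc : c ∉ A) (ha' : a' ∈ A) (hc' : c' ∈ A) (hA : dc G A = 2) {x y : V} (hx : x ∈ A) (hy : y ∉ A)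
    (hxy : G.Adj x y) : (x = a' ∧ y = a) ∨ (x = c' ∧ y = c) := by
  by_contra hne
  have g1 : G.Adj a' a := ((h.na a').2 (by simp)).symm
  have g2 : G.Adj c' c := ((h.nc c').2 (by simp)).symm
  have hsub : ([s(x,y), s(a',a), s(c',c)].toFinset) ⊆ (eF G).filter (crs A) := by
    intro e he
    simp only [List.mem_toFinset, List.mem_cons, List.not_mem_nil, or_false] at he
    rw [mem_filter]
    rcases he with rfl | rfl | rfl
    · exact ⟨mem_eF.2 hxy, x, hx, y, hy, rfl⟩
    · exact ⟨mem_eF.2 g1, a', ha', a, ha, rfl⟩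
    · exact ⟨mem_eF.2 g2, c', hc', c, hc, rfl⟩
  have hnd : [s(x,y), s(a',a), s(c',c)].Nodup := by
    have := h.e1
    simp only [List.nodup_cons, List.mem_cons, List.not_mem_nil, or_false, not_or, List.nodup_nil, and_true, not_false_eq_true, Sym2.eq_iff]
    grind
  have := card_le_card hsub
  rw [List.toFinset_card_of_nodup hnd] at this
  unfold dc at hA
  simp at this; omega

namespace Cx
variable {G : SimpleGraph V} {W : Finset V} {m : V → V}

/-- out facts for components -/
lemma out (h : Cx G W m) {v : V} (hv : v ∈ W) :
    2 ≤ ((cpt (fg G m) v).filter (fun u => m u ∉ cpt (fg G m) v)).card ∧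
    ((cpt (fg G m) v).filter (fun u => m u ∉ cpt (fg G m) v)).card ≠ 3 ∧
    ((cpt (fg G m) v).filter (fun u => m u ∉ cpt (fg G m) v)).card % 2 = (cpt (fg G m) v).card % 2 :=
  let h1 := h.toMt.out_facts (h.cmp_sub hv) cmp_FC ⟨v, self_mem_cmp⟩ (h.nW v hv)
  ⟨h1.1, h1.2.1, h1.2.2.1⟩

lemma altSep (h : Cx G W m) {a b c d a' b' c' d' : V} (hq : Q4 G a b c d a' b' c' d') (hs : SepP G W a b c d a' c')
    (m1 : m a = b) (m2 : m c = d) : b ∈ cpt (fg G m) a ∧ c ∈ cpt (fg G m) a ∧ d ∈ cpt (fg G m) a ∧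
      8 ≤ (cpt (fg G m) a).card := by
  obtain ⟨A, hAW, hA1, hA2, hA3, hA4, ha', hc', hA⟩ := hs
  have hcr := fun x y => hq.cross hA1 hA3 ha' hc' hA (x := x) (y := y)
  have faa' : (fg G m).Adj a a' := h.fadj.2 ⟨(hq.na _).2 (by simp), by rw [m1]; exact hq.a1.symm⟩
  have fcc' : (fg G m).Adj c c' := h.fadj.2 ⟨(hq.nc _).2 (by simp), by rw [m2]; exact hq.c3.symm⟩
  have fad : (fg G m).Adj a d := h.fadj.2 ⟨(hq.na _).2 (by simp), by rw [m1]; exact hq.bd⟩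
  have fcb : (fg G m).Adj c b := h.fadj.2 ⟨(hq.nc _).2 (by simp), by rw [m2]; exact hq.bd.symm⟩
  have haW : a ∈ W := (h.cub.adj_mem faa'.1).1
  have hcW : c ∈ W := (h.cub.adj_mem fcc'.1).1
  have mb : m b = a := by rw [← m1, h.inv a haW]
  have md : m d = c := by rw [← m2, h.inv c hcW]
  have fbb' : (fg G m).Adj b b' := h.fadj.2 ⟨(hq.nb _).2 (by simp), by rw [mb]; exact hq.b1.symm⟩
  have fdd' : (fg G m).Adj d d' := h.fadj.2 ⟨(hq.nd _).2 (by simp), by rw [md]; exact hq.d3.symm⟩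
  set D := cpt (fg G m) a with hD
  have hFC : FC (fg G m) D := cmp_FC
  have aD : a ∈ D := self_mem_cmp
  have a'D : a' ∈ D := hFC _ _ aD faa'
  have dD : d ∈ D := hFC _ _ aD fad
  have d'D : d' ∈ D := hFC _ _ dD fdd'
  have hev := h.d2.even_cut (A ∩ D)
  have cD : c ∈ D := by
    by_contra hcD
    have : (eF (fg G m)).filter (crs (A ∩ D)) = {s(a', a)} := by
      ext e
      rw [mem_filter, mem_singleton]
      constructor
      · rintro ⟨he, x, hx, y, hy, rfl⟩
        rw [mem_eF] at he
        rw [mem_inter] at hx hy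
        have hyD := hFC _ _ hx.2 he
        rcases hcr x y hx.1 (fun hh => hy ⟨hh, hyD⟩) he.1 with ⟨rfl, rfl⟩ | ⟨rfl, rfl⟩
        · rfl
        · exact absurd hyD hcD
      · rintro rfl
        exact ⟨mem_eF.2 faa'.symm, a', mem_inter.2 ⟨ha', a'D⟩, a, fun hh => hA1 (mem_inter.1 hh).1, rfl⟩
    unfold dc at hev
    rw [this] at hev
    exact absurd hev (by simp)
  have bD : b ∈ D := hFC _ _ cD fcb
  have c'D : c' ∈ D := hFC _ _ cD fcc'
  have b'D : b' ∈ D := hFC _ _ bD fbb'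
  refine ⟨bD, cD, dD, ?_⟩
  have hb'A : b' ∉ A := by
    intro hh
    have := hcr b' b hh hA2 fbb'.1.symm
    have := fcb.ne; have := (h.ne haW); grind
  have hd'A : d' ∉ A := by
    intro hh
    have := hcr d' d hh hA4 fdd'.1.symm
    have := fad.ne; have := (h.ne hcW); grind
  have hnd : [a,b,c,d,a',b',c',d'].Nodup := by
    have := hq.ac; have := hq.bd; have := hq.e1; have := hq.e2
    have := hq.b1; have := hq.b2; have := hq.b3
    have := hq.d1; have := hq.d2; have := hq.d3
    have := fcb.ne; have := fad.ne; have := fbb'.ne; have := fdd'.ne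
    have := (h.ne haW); have := (h.ne hcW)
    rw [m1] at *; rw [m2] at *
    have := ne_of_mem_of_not_mem ha' hA1; have := ne_of_mem_of_not_mem ha' hA2
    have := ne_of_mem_of_not_mem ha' hA3; have := ne_of_mem_of_not_mem ha' hA4
    have := ne_of_mem_of_not_mem hc' hA1; have := ne_of_mem_of_not_mem hc' hA2
    have := ne_of_mem_of_not_mem hc' hA3; have := ne_of_mem_of_not_mem hc' hA4
    have := ne_of_mem_of_not_mem ha' hb'A; have := ne_of_mem_of_not_mem ha' hd'A
    have := ne_of_mem_of_not_mem hc' hb'A; have := ne_of_mem_of_not_mem hc' hd'A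
    simp only [List.nodup_cons, List.mem_cons, List.not_mem_nil, or_false, not_or, List.nodup_nil, and_true, not_false_eq_true]
    clear hcr hFC hev
    clear_value D
    clear aD a'D dD d'D cD bD c'D b'D hA1 hA2 hA3 hA4 ha' hc' hb'A hd'A hA hAW
    refine ⟨⟨?_,?_,?_,?_,?_,?_,?_⟩,⟨?_,?_,?_,?_,?_,?_⟩,⟨?_,?_,?_,?_,?_⟩,⟨?_,?_,?_,?_⟩,⟨?_,?_,?_⟩,⟨?_,?_⟩,?_⟩ <;>
      first | assumption | (apply Ne.symm; assumption)
  have hsub : [a,b,c,d,a',b',c',d'].toFinset ⊆ D := by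
    intro x hx
    simp only [List.mem_toFinset, List.mem_cons, List.not_mem_nil, or_false] at hx
    rcases hx with rfl | rfl | rfl | rfl | rfl | rfl | rfl | rfl <;> assumption
  have := card_le_card hsub
  rw [List.toFinset_card_of_nodup hnd] at this
  simpa using this

lemma altChord (h : Cx G W m) {a b c d : V} (hbd : b ≠ d)
    (gab : G.Adj a b) (gbc : G.Adj b c) (gcd : G.Adj c d) (gda : G.Adj d a) (gac : G.Adj a c)
    (m1 : m a = b) (m2 : m c = d) : b ∈ cpt (fg G m) a ∧ c ∈ cpt (fg G m) a ∧ d ∈ cpt (fg G m) a ∧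
      8 ≤ (cpt (fg G m) a).card := by
  have haW : a ∈ W := (h.cub.adj_mem gab).1
  have hcW : c ∈ W := (h.cub.adj_mem gcd).1
  have hbW : b ∈ W := (h.cub.adj_mem gab).2
  have hdW : d ∈ W := (h.cub.adj_mem gcd).2
  have mb : m b = a := by rw [← m1, h.inv a haW]
  have md : m d = c := by rw [← m2, h.inv c hcW]
  have fac : (fg G m).Adj a c := h.fadj.2 ⟨gac, by rw [m1]; exact gbc.ne⟩
  have fad : (fg G m).Adj a d := h.fadj.2 ⟨gda.symm, by rw [m1]; exact hbd⟩
  have fcb : (fg G m).Adj c b := h.fadj.2 ⟨gbc.symm, by rw [m2]; exact hbd.symm⟩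
  have nFa := h.d2.of2 fac fad gcd.ne
  have nFc := h.d2.of2 fac.symm fcb gab.ne
  obtain ⟨b', fbb', hb'c⟩ : ∃ b', (fg G m).Adj b b' ∧ b' ≠ c := by
    obtain ⟨p, q, hpq, -, -, -, hn⟩ := h.n3 hbW
    by_cases hp : p = c
    · exact ⟨q, (hn q).2 (Or.inr rfl), fun hh => hpq (hp.trans hh.symm)⟩
    · exact ⟨p, (hn p).2 (Or.inl rfl), hp⟩
  obtain ⟨d', fdd', hd'a⟩ : ∃ d', (fg G m).Adj d d' ∧ d' ≠ a := by
    obtain ⟨p, q, hpq, -, -, -, hn⟩ := h.n3 hdW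
    by_cases hp : p = a
    · exact ⟨q, (hn q).2 (Or.inr rfl), fun hh => hpq (hp.trans hh.symm)⟩
    · exact ⟨p, (hn p).2 (Or.inl rfl), hp⟩
  have nFb := h.d2.of2 fcb.symm fbb' hb'c.symm
  have nFd := h.d2.of2 fad.symm fdd' hd'a.symm
  have hb'a : b' ≠ a := by rintro rfl; exact fbb'.2.1 mb
  have hd'c : d' ≠ c := by rintro rfl; exact fdd'.2.1 md
  set D := cpt (fg G m) a with hD
  have hFC : FC (fg G m) D := cmp_FC
  have aD : a ∈ D := self_mem_cmp
  have cD : c ∈ D := hFC _ _ aD fac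
  have dD : d ∈ D := hFC _ _ aD fad
  have bD : b ∈ D := hFC _ _ cD fcb
  have b'D : b' ∈ D := hFC _ _ bD fbb'
  have d'D : d' ∈ D := hFC _ _ dD fdd'
  have e1 := gab.ne; have e2 := gbc.ne; have e3 := gcd.ne; have e4 := gda.ne; have e5 := gac.ne
  have e6 := fbb'.ne; have e7 := fdd'.ne
  have hout := h.out haW
  rw [← hD] at hout
  refine ⟨bD, cD, dD, ?_⟩
  have fb'b := fbb'.symm
  have fd'd := fdd'.symm
  have hb'd : b' ≠ d := by
    rintro rfl
    have hcl : FC (fg G m) {a,b,c,b'} := by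
      intro x y hx hxy
      simp only [mem_insert, mem_singleton] at hx ⊢
      rcases hx with rfl | rfl | rfl | rfl
      · rw [nFa] at hxy; tauto
      · rw [nFb] at hxy; tauto
      · rw [nFc] at hxy; tauto
      · rw [h.d2.of2 fad.symm fb'b e1] at hxy; tauto
    have hs := hcl.cmp_sub (u := a) (by simp)
    have : (D.filter (fun u => m u ∉ D)) = ∅ := by
      ext x; rw [mem_filter]
      constructor
      · rintro ⟨hx, hmx⟩
        exfalso; apply hmx
        have := hs hx
        simp only [mem_insert, mem_singleton] at this
        rcases this with rfl | rfl | rfl | rfl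
        · rwa [m1]
        · rwa [mb]
        · rwa [m2]
        · rwa [md]
      · intro hh; simp at hh
    rw [this] at hout; simp at hout
  have hd'b : d' ≠ b := by
    rintro rfl
    rw [nFb] at fd'd
    grind
  have hb'd' : b' ≠ d' := by
    intro hbd'
    rw [← hbd'] at fdd' fd'd d'D hd'a hd'c hd'b e7 nFd
    have nb' := h.d2.of2 fb'b fd'd hbd
    have hcl : FC (fg G m) {a,b,c,d,b'} := by
      intro x y hx hxy
      simp only [mem_insert, mem_singleton] at hx ⊢
      rcases hx with rfl | rfl | rfl | rfl | rfl
      · rw [nFa] at hxy; tauto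
      · rw [nFb] at hxy; tauto
      · rw [nFc] at hxy; tauto
      · rw [nFd] at hxy; tauto
      · rw [nb'] at hxy; tauto
    have hs := hcl.cmp_sub (u := a) (by simp)
    have hnd : [a,b,c,d,b'].Nodup := by
      simp only [List.nodup_cons, List.mem_cons, List.not_mem_nil, or_false, not_or, List.nodup_nil, and_true, not_false_eq_true]
      grind
    have hDe : D = [a,b,c,d,b'].toFinset := by
      ext x; constructor
      · intro hx; have := hs hx; simpa using this
      · intro hx
        simp only [List.mem_toFinset, List.mem_cons, List.not_mem_nil, or_false] at hx
        rcases hx with rfl | rfl | rfl | rfl | rfl <;> assumption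
    have := congrArg card hDe
    rw [List.toFinset_card_of_nodup hnd] at this
    exact h.n5 a haW (by rw [← hD, this]; rfl)
  have hnd : [a,b,c,d,b',d'].Nodup := by
    simp only [List.nodup_cons, List.mem_cons, List.not_mem_nil, or_false, not_or, List.nodup_nil, and_true, not_false_eq_true]
    grind
  have hsub : [a,b,c,d,b',d'].toFinset ⊆ D := by
    intro x hx
    simp only [List.mem_toFinset, List.mem_cons, List.not_mem_nil, or_false] at hx
    rcases hx with rfl | rfl | rfl | rfl | rfl | rfl <;> assumption
  have hc6 := card_le_card hsub
  rw [List.toFinset_card_of_nodup hnd] at hc6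
  simp only [List.length_cons, List.length_nil] at hc6
  have hout4 : (D.filter (fun u => m u ∉ D)).card + 4 ≤ D.card := by
    have h4 : [a,b,c,d].Nodup := by
      simp only [List.nodup_cons, List.mem_cons, List.not_mem_nil, or_false, not_or, List.nodup_nil, and_true, not_false_eq_true]
      grind
    have hdis : Disjoint (D.filter (fun u => m u ∉ D)) [a,b,c,d].toFinset := by
      rw [Finset.disjoint_left]
      intro x hx hx'
      rw [mem_filter] at hx
      simp only [List.mem_toFinset, List.mem_cons, List.not_mem_nil, or_false] at hx'
      apply hx.2
      rcases hx' with rfl | rfl | rfl | rfl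
      · rwa [m1]
      · rwa [mb]
      · rwa [m2]
      · rwa [md]
    have hu : (D.filter (fun u => m u ∉ D)) ∪ [a,b,c,d].toFinset ⊆ D := by
      apply union_subset (filter_subset _ _)
      intro x hx'
      simp only [List.mem_toFinset, List.mem_cons, List.not_mem_nil, or_false] at hx'
      rcases hx' with rfl | rfl | rfl | rfl <;> assumption
    have := card_le_card hu
    rw [card_union_of_disjoint hdis, List.toFinset_card_of_nodup h4] at this
    simpa using this
  by_contra hlt
  have h6 : D.card = 6 := by
    by_contra h6
    have h7 : D.card = 7 := by omega
    rw [h7] at hout hout4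
    omega
  -- D = the six vertices
  have hDe : D = [a,b,c,d,b',d'].toFinset := by
    symm; apply eq_of_subset_of_card_le hsub
    rw [List.toFinset_card_of_nodup hnd, h6]; rfl
  have hb'W := h.cmp_sub haW b'D
  have hd'W := h.cmp_sub haW d'D
  have fbd' : (fg G m).Adj b' d' := by
    obtain ⟨p, q, hpq, hp, hq, -, hn⟩ := h.n3 hb'W
    obtain ⟨r, fr, hrb⟩ : ∃ r, (fg G m).Adj b' r ∧ r ≠ b := by
      by_cases hp : p = b
      · exact ⟨q, (hn q).2 (Or.inr rfl), fun hh => hpq (hp.trans hh.symm)⟩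
      · exact ⟨p, (hn p).2 (Or.inl rfl), hp⟩
    have hr := hFC _ _ b'D fr
    rw [hDe] at hr
    simp only [List.mem_toFinset, List.mem_cons, List.not_mem_nil, or_false] at hr
    rcases hr with rfl | rfl | rfl | rfl | rfl | rfl
    · have := (nFa _).1 fr.symm; grind
    · exact absurd rfl hrb
    · have := (nFc _).1 fr.symm; grind
    · have := (nFd _).1 fr.symm; grind
    · exact absurd rfl fr.ne
    · exact fr
  have gmb := h.adj _ hb'W
  have gmd := h.adj _ hd'W
  have k1 : m b' ≠ a := fun hh => hb'a.symm (by have := h.inv _ hb'W; rw [hh, m1] at this; exact absurd this e6)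
  have k2 : m b' ≠ b := fun hh => by have := h.inv _ hb'W; rw [hh, mb] at this; exact hb'a this.symm
  have k3 : m b' ≠ c := fun hh => by have := h.inv _ hb'W; rw [hh, m2] at this; exact hb'd this.symm
  have k4 : m b' ≠ d := fun hh => by have := h.inv _ hb'W; rw [hh, md] at this; exact hb'c this.symm
  have k5 : m d' ≠ a := fun hh => by have := h.inv _ hd'W; rw [hh, m1] at this; exact hd'b this.symm
  have k6 : m d' ≠ b := fun hh => by have := h.inv _ hd'W; rw [hh, mb] at this; exact hd'a this.symm
  have k7 : m d' ≠ c := fun hh => by have := h.inv _ hd'W; rw [hh, m2] at this; exact e7 this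
  have k8 : m d' ≠ d := fun hh => by have := h.inv _ hd'W; rw [hh, md] at this; exact hd'c this.symm
  have k9 : m b' ≠ d' := fbd'.2.1
  have k10 : m d' ≠ b' := fbd'.2.2
  refine h.n6 b a d c b' d' (m b') (m d') ⟨?_, ?_, ?_, ?_, ?_, ?_, hbd, hd'b.symm, hb'd.symm, hb'a, hb'c, hd'a, hd'c,
    k2, k1, k4, k3, k9, k6, k5, k8, k7, k10⟩
  · exact N3.of3 (h.cub.deg b hbW) gab.symm gbc fbb'.1 e5 hb'a.symm hb'c.symm
  · exact N3.of3 (h.cub.deg a haW) gab gda.symm gac hbd e2 e3.symm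
  · exact N3.of3 (h.cub.deg d hdW) gda gcd.symm fdd'.1 e5 hd'a.symm hd'c.symm
  · exact N3.of3 (h.cub.deg c hcW) gbc.symm gcd gac.symm hbd e1.symm e4
  · exact N3.of3 (h.cub.deg b' hb'W) fbb'.1.symm fbd'.1 gmb hd'b.symm k2.symm k9.symm
  · exact N3.of3 (h.cub.deg d' hd'W) fdd'.1.symm fbd'.1.symm gmd hb'd.symm k8.symm k10.symm

lemma alt (h : Cx G W m) {a b c d : V} (hq : IQ G W a b c d)
    (m1 : m a = b) (m2 : m c = d) : b ∈ cpt (fg G m) a ∧ c ∈ cpt (fg G m) a ∧ d ∈ cpt (fg G m) a ∧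
      8 ≤ (cpt (fg G m) a).card := by
  have hb := hq.basic
  have haW := (h.cub.adj_mem hb.2.2.1).1
  have hcW := (h.cub.adj_mem hb.2.2.2.2.1).1
  have mb : m b = a := by rw [← m1, h.inv a haW]
  have md : m d = c := by rw [← m2, h.inv c hcW]
  have conv : (a ∈ cpt (fg G m) b ∧ d ∈ cpt (fg G m) b ∧ c ∈ cpt (fg G m) b ∧ 8 ≤ (cpt (fg G m) b).card) →
    b ∈ cpt (fg G m) a ∧ c ∈ cpt (fg G m) a ∧ d ∈ cpt (fg G m) a ∧ 8 ≤ (cpt (fg G m) a).card := by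
    rintro ⟨h1, h2, h3, h4⟩
    rw [cmp_eq h1]
    exact ⟨self_mem_cmp, h3, h2, h4⟩
  rcases hq with ⟨h1, h2, h3, h4, h5, h6, h7⟩ | ⟨a', b', c', d', hq, hs⟩
  · rcases h7 with h7 | h7
    · exact h.altChord h2 h3 h4 h5 h6 h7 m1 m2
    · exact conv (h.altChord h1 h3.symm h6.symm h5.symm h4.symm h7 mb md)
  · rcases hs with hs | hs
    · exact h.altSep hq hs m1 m2
    · exact conv (h.altSep hq.flip hs.flip mb md)

lemma runiq (h : Cx G W m) {v r s : V} (hr : IQ G W v (m v) r (m r)) (hs : IQ G W v (m v) s (m s)) : r = s := by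
  by_contra hrs
  have hc8 := (h.alt hr rfl rfl).2.2.2
  obtain ⟨r1, r2, r3, r4, r5, r6⟩ := hr.basic
  obtain ⟨s1, s2, s3, s4, s5, s6⟩ := hs.basic
  have vW := (h.cub.adj_mem r3).1
  have mvW := (h.cub.adj_mem r3).2
  have rW := (h.cub.adj_mem r5).1
  have sW := (h.cub.adj_mem s5).1
  have nv := N3.of3 (h.cub.deg v vW) r3 r6.symm s6.symm r2 s2 (fun e => hrs (h.inj rW sW e))
  have nmv := N3.of3 (h.cub.deg (m v) mvW) r3.symm r4 s4 r1 s1 hrs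
  have small : s = m r → False := by
    intro e
    have ms : m s = r := by rw [e, h.inv r rW]
    rw [← e] at r6 r5 nv
    rw [ms] at s6 nv
    have g1 : G.Adj v r := s6.symm
    have nr := N3.of3 (h.cub.deg r rW) r4.symm r5 g1.symm (fun e => s2 (by rw [ms]; exact absurd e (by grind))) (r3.ne.symm) s1.symm
    have ns := N3.of3 (h.cub.deg s sW) s4.symm r6 r5.symm r3.ne.symm r4.ne r1
    have hcl : FC (fg G m) {v, m v, r, s} := by
      intro x y hx hxy
      simp only [mem_insert, mem_singleton] at hx ⊢
      have hxy := hxy.1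
      rcases hx with rfl | rfl | rfl | rfl
      · rw [nv] at hxy; tauto
      · rw [nmv] at hxy; tauto
      · rw [nr] at hxy; tauto
      · rw [ns] at hxy; tauto
    have h1 := card_le_card (hcl.cmp_sub (u := v) (by simp))
    have h2 : ({v, m v, r, s} : Finset V).card ≤ 4 := card_le_four
    omega
  rcases hr with ⟨-, -, -, -, -, -, h7⟩ | ⟨a', b', c', d', hq, hs'⟩
  · rcases h7 with h7 | h7
    · rw [nv] at h7
      rcases h7 with e | e | e
      · exact r4.ne e.symm
      · exact r5.ne e
      · exact small (by rw [e, h.inv s sW])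
    · rw [nmv] at h7
      rcases h7 with e | e | e
      · exact r6.ne e
      · exact r5.ne e.symm
      · exact small e.symm
  · have e1 : a' = m s := by
      have := (nv a').1 ((hq.na a').2 (by simp))
      have := hq.a1; have := hq.a3; grind
    have e2 : b' = s := by
      have := (nmv b').1 ((hq.nb b').2 (by simp))
      have := hq.b1; have := hq.b2; grind
    have gab : G.Adj a' b' := by rw [e1, e2]; exact s5.symm
    have key : ∀ {a b c d a' b' c' d' : V}, Q4 G a b c d a' b' c' d' → SepP G W a b c d a' c' → ¬ G.Adj a' b' := by
      rintro a b c d a' b' c' d' hq ⟨A, hAW, hA1, hA2, hA3, hA4, ha', hc', hA⟩ gab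
      have gab2 : G.Adj a b := (hq.na b).2 (by simp)
      have gcb2 : G.Adj c b := (hq.nc b).2 (by simp)
      by_cases hb : b' ∈ A
      · have gbb : G.Adj b b' := (hq.nb b').2 (by simp)
        have := hq.cross hA1 hA3 ha' hc' hA hb hA2 gbb.symm
        have := gab2.ne; have := gcb2.ne
        grind
      · have := hq.cross hA1 hA3 ha' hc' hA ha' hb gab
        have := hq.b1; have := hq.b2; grind
    rcases hs' with hs' | hs'
    · exact key hq hs' gab
    · exact key hq.flip hs'.flip gab.symm

end Cx
end K3

set_option linter.unusedSectionVars false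
set_option linter.unusedVariables false
set_option linter.unusedSimpArgs false

section K4
variable {V : Type*} [Fintype V] [DecidableEq V]
open Finset

open Classical in
noncomputable def QS (G : SimpleGraph V) (W : Finset V) : Finset (Fin 4 → V) :=
  univ.filter (fun Z => IQ G W (Z 0) (Z 1) (Z 2) (Z 3))

lemma mem_QS {G : SimpleGraph V} {W : Finset V} {Z : Fin 4 → V} : Z ∈ QS G W ↔ IQ G W (Z 0) (Z 1) (Z 2) (Z 3) := by
  simp [QS]

/-- six-cycles with the no-common-neighbour property -/
def I6 (G : SimpleGraph V) (Z : Fin 6 → V) : Prop :=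
  Function.Injective Z ∧ (∀ i, G.Adj (Z i) (Z (i+1))) ∧
    ∀ i x, (∀ j, x ≠ Z j) → ¬ (G.Adj x (Z i) ∧ G.Adj x (Z (i+1)))

open Classical in
noncomputable def ZS (G : SimpleGraph V) : Finset (Fin 6 → V) := univ.filter (fun Z => I6 G Z)

lemma mem_ZS {G : SimpleGraph V} {Z : Fin 6 → V} : Z ∈ ZS G ↔ I6 G Z := by
  simp [ZS]

open Classical in
noncomputable def LQ (G : SimpleGraph V) (W : Finset V) (m : V → V) : Finset V :=
  W.filter (fun v => ∃ r, IQ G W v (m v) r (m r))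

lemma QS_adj {G : SimpleGraph V} {W : Finset V} : ∀ Z ∈ QS G W, ∀ i, G.Adj (Z i) (Z (i+1)) := by
  intro Z hZ i
  obtain ⟨h1, h2, h3, h4, h5, h6⟩ := (mem_QS.1 hZ).basic
  fin_cases i
  · exact h3
  · exact h4
  · exact h5
  · exact h6

lemma QS_inj {G : SimpleGraph V} {W : Finset V} : ∀ Z ∈ QS G W, Function.Injective Z := by
  intro Z hZ i j e
  obtain ⟨h1, h2, h3, h4, h5, h6⟩ := (mem_QS.1 hZ).basic
  have h3 := h3.ne; have h4 := h4.ne; have h5 := h5.ne; have h6 := h6.ne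
  fin_cases i <;> fin_cases j <;> simp at e ⊢ <;> grind

lemma mu_zero {n : ℕ} [NeZero n] {G : SimpleGraph V} {m : V → V} {Z : Fin n → V} (h : ∀ i, (fg G m).Adj (Z i) (Z (i+1))) :
    mu m Z = 0 := by
  unfold mu
  exact sum_eq_zero fun i _ => if_neg (h i).2.1

noncomputable def NC (G : SimpleGraph V) (W : Finset V) (m : V → V) (k : ℕ) : Finset V :=
  W.filter (fun v => (cpt (fg G m) v).card = k)

namespace Cx
variable {G : SimpleGraph V} {W : Finset V} {m : V → V}

open Classical in
lemma q2_le (h : Cx G W m) :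
    ((QS G W).filter (fun Z => (m (Z 0) = Z 1 ∧ m (Z 2) = Z 3) ∨ (m (Z 1) = Z 2 ∧ m (Z 3) = Z 0))).card ≤ 2 * (LQ G W m).card := by
  have key : ∀ Z : Fin 4 → V, IQ G W (Z 0) (Z 1) (Z 2) (Z 3) → (m (Z 0) = Z 1 ∧ m (Z 2) = Z 3) ∨ (m (Z 1) = Z 2 ∧ m (Z 3) = Z 0) →
     IQ G W (Z 0) (m (Z 0)) (Z 2) (m (Z 2)) ∧ ((m (Z 0) = Z 1 ∧ Z 3 = m (Z 2)) ∨ (m (Z 0) ≠ Z 1 ∧ Z 3 = m (Z 0) ∧ Z 1 = m (Z 2))) := by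
    intro Z hZ ha
    have hb := hZ.basic
    rcases ha with ⟨a1, a2⟩ | ⟨a1, a2⟩
    · exact ⟨by rw [a1, a2]; exact hZ, Or.inl ⟨a1, a2.symm⟩⟩
    · have w1 := (h.cub.adj_mem hb.2.2.1).2
      have w3 := (h.cub.adj_mem hb.2.2.2.2.1).2
      have b1 : m (Z 2) = Z 1 := by rw [← a1, h.inv _ w1]
      have b2 : m (Z 0) = Z 3 := by rw [← a2, h.inv _ w3]
      exact ⟨by rw [b1, b2]; exact hZ.refl', Or.inr ⟨by rw [b2]; exact hb.2.1.symm, b2.symm, b1.symm⟩⟩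
  have hcard : ((LQ G W m) ×ˢ (univ : Finset Bool)).card = 2 * (LQ G W m).card := by
    rw [card_product]; simp [mul_comm]
  rw [← hcard]
  apply card_le_card_of_injOn (fun Z => (Z 0, decide (m (Z 0) = Z 1)))
  · intro Z hZ
    rw [mem_coe, mem_filter, mem_QS] at hZ
    rw [mem_coe, mem_product]
    refine ⟨?_, mem_univ _⟩
    obtain ⟨k1, k2⟩ := key Z hZ.1 hZ.2
    unfold LQ
    rw [mem_filter]
    exact ⟨(h.cub.adj_mem k1.basic.2.2.1).1, _, k1⟩
  · intro Z hZ Z' hZ' e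
    rw [mem_coe, mem_filter, mem_QS] at hZ hZ'
    obtain ⟨k1, k2⟩ := key Z hZ.1 hZ.2
    obtain ⟨k1', k2'⟩ := key Z' hZ'.1 hZ'.2
    simp only [Prod.mk.injEq] at e
    obtain ⟨e0, e1⟩ := e
    rw [← e0] at k1' k2' e1
    have e2 := h.runiq k1 k1'
    rw [← e2] at k2'
    have e1' : (m (Z 0) = Z 1) ↔ (m (Z 0) = Z' 1) := by simpa using e1
    clear key hZ hZ'
    funext i
    fin_cases i
    · exact e0
    · show Z 1 = Z' 1; clear k1 k1'; grind
    · exact e2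
    · show Z 3 = Z' 3; clear k1 k1'; grind

lemma iq_comp (h : Cx G W m) {a b c d : V} (fab : (fg G m).Adj a b) (fbc : (fg G m).Adj b c) (fcd : (fg G m).Adj c d)
    (fda : (fg G m).Adj d a) (ac : a ≠ c) (bd : b ≠ d) : IQ G W a b c d := by
  have aW := (h.cub.adj_mem fab.1).1
  have bW := (h.cub.adj_mem fbc.1).1
  have cW := (h.cub.adj_mem fcd.1).1
  have dW := (h.cub.adj_mem fda.1).1
  by_cases h1 : m a = c
  · exact Or.inl ⟨ac, bd, fab.1, fbc.1, fcd.1, fda.1, Or.inl (by rw [← h1]; exact h.adj a aW)⟩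
  by_cases h2 : m b = d
  · exact Or.inl ⟨ac, bd, fab.1, fbc.1, fcd.1, fda.1, Or.inr (by rw [← h2]; exact h.adj b bW)⟩
  have h3 : m c ≠ a := fun e => h1 (by rw [← e, h.inv c cW])
  have h4 : m d ≠ b := fun e => h2 (by rw [← e, h.inv d dW])
  have hq : Q4 G a b c d (m a) (m b) (m c) (m d) := by
    refine ⟨?_, ?_, ?_, ?_, ac, bd, fab.2.1, h1, fda.2.2, fab.2.2, fbc.2.1, h2, h3, fbc.2.2, fcd.2.1, fda.2.1, h4, fcd.2.2,
      fun e => ac (h.inj aW cW e), fun e => bd (h.inj bW dW e)⟩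
    · exact N3.of3 (h.cub.deg a aW) fab.1 fda.1.symm (h.adj a aW) bd fab.2.1.symm fda.2.2.symm
    · exact N3.of3 (h.cub.deg b bW) fab.1.symm fbc.1 (h.adj b bW) ac fab.2.2.symm fbc.2.1.symm
    · exact N3.of3 (h.cub.deg c cW) fbc.1.symm fcd.1 (h.adj c cW) bd fbc.2.2.symm fcd.2.1.symm
    · exact N3.of3 (h.cub.deg d dW) fda.1 fcd.1.symm (h.adj d dW) ac fda.2.1.symm fcd.2.2.symm
  exact Or.inr ⟨_, _, _, _, hq, h.n4 _ _ _ _ _ _ _ _ hq⟩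

lemma q0_ge (h : Cx G W m) : 2 * (NC G W m 4).card ≤ ((QS G W).filter (fun Z => mu m Z = 0)).card := by
  have hf : ∀ Z ∈ (QS G W).filter (fun Z => mu m Z = 0), Z 0 ∈ (univ : Finset V) := fun _ _ => mem_univ _
  rw [card_eq_sum_card_fiberwise hf]
  have h1 : ∑ v ∈ NC G W m 4, 2 ≤ ∑ v ∈ NC G W m 4, (((QS G W).filter (fun Z => mu m Z = 0)).filter (fun Z => Z 0 = v)).card := by
    apply sum_le_sum
    intro v hv
    unfold NC at hv; rw [mem_filter] at hv
    obtain ⟨p, q, hpq, -, -, -, hn⟩ := h.n3 hv.1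
    have fvp := (hn p).2 (Or.inl rfl)
    obtain ⟨l, hnd, hch, hm, hl, -⟩ := h.d2.cyl fvp
    rw [hv.2] at hl
    obtain ⟨x, y, rfl⟩ : ∃ x y, l = [x, y] := by
      match l, hl with
      | [x, y], _ => exact ⟨x, y, rfl⟩
    simp only [List.cons_append, List.nil_append, List.nodup_cons, List.mem_cons, List.not_mem_nil, or_false, not_or, List.nodup_nil, and_true, not_false_eq_true] at hnd
    simp only [List.cons_append, List.nil_append, List.isChain_cons_cons, List.isChain_singleton, and_true] at hch
    obtain ⟨c1, c2, c3⟩ := hch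
    have A : ![v,x,y,p] ∈ ((QS G W).filter (fun Z => mu m Z = 0)).filter (fun Z => Z 0 = v) := by
      rw [mem_filter, mem_filter, mem_QS]
      refine ⟨⟨h.iq_comp c1 c2 c3 fvp.symm hnd.1.2.1 hnd.2.1.2, mu_zero (G := G) ?_⟩, rfl⟩
      intro i; fin_cases i
      · exact c1
      · exact c2
      · exact c3
      · exact fvp.symm
    have B : ![v,p,y,x] ∈ ((QS G W).filter (fun Z => mu m Z = 0)).filter (fun Z => Z 0 = v) := by
      rw [mem_filter, mem_filter, mem_QS]
      refine ⟨⟨h.iq_comp fvp c3.symm c2.symm c1.symm hnd.1.2.1 (Ne.symm hnd.2.1.2), mu_zero (G := G) ?_⟩, rfl⟩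
      intro i; fin_cases i
      · exact fvp
      · exact c3.symm
      · exact c2.symm
      · exact c1.symm
    have hne : ![v,x,y,p] ≠ ![v,p,y,x] := by
      intro e
      have := congrFun e 1
      exact hnd.2.1.2 this
    exact one_lt_card.2 ⟨_, A, _, B, hne⟩
  have h2 := sum_le_sum_of_subset (f := fun v => (((QS G W).filter (fun Z => mu m Z = 0)).filter (fun Z => Z 0 = v)).card) (subset_univ (NC G W m 4))
  simp only [sum_const, smul_eq_mul] at h1
  linarith

lemma z0_ge (h : Cx G W m) : (NC G W m 6).card ≤ ((ZS G).filter (fun Z => mu m Z = 0)).card := by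
  have hf : ∀ Z ∈ (ZS G).filter (fun Z => mu m Z = 0), Z 0 ∈ (univ : Finset V) := fun _ _ => mem_univ _
  rw [card_eq_sum_card_fiberwise hf]
  have h1 : ∑ v ∈ NC G W m 6, 1 ≤ ∑ v ∈ NC G W m 6, (((ZS G).filter (fun Z => mu m Z = 0)).filter (fun Z => Z 0 = v)).card := by
    apply sum_le_sum
    intro v hv
    unfold NC at hv; rw [mem_filter] at hv
    obtain ⟨p, q, hpq, -, -, -, hn⟩ := h.n3 hv.1
    have fvp := (hn p).2 (Or.inl rfl)
    obtain ⟨l, hnd, hch, hm, hl, -⟩ := h.d2.cyl fvp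
    rw [hv.2] at hl
    obtain ⟨x, y, z, w, rfl⟩ : ∃ x y z w, l = [x, y, z, w] := by
      match l, hl with
      | [x, y, z, w], _ => exact ⟨x, y, z, w, rfl⟩
    simp only [List.cons_append, List.nil_append] at hnd hch hm
    have hnd' := hnd
    simp only [List.isChain_cons_cons, List.isChain_singleton, and_true] at hch
    simp only [List.mem_cons, List.not_mem_nil, or_false] at hm
    obtain ⟨c1, c2, c3, c4, c5⟩ := hch
    have hF : ∀ i, (fg G m).Adj (![v,x,y,z,w,p] i) (![v,x,y,z,w,p] (i+1)) := by
      intro i; fin_cases i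
      · exact c1
      · exact c2
      · exact c3
      · exact c4
      · exact c5
      · exact fvp.symm
    have hmem : ∀ u, u ∈ cpt (fg G m) v → ∃ j, u = ![v,x,y,z,w,p] j := by
      intro u hu
      rw [← hm] at hu
      rcases hu with e | e | e | e | e | e
      · exact ⟨0, e⟩
      · exact ⟨1, e⟩
      · exact ⟨2, e⟩
      · exact ⟨3, e⟩
      · exact ⟨4, e⟩
      · exact ⟨5, e⟩
    have hmem' : ∀ j, ![v,x,y,z,w,p] j ∈ cpt (fg G m) v := by
      intro j
      rw [← hm]
      fin_cases j <;> simp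
    have hinj : Function.Injective ![v,x,y,z,w,p] := by
      have : ![v,x,y,z,w,p] = [v,x,y,z,w,p].get := by
        funext i; fin_cases i <;> rfl
      rw [this]
      exact List.nodup_iff_injective_get.1 hnd'
    generalize hZ : ![v,x,y,z,w,p] = Z at *
    have hm1 : ∀ u i, (∀ j, u ≠ Z j) → G.Adj u (Z i) → m (Z i) = u := by
      intro u i hu hua
      by_contra hne
      obtain ⟨j, hj⟩ := hmem u (cmp_FC _ _ (hmem' i) (h.fadj.2 ⟨hua.symm, hne⟩))
      exact hu j hj
    refine card_pos.2 ⟨Z, ?_⟩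
    rw [mem_filter, mem_filter, mem_ZS]
    refine ⟨⟨⟨hinj, fun i => (hF i).1, ?_⟩, mu_zero hF⟩, by rw [← hZ]; rfl⟩
    rintro i u hu ⟨g1, g2⟩
    have := h.inj (h.cub.adj_mem g1).2 (h.cub.adj_mem g2).2 ((hm1 _ _ hu g1).trans (hm1 _ _ hu g2).symm)
    exact (hF i).1.ne this
  have h2 := sum_le_sum_of_subset (f := fun v => (((ZS G).filter (fun Z => mu m Z = 0)).filter (fun Z => Z 0 = v)).card) (subset_univ (NC G W m 6))
  simp only [sum_const, smul_eq_mul] at h1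
  linarith

end Cx
end K4

set_option linter.unusedSectionVars false
set_option linter.unusedVariables false
set_option linter.unusedSimpArgs false

section K5
variable {V : Type*} [Fintype V] [DecidableEq V]
open Finset

noncomputable def CS (G : SimpleGraph V) (W : Finset V) (m : V → V) : Finset (Finset V) :=
  W.image (cpt (fg G m))

noncomputable def NB (G : SimpleGraph V) (W : Finset V) (m : V → V) : Finset V :=
  W.filter (fun v => 7 ≤ (cpt (fg G m) v).card)

namespace Cx
variable {G : SimpleGraph V} {W : Finset V} {m : V → V}

lemma fib (h : Cx G W m) (X : Finset V) (hX : X ⊆ W) : X.card = ∑ D ∈ CS G W m, (D ∩ X).card := by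
  have hf : ∀ x ∈ X, cpt (fg G m) x ∈ CS G W m := fun x hx => mem_image_of_mem _ (hX hx)
  rw [card_eq_sum_card_fiberwise hf]
  refine sum_congr rfl fun D hD => ?_
  congr 1
  ext x
  rw [mem_filter, mem_inter]
  unfold CS at hD
  rw [mem_image] at hD
  obtain ⟨v, hv, rfl⟩ := hD
  constructor
  · rintro ⟨h1, h2⟩; exact ⟨h2 ▸ self_mem_cmp, h1⟩
  · rintro ⟨h1, h2⟩; exact ⟨h2, cmp_eq h1⟩

lemma LQ_facts (h : Cx G W m) {v : V} (hv : v ∈ LQ G W m) : v ∈ W ∧ 8 ≤ (cpt (fg G m) v).card ∧ m v ∈ cpt (fg G m) v := by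
  classical
  unfold LQ at hv
  rw [mem_filter] at hv
  obtain ⟨hv, r, hr⟩ := hv
  have := h.alt hr rfl rfl
  exact ⟨hv, this.2.2.2, this.1⟩

lemma LQ_sub (h : Cx G W m) : LQ G W m ⊆ NB G W m := by
  intro v hv
  have := h.LQ_facts hv
  unfold NB; rw [mem_filter]; exact ⟨this.1, by omega⟩

lemma card_cases (h : Cx G W m) {v : V} (hv : v ∈ W) : (cpt (fg G m) v).card = 4 ∨ (cpt (fg G m) v).card = 6 ∨ 7 ≤ (cpt (fg G m) v).card := by
  have := h.card_ge4 hv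
  have := h.n5 v hv
  omega

lemma acc (h : Cx G W m) : 192 * (CS G W m).card + 8 * (LQ G W m).card + (NB G W m).card ≤ 32 * W.card + 16 * (NC G W m 4).card := by
  have e1 := h.fib (LQ G W m) (fun v hv => (h.LQ_facts hv).1)
  have e2 := h.fib (NB G W m) (filter_subset _ _)
  have e3 := h.fib W (Subset.refl _)
  have e4 := h.fib (NC G W m 4) (filter_subset _ _)
  have key : ∀ D ∈ CS G W m, 192 + 8 * (D ∩ LQ G W m).card + (D ∩ NB G W m).card ≤ 32 * (D ∩ W).card + 16 * (D ∩ NC G W m 4).card := by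
    intro D hD
    unfold CS at hD
    rw [mem_image] at hD
    obtain ⟨v, hv, rfl⟩ := hD
    set D := cpt (fg G m) v with hD
    have hDW : D ∩ W = D := inter_eq_left.2 (h.cmp_sub hv)
    rw [hDW]
    have hsame : ∀ x ∈ D, (cpt (fg G m) x).card = D.card := fun x hx => by rw [cmp_eq hx]
    have l1 : (D ∩ LQ G W m).card ≤ D.card := card_le_card inter_subset_left
    have l2 : (D ∩ NB G W m).card ≤ D.card := card_le_card inter_subset_left
    have l3 : D.card < 8 → (D ∩ LQ G W m).card = 0 := by
      intro hlt
      rw [card_eq_zero, eq_empty_iff_forall_notMem]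
      intro x hx
      rw [mem_inter] at hx
      have := (h.LQ_facts hx.2).2.1
      rw [hsame x hx.1] at this; omega
    have l4 : D.card < 7 → (D ∩ NB G W m).card = 0 := by
      intro hlt
      rw [card_eq_zero, eq_empty_iff_forall_notMem]
      intro x hx
      unfold NB at hx
      rw [mem_inter, mem_filter] at hx
      have := hx.2.2
      rw [hsame x hx.1] at this; omega
    have l5 : D.card = 4 → (D ∩ NC G W m 4).card = 4 := by
      intro h4
      rw [← h4]; congr 1
      rw [inter_eq_left]
      intro x hx
      unfold NC
      rw [mem_filter]
      exact ⟨h.cmp_sub hv hx, by rw [hsame x hx]⟩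
    have l6 : (D ∩ LQ G W m).card < D.card := by
      rcases lt_or_eq_of_le l1 with hl | hl
      · exact hl
      · exfalso
        have heq : D ∩ LQ G W m = D := eq_of_subset_of_card_le inter_subset_left hl.ge
        have ho := h.out hv
        rw [← hD] at ho
        have : (D.filter (fun u => m u ∉ D)) = ∅ := by
          rw [filter_eq_empty_iff]
          intro x hx hmx
          rw [← heq, mem_inter] at hx
          have := (h.LQ_facts hx.2).2.2
          rw [cmp_eq hx.1] at this
          exact hmx this
        rw [this] at ho
        simp at ho
    have hc := h.card_cases hv
    rw [← hD] at hc
    rcases hc with hc | hc | hc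
    · have := l3 (by omega); have := l4 (by omega); have := l5 hc; omega
    · have := l3 (by omega); have := l4 (by omega); omega
    · by_cases h8 : D.card < 8
      · have := l3 h8; omega
      · by_cases h9 : D.card = 8
        · omega
        · omega
  have := sum_le_sum key
  rw [sum_add_distrib, sum_add_distrib, sum_add_distrib, ← mul_sum, ← mul_sum, ← mul_sum, ← e1, ← e2, ← e3, ← e4] at this
  simp only [sum_const, smul_eq_mul] at this
  linarith

lemma ntot (h : Cx G W m) : W.card = (NC G W m 4).card + (NC G W m 6).card + (NB G W m).card := by
  unfold NC NB
  have h1 := card_filter_add_card_filter_not (s := W) (fun v => 7 ≤ (cpt (fg G m) v).card)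
  have h2 := card_filter_add_card_filter_not (s := W.filter (fun v => ¬ 7 ≤ (cpt (fg G m) v).card)) (fun v => (cpt (fg G m) v).card = 4)
  have h3 : (W.filter (fun v => ¬ 7 ≤ (cpt (fg G m) v).card)).filter (fun v => (cpt (fg G m) v).card = 4) = W.filter (fun v => (cpt (fg G m) v).card = 4) := by
    ext x; simp only [mem_filter]
    constructor
    · tauto
    · rintro ⟨h1, h2⟩; exact ⟨⟨h1, by omega⟩, h2⟩
  have h4 : (W.filter (fun v => ¬ 7 ≤ (cpt (fg G m) v).card)).filter (fun v => ¬ (cpt (fg G m) v).card = 4) = W.filter (fun v => (cpt (fg G m) v).card = 6) := by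
    ext x; simp only [mem_filter]
    constructor
    · rintro ⟨⟨h1, h2⟩, h3⟩; have := h.card_cases h1; exact ⟨h1, by omega⟩
    · rintro ⟨h1, h2⟩; exact ⟨⟨h1, by omega⟩, by omega⟩
  rw [h3, h4] at h2
  omega

end Cx

/-- alternating six-tuples -/
def AL (m : V → V) (Z : Fin 6 → V) : Prop :=
  (m (Z 0) = Z 1 ∧ m (Z 2) = Z 3 ∧ m (Z 4) = Z 5) ∨ (m (Z 1) = Z 2 ∧ m (Z 3) = Z 4 ∧ m (Z 5) = Z 0)

instance (m : V → V) : DecidablePred (AL m) := fun Z => by unfold AL; infer_instance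

def rt6 (Z : Fin 6 → V) : Fin 6 → V := fun i => Z (i+1)

lemma I6.rt {G : SimpleGraph V} {Z : Fin 6 → V} (h : I6 G Z) : I6 G (rt6 Z) := by
  obtain ⟨h1, h2, h3⟩ := h
  refine ⟨fun i j e => add_right_cancel (h1 e), fun i => h2 (i+1), fun i x hx => h3 (i+1) x (fun j => ?_)⟩
  have := hx (j-1)
  unfold rt6 at this
  rwa [sub_add_cancel] at this

lemma Mt.inv' {G : SimpleGraph V} {W : Finset V} {m : V → V} (h : Mt G W m) {u v : V} (hu : u ∈ W) (e : m u = v) : m v = u := by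
  rw [← e, h.inv u hu]

lemma AL.rt {m : V → V} {Z : Fin 6 → V} (h : AL m Z) : AL m (rt6 Z) := by
  rcases h with ⟨h1, h2, h3⟩ | ⟨h1, h2, h3⟩
  · exact Or.inr ⟨h2, h3, h1⟩
  · exact Or.inl ⟨h1, h2, h3⟩

namespace Cx
variable {G : SimpleGraph V} {W : Finset V} {m : V → V}

lemma al0 (h : Cx G W m) (v : V) : (((ZS G).filter (AL m)).filter (fun Z => Z 0 = v)).card ≤ 18 := by
  have hnb : ∀ u, ∃ nb : Fin 3 → V, ∀ x, G.Adj u x → ∃ i, nb i = x := by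
    intro u
    by_cases hu : u ∈ W
    · obtain ⟨a, b, c, -, -, -, hn⟩ := h.cub.deg u hu
      refine ⟨![a,b,c], fun x hx => ?_⟩
      rw [hn] at hx
      rcases hx with rfl | rfl | rfl
      · exact ⟨0, rfl⟩
      · exact ⟨1, rfl⟩
      · exact ⟨2, rfl⟩
    · exact ⟨fun _ => u, fun x hx => absurd (h.cub.adj_mem hx).1 hu⟩
  choose nb hnb using hnb
  let f : Bool × Fin 3 × Fin 3 → (Fin 6 → V) := fun t =>
    if t.1 then ![v, m v, nb (m v) t.2.1, m (nb (m v) t.2.1), nb (m (nb (m v) t.2.1)) t.2.2, m (nb (m (nb (m v) t.2.1)) t.2.2)]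
    else ![v, nb v t.2.1, m (nb v t.2.1), nb (m (nb v t.2.1)) t.2.2, m (nb (m (nb v t.2.1)) t.2.2), m v]
  have hsub : ((ZS G).filter (AL m)).filter (fun Z => Z 0 = v) ⊆ univ.image f := by
    intro Z hZ
    rw [mem_filter, mem_filter, mem_ZS] at hZ
    obtain ⟨⟨hI, hA⟩, h0⟩ := hZ
    have ha := hI.2.1
    rw [mem_image]
    rcases hA with ⟨h1, h2, h3⟩ | ⟨h1, h2, h3⟩
    · obtain ⟨i, hi⟩ := hnb (Z 1) (Z 2) (ha 1)
      obtain ⟨j, hj⟩ := hnb (Z 3) (Z 4) (ha 3)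
      refine ⟨(true, i, j), mem_univ _, ?_⟩
      funext k
      simp only [f, if_true]
      rw [h0] at h1
      rw [h1, hi, h2, hj, h3]
      fin_cases k
      · exact h0.symm
      all_goals rfl
    · obtain ⟨i, hi⟩ := hnb (Z 0) (Z 1) (ha 0)
      obtain ⟨j, hj⟩ := hnb (Z 2) (Z 3) (ha 2)
      have h4 := h.inv' (h.cub.adj_mem (ha 5)).1 h3
      refine ⟨(false, i, j), mem_univ _, ?_⟩
      funext k
      simp only [f]
      rw [h0] at h4 hi
      rw [h4, hi, h1, hj, h2]
      fin_cases k
      · exact h0.symm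
      all_goals rfl
  calc _ ≤ (univ.image f).card := card_le_card hsub
    _ ≤ (univ : Finset (Bool × Fin 3 × Fin 3)).card := card_image_le
    _ = 18 := by simp

lemma ali (h : Cx G W m) (v : V) (i : Fin 6) : (((ZS G).filter (AL m)).filter (fun Z => Z i = v)).card ≤ 18 := by
  have step : ∀ i : Fin 6, (((ZS G).filter (AL m)).filter (fun Z => Z (i+1) = v)).card ≤ (((ZS G).filter (AL m)).filter (fun Z => Z i = v)).card := by
    intro i
    apply card_le_card_of_injOn rt6
    · intro Z hZ
      rw [mem_coe, mem_filter, mem_filter, mem_ZS] at hZ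
      rw [mem_coe, mem_filter, mem_filter, mem_ZS]
      exact ⟨⟨hZ.1.1.rt, hZ.1.2.rt⟩, hZ.2⟩
    · intro Z _ Z' _ e
      funext j
      have := congrFun e (j-1)
      unfold rt6 at this
      rwa [sub_add_cancel] at this
  have s0 := h.al0 v
  have s1 := step 0; have s2 := step 1; have s3 := step 2; have s4 := step 3; have s5 := step 4
  simp only [show (0:Fin 6)+1 = 1 from rfl, show (1:Fin 6)+1 = 2 from rfl, show (2:Fin 6)+1 = 3 from rfl, show (3:Fin 6)+1 = 4 from rfl,
    show (4:Fin 6)+1 = 5 from rfl] at *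
  fin_cases i
  · exact s0
  · exact s1.trans s0
  · exact s2.trans (s1.trans s0)
  · exact s3.trans (s2.trans (s1.trans s0))
  · exact s4.trans (s3.trans (s2.trans (s1.trans s0)))
  · exact s5.trans (s4.trans (s3.trans (s2.trans (s1.trans s0))))

lemma alT (h : Cx G W m) (T : Finset V) (hT : ∀ Z ∈ (ZS G).filter (AL m), ∃ i, Z i ∈ T) :
    ((ZS G).filter (AL m)).card ≤ 108 * T.card := by
  have hsub : (ZS G).filter (AL m) ⊆ (T ×ˢ (univ : Finset (Fin 6))).biUnion (fun t => ((ZS G).filter (AL m)).filter (fun Z => Z t.2 = t.1)) := by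
    intro Z hZ
    obtain ⟨i, hi⟩ := hT Z hZ
    rw [mem_biUnion]
    exact ⟨(Z i, i), mem_product.2 ⟨hi, mem_univ _⟩, mem_filter.2 ⟨hZ, rfl⟩⟩
  calc _ ≤ _ := card_le_card hsub
    _ ≤ (T ×ˢ (univ : Finset (Fin 6))).card * 18 := card_biUnion_le_card_mul _ _ _ (fun t _ => h.ali t.1 t.2)
    _ = 108 * T.card := by rw [card_product]; simp; ring

end Cx
end K5

set_option linter.unusedSectionVars false
set_option linter.unusedVariables false
set_option linter.unusedSimpArgs false

section K6
variable {V : Type*} [Fintype V] [DecidableEq V]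
open Finset

/-- Hamilton path of `X` from `s` to `t`. -/
def PL (G : SimpleGraph V) (X : Finset V) (s t : V) : Prop :=
  ∃ L : List V, L.Nodup ∧ List.IsChain G.Adj L ∧ (∀ x, x ∈ X ↔ x ∈ L) ∧ L.head? = some s ∧ L.getLast? = some t

lemma PL.append {G : SimpleGraph V} {X Y : Finset V} {s t s' t' : V} (h : PL G X s t) (h' : PL G Y s' t')
    (hd : Disjoint X Y) (ha : G.Adj t s') : PL G (X ∪ Y) s t' := by
  obtain ⟨L, h1, h2, h3, h4, h5⟩ := h
  obtain ⟨L', h1', h2', h3', h4', h5'⟩ := h'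
  refine ⟨L ++ L', ?_, ?_, ?_, ?_, ?_⟩
  · rw [List.nodup_append]
    refine ⟨h1, h1', fun a ha b hb e => ?_⟩
    rw [← h3] at ha; rw [← h3'] at hb
    exact Finset.disjoint_left.1 hd ha (e ▸ hb)
  · rw [List.isChain_append]
    refine ⟨h2, h2', fun x hx y hy => ?_⟩
    rw [h5] at hx; rw [h4'] at hy
    simp at hx hy
    rw [← hx, ← hy]; exact ha
  · intro x; rw [mem_union, List.mem_append, h3, h3']
  · rw [List.head?_append, h4]; rfl
  · rw [List.getLast?_append, h5']; rfl

lemma D2.pl {G F : SimpleGraph V} (hF : D2 F) (hFG : F ≤ G) {u v : V} (huv : F.Adj u v) : PL G (cpt F u) u v := by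
  obtain ⟨l, h1, h2, h3, -, -⟩ := hF.cyl huv
  refine ⟨u :: (l ++ [v]), h1, h2.imp (fun _ _ h => hFG h), fun x => (h3 x).symm, rfl, ?_⟩
  rw [← List.cons_append, List.getLast?_append]; rfl

lemma fg_le {G : SimpleGraph V} {m : V → V} : fg G m ≤ G := fun _ _ h => h.1

/-- A Hamilton cycle on `U`. -/
def Ham (G : SimpleGraph V) (U : Finset V) : Prop := 3 ≤ U.card ∧ ∃ s t, PL G U s t ∧ G.Adj t s

namespace Cx
variable {G : SimpleGraph V} {W : Finset V} {m : V → V}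

lemma hamD (h : Cx G W m) {v0 v1 v2 v3 : V} (h6 : (cpt (fg G m) v0).card = 6) (f01 : (fg G m).Adj v0 v1) (f23 : (fg G m).Adj v2 v3)
    (m12 : m v1 = v2) (hv2 : v2 ∈ cpt (fg G m) v0) (n02 : v0 ≠ v2) (n03 : v0 ≠ v3) (n13 : v1 ≠ v3) 
    (hst : ∀ x ∈ cpt (fg G m) v0, x ≠ v0 → x ≠ v1 → x ≠ v2 → x ≠ v3 → ¬ (G.Adj x v1 ∧ G.Adj x v2)) :
    PL G (cpt (fg G m) v0) v0 v3 := by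
  have v1W := (h.cub.adj_mem f01.1).2
  have g12 : G.Adj v1 v2 := by rw [← m12]; exact h.adj _ v1W
  obtain ⟨l, hnd, hch, hm, hl, -⟩ := h.d2.cyl f01
  rw [h6] at hl
  obtain ⟨c1, c2, c3, c4, rfl⟩ : ∃ x y z w, l = [x, y, z, w] := by
    match l, hl with
    | [x, y, z, w], _ => exact ⟨x, y, z, w, rfl⟩
  simp only [List.cons_append, List.nil_append] at hnd hch hm
  simp only [List.isChain_cons_cons, List.isChain_singleton, and_true] at hch
  obtain ⟨e1, e2, e3, e4, e5⟩ := hch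
  have hnd' := hnd
  simp only [List.nodup_cons, List.mem_cons, List.not_mem_nil, or_false, not_or, List.nodup_nil, and_true, not_false_eq_true] at hnd'
  obtain ⟨⟨d01, d02, d03, d04, d05⟩, ⟨d12, d13, d14, d15⟩, ⟨d23, d24, d25⟩, ⟨d34, d35⟩, d45⟩ := hnd'
  have mk : ∀ L : List V, List.Perm L [v0, c1, c2, c3, c4, v1] → List.IsChain G.Adj L → L.head? = some v0 → L.getLast? = some v3 →
     PL G (cpt (fg G m) v0) v0 v3 := by
    intro L hp hc h1 h2
    exact ⟨L, hp.nodup_iff.2 hnd, hc, fun x => by rw [← hm, hp.mem_iff], h1, h2⟩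
  have hv2' := (hm v2).2 hv2
  simp only [List.mem_cons, List.not_mem_nil, or_false] at hv2'
  rcases hv2' with e | e | e | e | e | e
  · exact absurd e.symm n02
  · -- v2 = c1
    subst e
    have hv3 : v3 = c2 := by
      have := (h.d2.of2 e1.symm e2 d02 v3).1 f23
      rcases this with e | e
      · exact absurd e.symm n03
      · exact e
    subst hv3
    refine mk [v0, v2, v1, c4, c3, v3] ?_ ?_ rfl rfl
    · apply List.Perm.cons; apply List.Perm.cons
      exact (List.reverse_perm [v3, c3, c4, v1])
    · simp only [List.isChain_cons_cons, List.isChain_singleton, and_true]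
      exact ⟨e1.1, g12.symm, e5.1.symm, e4.1.symm, e3.1.symm⟩
  · subst e
    rcases (h.d2.of2 e2.symm e3 d13 v3).1 f23 with e | e
    · subst e
      refine mk [v0, v1, c4, c3, v2, v3] ?_ ?_ rfl rfl
      · apply List.Perm.cons
        exact (List.reverse_perm [v3, v2, c3, c4, v1])
      · simp only [List.isChain_cons_cons, List.isChain_singleton, and_true]
        exact ⟨f01.1, e5.1.symm, e4.1.symm, e3.1.symm, e2.1.symm⟩
    · subst e
      refine mk [v0, c1, v2, v1, c4, v3] ?_ ?_ rfl rfl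
      · apply List.Perm.cons; apply List.Perm.cons; apply List.Perm.cons
        exact (List.reverse_perm [v3, c4, v1])
      · simp only [List.isChain_cons_cons, List.isChain_singleton, and_true]
        exact ⟨e1.1, e2.1, g12.symm, e5.1.symm, e4.1.symm⟩
  · subst e
    rcases (h.d2.of2 e3.symm e4 d24 v3).1 f23 with e | e
    · subst e
      exfalso
      refine hst c4 ((hm c4).1 (by simp)) (Ne.symm d04) d45 (Ne.symm d34) (Ne.symm d24) ⟨e5.1, e4.1.symm⟩
    · subst e
      refine mk [v0, c1, c2, v2, v1, v3] ?_ ?_ rfl rfl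
      · apply List.Perm.cons; apply List.Perm.cons; apply List.Perm.cons; apply List.Perm.cons
        exact (List.reverse_perm [v3, v1])
      · simp only [List.isChain_cons_cons, List.isChain_singleton, and_true]
        exact ⟨e1.1, e2.1, e3.1, g12.symm, e5.1.symm⟩
  · subst e
    exact absurd m12 e5.2.2
  · subst e
    exact absurd m12 (h.ne v1W)

/-- Good unions of components. -/
def GU (G : SimpleGraph V) (W : Finset V) (m : V → V) (U : Finset V) : Prop :=
  U ⊆ W ∧ FC (fg G m) U ∧ (∀ x ∈ U, (cpt (fg G m) x).card = 6) ∧ 12 ≤ U.card ∧ U.card ≤ 18 ∧ Ham G U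

lemma cdisj {F : SimpleGraph V} {u v : V} (h : v ∉ cpt F u) : Disjoint (cpt F u) (cpt F v) := by
  rw [Finset.disjoint_left]
  intro x hx hx'
  apply h
  rw [← cmp_eq hx, cmp_eq hx']; exact self_mem_cmp

lemma FCu {F : SimpleGraph V} {X Y : Finset V} (hX : FC F X) (hY : FC F Y) : FC F (X ∪ Y) := by
  intro u v hu huv
  rw [mem_union] at *
  exact hu.imp (fun h => hX _ _ h huv) (fun h => hY _ _ h huv)

/-- case b -/
lemma caseB (h : Cx G W m) {v0 v1 v2 v3 v4 v5 : V} (f01 : (fg G m).Adj v0 v1) (f23 : (fg G m).Adj v2 v3) (f45 : (fg G m).Adj v4 v5)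
    (m12 : m v1 = v2) (g34 : G.Adj v3 v4) (g50 : G.Adj v5 v0) (hnd : [v0,v1,v2,v3,v4,v5].Nodup)
    (hst : ∀ x, x ≠ v0 → x ≠ v1 → x ≠ v2 → x ≠ v3 → x ≠ v4 → x ≠ v5 → ¬ (G.Adj x v1 ∧ G.Adj x v2))
    (k0 : (cpt (fg G m) v0).card = 6) (k4 : (cpt (fg G m) v4).card = 6)
    (hv2 : v2 ∈ cpt (fg G m) v0) (hv4 : v4 ∉ cpt (fg G m) v0) : ∃ U, GU G W m U ∧ ∀ x ∈ U, x ∈ cpt (fg G m) v0 ∨ x ∈ cpt (fg G m) v4 := by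
  simp only [List.nodup_cons, List.mem_cons, List.not_mem_nil, or_false, not_or, List.nodup_nil, and_true, not_false_eq_true] at hnd
  have hv5 : v5 ∉ cpt (fg G m) v0 := fun hh => hv4 (cmp_FC _ _ hh f45.symm)
  have p1 := h.hamD k0 f01 f23 m12 hv2 hnd.1.2.1 hnd.1.2.2.1 hnd.2.1.2.1
    (fun x hx a b c d => hst x a b c d (ne_of_mem_of_not_mem hx hv4) (ne_of_mem_of_not_mem hx hv5))
  have p2 := h.d2.pl fg_le f45
  have v0W := (h.cub.adj_mem f01.1).1
  have v4W := (h.cub.adj_mem f45.1).1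
  have hd := cdisj hv4
  have hc : (cpt (fg G m) v0 ∪ cpt (fg G m) v4).card = 12 := by rw [card_union_of_disjoint hd, k0, k4]
  refine ⟨cpt (fg G m) v0 ∪ cpt (fg G m) v4, ⟨union_subset (h.cmp_sub v0W) (h.cmp_sub v4W), FCu cmp_FC cmp_FC, ?_, by omega, by omega,
    by omega, _, _, p1.append p2 hd g34, g50⟩, fun x hx => mem_union.1 hx⟩
  intro x hx
  rw [mem_union] at hx
  rcases hx with hx | hx
  · rw [cmp_eq hx, k0]
  · rw [cmp_eq hx, k4]

lemma caseA (h : Cx G W m) {v0 v1 v2 v3 v4 v5 : V} (f01 : (fg G m).Adj v0 v1) (f23 : (fg G m).Adj v2 v3) (f45 : (fg G m).Adj v4 v5)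
    (g12 : G.Adj v1 v2) (g34 : G.Adj v3 v4) (g50 : G.Adj v5 v0)
    (k0 : (cpt (fg G m) v0).card = 6) (k2 : (cpt (fg G m) v2).card = 6) (k4 : (cpt (fg G m) v4).card = 6)
    (hv2 : v2 ∉ cpt (fg G m) v0) (hv4 : v4 ∉ cpt (fg G m) v0) (hv24 : v4 ∉ cpt (fg G m) v2) :
    ∃ U, GU G W m U ∧ ∀ x ∈ U, (x ∈ cpt (fg G m) v0 ∨ x ∈ cpt (fg G m) v2) ∨ x ∈ cpt (fg G m) v4 := by
  have p1 := h.d2.pl fg_le f01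
  have p2 := h.d2.pl fg_le f23
  have p3 := h.d2.pl fg_le f45
  have v0W := (h.cub.adj_mem f01.1).1
  have v2W := (h.cub.adj_mem f23.1).1
  have v4W := (h.cub.adj_mem f45.1).1
  have hd := cdisj hv2
  have hd2 : Disjoint (cpt (fg G m) v0 ∪ cpt (fg G m) v2) (cpt (fg G m) v4) := disjoint_union_left.2 ⟨cdisj hv4, cdisj hv24⟩
  have hc : (cpt (fg G m) v0 ∪ cpt (fg G m) v2 ∪ cpt (fg G m) v4).card = 18 := by rw [card_union_of_disjoint hd2, card_union_of_disjoint hd, k0, k2, k4]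
  refine ⟨cpt (fg G m) v0 ∪ cpt (fg G m) v2 ∪ cpt (fg G m) v4, ⟨union_subset (union_subset (h.cmp_sub v0W) (h.cmp_sub v2W)) (h.cmp_sub v4W),
    FCu (FCu cmp_FC cmp_FC) cmp_FC, ?_, by omega, by omega,
    by omega, _, _, (p1.append p2 hd g12).append p3 hd2 g34, g50⟩, fun x hx => (mem_union.1 hx).imp mem_union.1 id⟩
  intro x hx
  rw [mem_union, mem_union] at hx
  rcases hx with (hx | hx) | hx
  · rw [cmp_eq hx, k0]
  · rw [cmp_eq hx, k2]
  · rw [cmp_eq hx, k4]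

lemma alt6n (h : Cx G W m) {Z : Fin 6 → V} (hI : I6 G Z) (h1 : m (Z 1) = Z 2) (h2 : m (Z 3) = Z 4) (h3 : m (Z 5) = Z 0)
    (h6 : ∀ i, (cpt (fg G m) (Z i)).card = 6) : ∃ U, GU G W m U ∧ ∀ x ∈ U, ∃ i, x ∈ cpt (fg G m) (Z i) := by
  obtain ⟨hinj, hadj, hstar⟩ := hI
  have hW : ∀ i, Z i ∈ W := fun i => (h.cub.adj_mem (hadj i)).1
  have ne : ∀ i j, i ≠ j → Z i ≠ Z j := fun i j hij e => hij (hinj e)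
  have h1' := h.inv' (hW 1) h1
  have h2' := h.inv' (hW 3) h2
  have h3' := h.inv' (hW 5) h3
  have f01 : (fg G m).Adj (Z 0) (Z 1) := h.fadj.2 ⟨hadj 0, by rw [h3']; exact ne 5 1 (by decide)⟩
  have f23 : (fg G m).Adj (Z 2) (Z 3) := h.fadj.2 ⟨hadj 2, by rw [h1']; exact ne 1 3 (by decide)⟩
  have f45 : (fg G m).Adj (Z 4) (Z 5) := h.fadj.2 ⟨hadj 4, by rw [h2']; exact ne 3 5 (by decide)⟩
  have g12 : G.Adj (Z 1) (Z 2) := hadj 1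
  have g34 : G.Adj (Z 3) (Z 4) := hadj 3
  have g50 : G.Adj (Z 5) (Z 0) := hadj 5
  have nd : ∀ a b c d e f : Fin 6, [a,b,c,d,e,f].Nodup → [Z a, Z b, Z c, Z d, Z e, Z f].Nodup := by
    intro a b c d e f hh
    exact hh.map hinj
  have st : ∀ a b c d e f : Fin 6, ([a,b,c,d,e,f].Nodup) → c = b + 1 → ∀ x, x ≠ Z a → x ≠ Z b → x ≠ Z c → x ≠ Z d → x ≠ Z e → x ≠ Z f → ¬ (G.Adj x (Z b) ∧ G.Adj x (Z c)) := by
    intro a b c d e f hh hc x xa xb xc xd xe xf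
    rw [hc]
    apply hstar b x
    intro j
    have : ∀ j, j = a ∨ j = b ∨ j = c ∨ j = d ∨ j = e ∨ j = f := by
      intro j
      have h5 : [a,b,c,d,e,f].toFinset = univ := by
        apply eq_univ_of_card; rw [List.toFinset_card_of_nodup hh]; rfl
      have := mem_univ j
      rw [← h5] at this
      simpa using this
    rcases this j with rfl | rfl | rfl | rfl | rfl | rfl <;> assumption
  by_cases c02 : Z 2 ∈ cpt (fg G m) (Z 0)
  · by_cases c04 : Z 4 ∈ cpt (fg G m) (Z 0)
    · -- all in one component
      exfalso
      have hall : ∀ i, Z i ∈ cpt (fg G m) (Z 0) := by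
        intro i; fin_cases i
        · exact self_mem_cmp
        · exact cmp_FC _ _ self_mem_cmp f01
        · exact c02
        · exact cmp_FC _ _ c02 f23
        · exact c04
        · exact cmp_FC _ _ c04 f45
      have heq : univ.image Z = cpt (fg G m) (Z 0) := by
        apply eq_of_subset_of_card_le
        · intro x hx; rw [mem_image] at hx; obtain ⟨i, -, rfl⟩ := hx; exact hall i
        · rw [card_image_of_injective _ hinj, h6]; simp
      have ho := (h.out (hW 0)).1
      have : ((cpt (fg G m) (Z 0)).filter (fun u => m u ∉ cpt (fg G m) (Z 0))) = ∅ := by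
        rw [filter_eq_empty_iff]
        intro x hx hmx
        rw [← heq, mem_image] at hx
        obtain ⟨i, -, rfl⟩ := hx
        apply hmx
        have : ∀ i, ∃ j, m (Z i) = Z j := by
          intro i; fin_cases i
          · exact ⟨_, h3'⟩
          · exact ⟨_, h1⟩
          · exact ⟨_, h1'⟩
          · exact ⟨_, h2⟩
          · exact ⟨_, h2'⟩
          · exact ⟨_, h3⟩
        obtain ⟨j, hj⟩ := this i
        rw [hj]; exact hall j
      rw [this] at ho
      simp at ho
    · obtain ⟨U, hU, h0⟩ := h.caseB f01 f23 f45 h1 g34 g50 (nd 0 1 2 3 4 5 (by decide)) (st 0 1 2 3 4 5 (by decide) rfl) (h6 0) (h6 4) c02 c04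
      exact ⟨U, hU, fun x hx => (h0 x hx).elim (fun h => ⟨_, h⟩) (fun h => ⟨_, h⟩)⟩
  · by_cases c24 : Z 4 ∈ cpt (fg G m) (Z 2)
    · have c20 : Z 0 ∉ cpt (fg G m) (Z 2) := fun hh => c02 (by rw [cmp_eq hh]; exact self_mem_cmp)
      obtain ⟨U, hU, h0⟩ := h.caseB f23 f45 f01 h2 g50 g12 (nd 2 3 4 5 0 1 (by decide)) (st 2 3 4 5 0 1 (by decide) rfl) (h6 2) (h6 0) c24 c20
      exact ⟨U, hU, fun x hx => (h0 x hx).elim (fun h => ⟨_, h⟩) (fun h => ⟨_, h⟩)⟩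
    · by_cases c04 : Z 4 ∈ cpt (fg G m) (Z 0)
      · have c40 : Z 0 ∈ cpt (fg G m) (Z 4) := by rw [cmp_eq c04]; exact self_mem_cmp
        have c42 : Z 2 ∉ cpt (fg G m) (Z 4) := fun hh => c24 (by rw [cmp_eq hh]; exact self_mem_cmp)
        obtain ⟨U, hU, h0⟩ := h.caseB f45 f01 f23 h3 g12 g34 (nd 4 5 0 1 2 3 (by decide)) (st 4 5 0 1 2 3 (by decide) rfl) (h6 4) (h6 2) c40 c42
        exact ⟨U, hU, fun x hx => (h0 x hx).elim (fun h => ⟨_, h⟩) (fun h => ⟨_, h⟩)⟩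
      · obtain ⟨U, hU, h0⟩ := h.caseA f01 f23 f45 g12 g34 g50 (h6 0) (h6 2) (h6 4) c02 c04 c24
        exact ⟨U, hU, fun x hx => (h0 x hx).elim (fun hh => hh.elim (fun h => ⟨_, h⟩) (fun h => ⟨_, h⟩)) (fun h => ⟨_, h⟩)⟩

lemma alt6 (h : Cx G W m) {Z : Fin 6 → V} (hI : I6 G Z) (hA : AL m Z)
    (h6 : ∀ i, (cpt (fg G m) (Z i)).card = 6) : ∃ U, GU G W m U ∧ ∀ x ∈ U, ∃ i, x ∈ cpt (fg G m) (Z i) := by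
  rcases hA with ⟨h1, h2, h3⟩ | ⟨h1, h2, h3⟩
  · obtain ⟨U, hU, hi⟩ := h.alt6n hI.rt h2 h3 h1 (fun i => h6 (i+1))
    refine ⟨U, hU, fun x hx => ?_⟩
    obtain ⟨i, hi⟩ := hi x hx
    exact ⟨i+1, hi⟩
  · exact h.alt6n hI h1 h2 h3 h6

end Cx
end K6

set_option linter.unusedSectionVars false
set_option linter.unusedVariables false
set_option linter.unusedSimpArgs false

section K7
variable {V : Type*} [Fintype V] [DecidableEq V]
open Finset

lemma Ham.list {G : SimpleGraph V} {U : Finset V} (h : Ham G U) : ∃ a b c l, (a :: b :: c :: l : List V).Nodup ∧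
    (∀ x, x ∈ U ↔ x ∈ a :: b :: c :: l) ∧ List.IsChain G.Adj (a :: b :: c :: (l ++ [a])) ∧ l.length + 3 = U.card := by
  obtain ⟨h3, s, t, ⟨L, h1, h2, hm, hs, ht⟩, hts⟩ := h
  have hc : U.card = L.length := by
    rw [← List.toFinset_card_of_nodup h1]; congr 1; ext x; rw [List.mem_toFinset, hm]
  match L, h1, h2, hm, hs, ht, hc with
  | [], _, _, _, hs, _, _ => simp at hs
  | [_], _, _, _, _, _, hc => simp only [List.length_cons, List.length_nil] at hc; omega
  | [_, _], _, _, _, _, _, hc => simp only [List.length_cons, List.length_nil] at hc; omega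
  | a :: b :: c :: l, h1, h2, hm, hs, ht, hc =>
    refine ⟨a, b, c, l, h1, hm, ?_, by simp only [List.length_cons] at hc; omega⟩
    have : List.IsChain G.Adj ((a :: b :: c :: l) ++ [a]) := by
      rw [List.isChain_append]
      refine ⟨h2, List.isChain_singleton _, fun x hx y hy => ?_⟩
      rw [ht] at hx
      simp only [List.head?_cons, Option.mem_def, Option.some.injEq] at hx hy hs
      rw [← hx, ← hy, hs]; exact hts
    exact this

lemma addparts {G : SimpleGraph V} {W : Finset V} (S : Finset (Finset V))
    (hS : ∀ U ∈ S, U ⊆ W ∧ Ham G U) (hd : ∀ U ∈ S, ∀ U' ∈ S, U ≠ U' → Disjoint U U') :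
    ∃ (H : SimpleGraph V) (k : ℕ), H ≤ G ∧ Rl W H k ∧ k + ∑ U ∈ S, U.card = W.card + 2 * S.card ∧
      ∀ w, (∀ U ∈ S, w ∉ U) → iso H w := by
  induction S using Finset.induction_on with
  | empty => exact ⟨⊥, W.card, bot_le, Rl.bot W, by simp, fun w _ x hx => hx⟩
  | insert U S hU ih =>
    obtain ⟨H, k, hHG, hR, hk, hiso⟩ := ih (fun X hX => hS X (mem_insert_of_mem hX))
      (fun X hX Y hY => hd X (mem_insert_of_mem hX) Y (mem_insert_of_mem hY))
    obtain ⟨hUW, hH⟩ := hS U (mem_insert_self _ _)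
    obtain ⟨a, b, c, l, hnd, hm, hch, hlen⟩ := hH.list
    have hdis : ∀ X ∈ S, Disjoint U X := fun X hX => hd U (mem_insert_self _ _) X (mem_insert_of_mem hX) (fun e => hU (e ▸ hX))
    have hbig : U.card + ∑ X ∈ S, X.card ≤ W.card := by
      have h1 : (S.biUnion id).card = ∑ X ∈ S, X.card := by
        rw [card_biUnion]
        · rfl
        · intro X hX Y hY hne; exact hd X (mem_insert_of_mem hX) Y (mem_insert_of_mem hY) hne
      have h2 : Disjoint U (S.biUnion id) := by
        rw [disjoint_biUnion_right]; exact hdis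
      rw [← h1, ← card_union_of_disjoint h2]
      apply card_le_card
      apply union_subset hUW
      rw [biUnion_subset]
      exact fun X hX => (hS X (mem_insert_of_mem hX)).1
    have hl : ∀ w ∈ a :: b :: c :: l, iso H w ∧ w ∈ W := by
      intro w hw
      rw [← hm] at hw
      exact ⟨hiso w (fun X hX => Finset.disjoint_left.1 (hdis X hX) hw), hUW hw⟩
    obtain ⟨H1, r1, r2, r3, r4⟩ := Rl.addc (Gc := G.Adj) (fun x y h => h.symm) hR (k := k + 2 - U.card) (a := a) (b := b) (c := c) (l := l)
      (by omega) hl hnd hch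
    · refine ⟨H1, k + 2 - U.card, ?_, r1, ?_, ?_⟩
      · intro x y hxy
        exact (r3 x y hxy).elim (fun h => hHG h) id
      · rw [sum_insert hU, card_insert_of_notMem hU]; omega
      · intro w hw
        apply r4 w
        · rw [← hm]; exact hw U (mem_insert_self _ _)
        · exact hiso w (fun X hX => hw X (mem_insert_of_mem hX))

/-- a partition into Hamiltonian parts gives `Good`. -/
lemma good_parts {G : SimpleGraph V} {W : Finset V} (S : Finset (Finset V))
    (hS : ∀ U ∈ S, U ⊆ W ∧ Ham G U) (hd : ∀ U ∈ S, ∀ U' ∈ S, U ≠ U' → Disjoint U U')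
    (hc : ∀ w ∈ W, ∃ U ∈ S, w ∈ U) : Good G W (2 * S.card) := by
  obtain ⟨H, k, hHG, hR, hk, -⟩ := addparts S hS hd
  have h1 : (S.biUnion id).card = ∑ X ∈ S, X.card := by
    rw [card_biUnion]
    · rfl
    · intro X hX Y hY hne; exact hd X hX Y hY hne
  have h2 : S.biUnion id = W := by
    ext w; rw [mem_biUnion]
    constructor
    · rintro ⟨U, hU, hw⟩; exact (hS U hU).1 hw
    · intro hw; obtain ⟨U, hU, hw⟩ := hc w hw; exact ⟨U, hU, hw⟩
  rw [h2] at h1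
  have : k = 2 * S.card := by omega
  exact ⟨H, hHG, this ▸ hR⟩

lemma Mt.ham_cpt {G : SimpleGraph V} {W : Finset V} {m : V → V} (h : Mt G W m) {v : V} (hv : v ∈ W) : Ham G (cpt (fg G m) v) := by
  obtain ⟨p, q, -, -, -, -, hn⟩ := h.n3 hv
  have fvp := (hn p).2 (Or.inl rfl)
  have := h.card_ge4 hv
  exact ⟨by omega, v, p, h.d2.pl fg_le fvp, fvp.1.symm⟩

lemma Mt.good2 {G : SimpleGraph V} {W : Finset V} {m : V → V} (h : Mt G W m) {v : V} (hv : v ∈ W) (hW : cpt (fg G m) v = W) : Good G W 2 := by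
  have := good_parts (G := G) (W := W) {W} (by
    intro U hU; rw [mem_singleton] at hU; subst hU
    exact ⟨Subset.refl _, hW ▸ h.ham_cpt hv⟩) (by
    intro U hU U' hU' hne; rw [mem_singleton] at hU hU'; exact absurd (hU.trans hU'.symm) hne)
    (fun w hw => ⟨W, mem_singleton_self _, hw⟩)
  simpa using this

/-- five-components -/
lemma Mt.five {G : SimpleGraph V} {W : Finset V} {m : V → V} (h : Mt G W m) {v : V} (hv : v ∈ W) (hW : cpt (fg G m) v ≠ W)
    (h5 : (cpt (fg G m) v).card = 5) : Good G W 2 ∨ ∃ (G' : SimpleGraph V) (W' : Finset V), Cub G' W' ∧ W'.card + 4 = W.card ∧ 10 ≤ W.card ∧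
      ∀ k, Good G' W' k → Good G W (k+1) := by
  obtain ⟨o1, o2, o3, o4⟩ := h.out_facts (h.cmp_sub hv) cmp_FC ⟨v, self_mem_cmp⟩ hW
  have ho : ((cpt (fg G m) v).filter (fun u => m u ∉ cpt (fg G m) v)).card = (cpt (fg G m) v).card := by omega
  have hall : ∀ u ∈ cpt (fg G m) v, m u ∉ cpt (fg G m) v := by
    have := eq_of_subset_of_card_le (filter_subset _ _) ho.ge
    intro u hu
    rw [← this, mem_filter] at hu; exact hu.2
  obtain ⟨p, q, -, -, -, -, hn⟩ := h.n3 hv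
  have fvp := (hn p).2 (Or.inl rfl)
  obtain ⟨l, hnd, hch, hm, hl, -⟩ := h.d2.cyl fvp
  rw [h5] at hl
  obtain ⟨x, y, z, rfl⟩ : ∃ x y z, l = [x, y, z] := by
    match l, hl with
    | [x, y, z], _ => exact ⟨x, y, z, rfl⟩
  simp only [List.cons_append, List.nil_append] at hnd hch hm
  simp only [List.isChain_cons_cons, List.isChain_singleton, and_true] at hch
  obtain ⟨c1, c2, c3, c4⟩ := hch
  have hWW : ∀ u ∈ [v,x,y,z,p], u ∈ W := fun u hu => h.cmp_sub hv ((hm u).1 hu)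
  have vW := hv
  have xW := hWW x (by simp)
  have yW := hWW y (by simp)
  have zW := hWW z (by simp)
  have pW := hWW p (by simp)
  have hnd' := hnd
  simp only [List.nodup_cons, List.mem_cons, List.not_mem_nil, or_false, not_or, List.nodup_nil, and_true, not_false_eq_true] at hnd'
  obtain ⟨⟨d01, d02, d03, d04⟩, ⟨d12, d13, d14⟩, ⟨d23, d24⟩, d34⟩ := hnd'
  refine red5 h.cub (v0 := v) (v1 := x) (v2 := y) (v3 := z) (v4 := p) (w0 := m v) (w1 := m x) (w2 := m y) (w3 := m z) (w4 := m p)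
    ⟨?_, ?_, ?_, ?_, ?_, ?_⟩ m h.cut h.inv rfl rfl rfl rfl rfl
  · exact N3.of3 (h.cub.deg v vW) fvp.1 c1.1 (h.adj v vW) (Ne.symm d14) fvp.2.1.symm c1.2.1.symm
  · exact N3.of3 (h.cub.deg x xW) c1.1.symm c2.1 (h.adj x xW) d02 c1.2.2.symm c2.2.1.symm
  · exact N3.of3 (h.cub.deg y yW) c2.1.symm c3.1 (h.adj y yW) d13 c2.2.2.symm c3.2.1.symm
  · exact N3.of3 (h.cub.deg z zW) c3.1.symm c4.1 (h.adj z zW) d24 c3.2.2.symm c4.2.1.symm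
  · exact N3.of3 (h.cub.deg p pW) c4.1.symm fvp.1.symm (h.adj p pW) (Ne.symm d03) c4.2.2.symm fvp.2.2.symm
  · have e : [v,x,y,z,p, m v, m x, m y, m z, m p] = [v,x,y,z,p] ++ [v,x,y,z,p].map m := rfl
    rw [e, List.nodup_append]
    refine ⟨hnd, ?_, ?_⟩
    · exact List.Nodup.map_on (fun a ha b hb e => h.inj (hWW a ha) (hWW b hb) e) hnd
    · intro a ha b hb e
      rw [List.mem_map] at hb
      obtain ⟨c, hc, rfl⟩ := hb
      exact hall c ((hm c).1 hc) (e ▸ (hm a).1 ha)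

namespace Cx
variable {G : SimpleGraph V} {W : Finset V} {m : V → V}

open Classical in
lemma packing (h : Cx G W m) : ∃ P : Finset (Finset V), (∀ U ∈ P, GU G W m U) ∧ (∀ U ∈ P, ∀ U' ∈ P, U ≠ U' → Disjoint U U') ∧
    ∀ U, GU G W m U → ∃ U' ∈ P, ¬ Disjoint U U' := by
  obtain ⟨P, hP, hmax⟩ := exists_max_image
    ((univ : Finset (Finset (Finset V))).filter (fun P => (∀ U ∈ P, GU G W m U) ∧ (∀ U ∈ P, ∀ U' ∈ P, U ≠ U' → Disjoint U U')))
    card ⟨∅, by simp⟩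
  rw [mem_filter] at hP
  refine ⟨P, hP.2.1, hP.2.2, fun U hU => ?_⟩
  by_contra hne
  push Not at hne
  have hUP : U ∉ P := by
    intro hh
    have := hne U hh
    rw [disjoint_self_iff_empty] at this
    have h12 := hU.2.2.2.1
    rw [this] at h12; simp at h12
  have := hmax (insert U P) (by
    rw [mem_filter]
    refine ⟨mem_univ _, ?_, ?_⟩
    · intro X hX; rw [mem_insert] at hX
      rcases hX with rfl | hX
      · exact hU
      · exact hP.2.1 X hX
    · intro X hX Y hY hXY
      rw [mem_insert] at hX hY
      rcases hX with rfl | hX <;> rcases hY with rfl | hY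
      · exact absurd rfl hXY
      · exact hne Y hY
      · exact (hne X hX).symm
      · exact hP.2.2 X hX Y hY hXY)
  rw [card_insert_of_notMem hUP] at this
  omega

open Classical in
lemma merge (h : Cx G W m) : ∃ k p, Good G W k ∧ k + 2 * p ≤ 2 * (CS G W m).card ∧
    ((ZS G).filter (AL m)).card ≤ 108 * ((NC G W m 4).card + (NB G W m).card + 18 * p) := by
  obtain ⟨P, hP, hPd, hmax⟩ := h.packing
  set PU := P.biUnion id with hPU
  have hPUc : PU.card = ∑ X ∈ P, X.card := by
    rw [hPU, card_biUnion]
    · rfl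
    · intro X hX Y hY hne; exact hPd X hX Y hY hne
  have hPUW : PU ⊆ W := by rw [hPU, biUnion_subset]; exact fun X hX => (hP X hX).1
  have hPUF : FC (fg G m) PU := by
    intro u v hu huv
    rw [hPU, mem_biUnion] at *
    obtain ⟨X, hX, hu⟩ := hu
    exact ⟨X, hX, (hP X hX).2.1 u v hu huv⟩
  have hup : PU.card ≤ 18 * P.card := by
    rw [hPUc]
    have := sum_le_sum (fun X hX => (hP X hX).2.2.2.2.1)
    simp only [sum_const, smul_eq_mul] at this; linarith
  have hlo : 12 * P.card ≤ PU.card := by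
    rw [hPUc]
    have := sum_le_sum (fun X hX => (hP X hX).2.2.2.1)
    simp only [sum_const, smul_eq_mul] at this; linarith
  have hin : PU.card ≤ 6 * ((CS G W m).filter (fun D => D ⊆ PU)).card := by
    rw [h.fib PU hPUW, ← sum_filter_add_sum_filter_not (CS G W m) (fun D => D ⊆ PU)]
    have e1 : ∑ D ∈ (CS G W m).filter (fun D => ¬ D ⊆ PU), (D ∩ PU).card = 0 := by
      apply sum_eq_zero
      intro D hD
      rw [mem_filter] at hD
      rw [card_eq_zero, eq_empty_iff_forall_notMem]
      intro x hx
      rw [mem_inter] at hx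
      apply hD.2
      have := hD.1
      unfold CS at this; rw [mem_image] at this
      obtain ⟨v, hv, rfl⟩ := this
      rw [← cmp_eq hx.1]
      exact hPUF.cmp_sub hx.2
    have e2 : ∑ D ∈ (CS G W m).filter (fun D => D ⊆ PU), (D ∩ PU).card ≤ ∑ D ∈ (CS G W m).filter (fun D => D ⊆ PU), 6 := by
      apply sum_le_sum
      intro D hD
      rw [mem_filter] at hD
      obtain ⟨h1, h2⟩ := hD
      unfold CS at h1; rw [mem_image] at h1
      obtain ⟨v, hv, rfl⟩ := h1
      have hvP := h2 self_mem_cmp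
      rw [hPU, mem_biUnion] at hvP
      obtain ⟨X, hX, hvX⟩ := hvP
      have := (hP X hX).2.2.1 v hvX
      rw [← this]; exact card_le_card inter_subset_left
    rw [e1]
    simp only [sum_const, smul_eq_mul] at e2
    linarith
  have hsplit := card_filter_add_card_filter_not (s := CS G W m) (fun D => D ⊆ PU)
  refine ⟨_, P.card, good_parts (P ∪ (CS G W m).filter (fun D => ¬ D ⊆ PU)) ?_ ?_ ?_, ?_, ?_⟩
  · intro U hU
    rw [mem_union, mem_filter] at hU
    rcases hU with hU | ⟨hU, -⟩
    · exact ⟨(hP U hU).1, (hP U hU).2.2.2.2.2⟩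
    · unfold CS at hU; rw [mem_image] at hU
      obtain ⟨v, hv, rfl⟩ := hU
      exact ⟨h.cmp_sub hv, h.ham_cpt hv⟩
  · have hx : ∀ U ∈ P, ∀ D ∈ (CS G W m).filter (fun D => ¬ D ⊆ PU), Disjoint U D := by
      intro U hU D hD
      rw [Finset.disjoint_left]
      intro x hxU hxD
      rw [mem_filter] at hD
      obtain ⟨h1, h2⟩ := hD
      apply h2
      unfold CS at h1; rw [mem_image] at h1
      obtain ⟨v, hv, rfl⟩ := h1
      rw [← cmp_eq hxD]
      exact hPUF.cmp_sub (by rw [hPU, mem_biUnion]; exact ⟨U, hU, hxU⟩)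
    intro U hU U' hU' hne
    rw [mem_union] at hU hU'
    rcases hU with hU | hU <;> rcases hU' with hU' | hU'
    · exact hPd U hU U' hU' hne
    · exact hx U hU U' hU'
    · exact (hx U' hU' U hU).symm
    · rw [mem_filter] at hU hU'
      have h1 := hU.1; have h2 := hU'.1
      unfold CS at h1 h2; rw [mem_image] at h1 h2
      obtain ⟨v, hv, rfl⟩ := h1
      obtain ⟨w, hw, rfl⟩ := h2
      exact cdisj (fun hh => hne (cmp_eq hh).symm)
  · intro w hw
    by_cases hwP : w ∈ PU
    · have := hwP
      rw [hPU, mem_biUnion] at this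
      obtain ⟨X, hX, hwX⟩ := this
      exact ⟨X, mem_union_left _ hX, hwX⟩
    · refine ⟨cpt (fg G m) w, mem_union_right _ (mem_filter.2 ⟨mem_image_of_mem _ hw, fun hh => hwP (hh self_mem_cmp)⟩), self_mem_cmp⟩
  · have := card_union_le P ((CS G W m).filter (fun D => ¬ D ⊆ PU))
    omega
  · have hT := h.alT (NC G W m 4 ∪ NB G W m ∪ PU) ?_
    · have c1 := card_union_le (NC G W m 4 ∪ NB G W m) PU
      have c2 := card_union_le (NC G W m 4) (NB G W m)
      calc _ ≤ _ := hT
        _ ≤ _ := Nat.mul_le_mul_left _ (by omega)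
    · intro Z hZ
      rw [mem_filter, mem_ZS] at hZ
      obtain ⟨hI, hA⟩ := hZ
      have hZW : ∀ i, Z i ∈ W := fun i => (h.cub.adj_mem (hI.2.1 i)).1
      by_cases h6 : ∀ i, (cpt (fg G m) (Z i)).card = 6
      · obtain ⟨U, hU, hUi⟩ := h.alt6 hI hA h6
        obtain ⟨X, hX, hnd⟩ := hmax U hU
        rw [not_disjoint_iff] at hnd
        obtain ⟨x, hxU, hxX⟩ := hnd
        obtain ⟨i, hi⟩ := hUi x hxU
        refine ⟨i, mem_union_right _ ?_⟩
        have hxP : x ∈ PU := by rw [hPU, mem_biUnion]; exact ⟨X, hX, hxX⟩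
        apply hPUF.cmp_sub hxP
        rw [cmp_eq hi]; exact self_mem_cmp
      · push Not at h6
        obtain ⟨i, hi⟩ := h6
        refine ⟨i, mem_union_left _ ?_⟩
        unfold NC NB
        rw [mem_union, mem_filter, mem_filter]
        have := h.card_cases (hZW i)
        rcases this with hc | hc | hc
        · exact Or.inl ⟨hZW i, hc⟩
        · exact absurd hc hi
        · exact Or.inr ⟨hZW i, hc⟩

end Cx
end K7

set_option linter.unusedSectionVars false
set_option linter.unusedVariables false
set_option linter.unusedSimpArgs false
section K8
variable {V : Type*} [Fintype V] [DecidableEq V]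
open Finset

lemma Cx.done {G : SimpleGraph V} {W : Finset V} {m : V → V} (h : Cx G W m)
    (hw : 2000 * (4 * (QS G W).card) + 6 * (ZS G).card ≤ 3 * (2000 * ∑ Z ∈ QS G W, mu m Z + ∑ Z ∈ ZS G, mu m Z)) :
    ∃ k, Good G W k ∧ 61236 * k ≤ 20411 * W.card := by
  obtain ⟨k, p, hG, hk, hA⟩ := h.merge
  refine ⟨k, hG, ?_⟩
  have a4 := wsum (QS G W) (mu m) (fun Z => (m (Z 0) = Z 1 ∧ m (Z 2) = Z 3) ∨ (m (Z 1) = Z 2 ∧ m (Z 3) = Z 0)) 4 2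
    (fun Z hZ => h.toMt.mu4 (fun i => (h.cub.adj_mem (QS_adj Z hZ i)).1) (QS_inj Z hZ))
  have a6 := wsum (ZS G) (mu m) (AL m) 6 3 (fun Z hZ => by
    have := h.toMt.mu6 (fun i => (h.cub.adj_mem ((mem_ZS.1 hZ).2.1 i)).1) (mem_ZS.1 hZ).1
    by_cases hA : AL m Z
    · rw [if_pos hA]
      rwa [if_pos (show (m (Z 0) = Z 1 ∧ m (Z 2) = Z 3 ∧ m (Z 4) = Z 5) ∨ (m (Z 1) = Z 2 ∧ m (Z 3) = Z 4 ∧ m (Z 5) = Z 0) from hA)] at this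
    · rw [if_neg hA]
      rwa [if_neg (show ¬ ((m (Z 0) = Z 1 ∧ m (Z 2) = Z 3 ∧ m (Z 4) = Z 5) ∨ (m (Z 1) = Z 2 ∧ m (Z 3) = Z 4 ∧ m (Z 5) = Z 0)) from hA)] at this)
  have q2 : ((QS G W).filter (fun Z => (m (Z 0) = Z 1 ∧ m (Z 2) = Z 3) ∨ (m (Z 1) = Z 2 ∧ m (Z 3) = Z 0))).card ≤ 2 * (LQ G W m).card := by
    convert h.q2_le
  have q0 : 2 * (NC G W m 4).card ≤ ((QS G W).filter (fun Z => mu m Z = 0)).card := by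
    convert h.q0_ge
  have z0 : (NC G W m 6).card ≤ ((ZS G).filter (fun Z => mu m Z = 0)).card := by
    convert h.z0_ge
  have ha := h.acc
  have hl := card_le_card h.LQ_sub
  have hn := h.ntot
  omega

theorem main_good : ∀ (n : ℕ) (G : SimpleGraph V) (W : Finset V), W.card = n → Cub G W → W.Nonempty →
    ∃ k, Good G W k ∧ (k ≤ 2 ∨ 61236 * k ≤ 20411 * W.card) := by
  intro n
  induction n using Nat.strong_induction_on with
  | _ n ih =>
  intro G W hn hC hne
  have red : (∃ (G' : SimpleGraph V) (W' : Finset V), Cub G' W' ∧ W'.card < W.card ∧ W'.Nonempty ∧ ∀ k, Good G' W' k → Good G W k) →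
      ∃ k, Good G W k ∧ (k ≤ 2 ∨ 61236 * k ≤ 20411 * W.card) := by
    rintro ⟨G', W', h1, h2, h3, h4⟩
    obtain ⟨k, g, hk⟩ := ih W'.card (hn ▸ h2) G' W' rfl h1 h3
    exact ⟨k, h4 k g, by omega⟩
  by_cases h6 : ∃ a b c d p q u v, D6 G a b c d p q u v
  · obtain ⟨a, b, c, d, p, q, u, v, h⟩ := h6
    exact red (red6 hC h)
  by_cases h4 : ∃ a b c d a' b' c' d', Q4 G a b c d a' b' c' d' ∧ ¬ SepP G W a b c d a' c' ∧ ¬ SepP G W a b c d b' d'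
  · obtain ⟨a, b, c, d, a', b', c', d', h, s1, s2⟩ := h4
    exact red (red4 hC h (fun A hA p1 p2 p3 p4 p5 p6 p7 => s1 ⟨A, hA, p1, p2, p3, p4, p5, p6, p7⟩)
      (fun A hA p1 p2 p3 p4 p5 p6 p7 => s2 ⟨A, hA, p1, p2, p3, p4, p5, p6, p7⟩))
  obtain ⟨m, hm, hw⟩ := hC.wpm2 (QS G W) (ZS G) QS_adj (fun Z hZ => (mem_ZS.1 hZ).2.1)
  by_cases hW : ∃ v ∈ W, cpt (fg G m) v = W
  · obtain ⟨v, hv, e⟩ := hW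
    exact ⟨2, hm.good2 hv e, Or.inl le_rfl⟩
  have nW : ∀ v ∈ W, cpt (fg G m) v ≠ W := fun v hv e => hW ⟨v, hv, e⟩
  by_cases h5 : ∃ v ∈ W, (cpt (fg G m) v).card = 5
  · obtain ⟨v, hv, e⟩ := h5
    rcases hm.five hv (nW v hv) e with g | ⟨G', W', c1, c2, c3, c4⟩
    · exact ⟨2, g, Or.inl le_rfl⟩
    · obtain ⟨k, g, hk⟩ := ih W'.card (by omega) G' W' rfl c1 (card_pos.1 (by omega))
      exact ⟨k + 1, c4 k g, by omega⟩
  have hx : Cx G W m := 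
    { hm with
      nW := nW
      n5 := fun v hv e => h5 ⟨v, hv, e⟩
      n6 := fun a b c d p q u v h => h6 ⟨a, b, c, d, p, q, u, v, h⟩
      n4 := fun a b c d a' b' c' d' h => by
        by_contra hc
        rw [not_or] at hc
        exact h4 ⟨a, b, c, d, a', b', c', d', h, hc.1, hc.2⟩ }
  obtain ⟨k, g, hk⟩ := hx.done hw
  exact ⟨k, g, Or.inr hk⟩

end K8

/-- Every 2-connected cubic simple graph `G` on `n ≥ 8` vertices admits a tour
(a closed walk visiting every vertex and traversing each edge at most twice)
of length at most `(4/3 − 1/61236)·n − 2`. -/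
theorem stmt0 {V : Type*} [Fintype V] [DecidableEq V]
    (G : SimpleGraph V) [DecidableRel G.Adj]
    (hcubic : ∀ v : V, G.degree v = 3)
    (hcard3 : 3 ≤ Fintype.card V)
    (hconn : G.Connected)
    (hdel : ∀ v : V, (G.induce ({v}ᶜ : Set V)).Connected)
    (hn : 8 ≤ Fintype.card V) :
    ∃ (a : V) (T : G.Walk a a),
      (∀ u : V, u ∈ T.support) ∧
      (∀ e : Sym2 V, T.edges.count e ≤ 2) ∧
      (T.length : ℝ) ≤ (4 / 3 - 1 / 61236) * (Fintype.card V : ℝ) - 2 := by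
  obtain ⟨k, hk, hb⟩ := main_good (Finset.univ : Finset V).card G Finset.univ rfl (cub_univ G hcubic hconn hdel)
    ⟨hconn.nonempty.some, Finset.mem_univ _⟩
  rw [Finset.card_univ] at hb
  exact final G hconn hn ⟨k, hk, hb⟩
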